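/- Let Q be a finite acyclic quiver, 𝒬• = (Q¹,…,Q^ℓ) an admissible, ordered, Dynkin subquiver partition, and β₁,…,β_r a Reineke order on Φ₊(𝒬•) with chosen vertices i(u) satisfying β_u(i(u)) = 1. Then the ℚ-linear map ⊕_{m∈ℕ^r} (𝒜_{β₁,m₁} ⊗ ⋯ ⊗ 𝒜_{β_r,m_r}) → ℋ(Q), induced on each summand by (f₁,…,f_r) ↦ f₁ * ⋯ * f_r (left-to-right CoHA product), is injective; that is, the *-multiplication-induced map 𝒜_{β₁} ⊗ ⋯ ⊗ 𝒜_{β_r} → ℋ(Q) is injective. -/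

import Mathlib

open MvPolynomial
open scoped Classical

/-- A finite quiver with vertex set `Fin n`: a finite type of arrows together with
head and tail maps. -/
structure FinQuiver (n : ℕ) where
  Arr : Type
  [fintypeArr : Fintype Arr]
  hd : Arr → Fin n
  tl : Arr → Fin n

attribute [instance] FinQuiver.fintypeArr

variable {n : ℕ}

/-- `Q` is acyclic: there is no oriented cycle, i.e. no path
`a₁, …, a_{k+1}` (with `hd aₘ = tl aₘ₊₁`) whose final head equals its initial tail. -/
def FinQuiver.Acyclic (Q : FinQuiver n) : Prop :=
  ∀ (k : ℕ) (c : Fin (k + 1) → Q.Arr),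
    (∀ m : Fin k, Q.hd (c m.castSucc) = Q.tl (c m.succ)) →
    Q.hd (c (Fin.last k)) ≠ Q.tl (c 0)

/-- The Euler form `χ_Q` of the quiver `Q`. -/
def FinQuiver.euler (Q : FinQuiver n) (α β : Fin n → ℕ) : ℤ :=
  ∑ i : Fin n, (α i : ℤ) * β i - ∑ a : Q.Arr, (α (Q.tl a) : ℤ) * β (Q.hd a)

/-- The opposite antisymmetrization `⟨α,β⟩ = χ_Q(β,α) − χ_Q(α,β)`. -/
def FinQuiver.lam (Q : FinQuiver n) (α β : Fin n → ℕ) : ℤ :=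
  Q.euler β α - Q.euler α β

/-- The polynomial ring in the variables `ω_{i,j}`, `i ∈ Q₀`, `j ∈ ℕ` (0-indexed). -/
abbrev PolyQ (n : ℕ) := MvPolynomial (Fin n × ℕ) ℚ

/-- The permutation of the variables at vertex `i` induced by a permutation of `ℕ`. -/
def vertexPerm (i : Fin n) (σ : Equiv.Perm ℕ) : Fin n × ℕ → Fin n × ℕ :=
  fun p => if p.1 = i then (i, σ p.2) else p

/-- `f` is, for each vertex `i`, symmetric in the variables `ω_{i,0},…,ω_{i,γ i − 1}`. -/
def SymmIn (γ : Fin n → ℕ) (f : PolyQ n) : Prop :=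
  ∀ (i : Fin n) (σ : Equiv.Perm ℕ),
    (∀ j : ℕ, σ j ≠ j → j < γ i) → rename (vertexPerm i σ) f = f

lemma vars_smul_subset (c : ℚ) (f : PolyQ n) : (c • f).vars ⊆ f.vars := by
  rw [MvPolynomial.smul_eq_C_mul]
  refine (MvPolynomial.vars_mul _ _).trans ?_
  simp [MvPolynomial.vars_C]

/-- `ℋ_γ`: polynomials using only the variables `ω_{i,j}`, `j < γ i`, which are
symmetric at each vertex.  A `ℚ`-submodule of `PolyQ n`. -/
noncomputable def Hspace (γ : Fin n → ℕ) : Submodule ℚ (PolyQ n) where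
  carrier := {f | (∀ p ∈ f.vars, p.2 < γ p.1) ∧ SymmIn γ f}
  add_mem' := by
    rintro f g ⟨hf1, hf2⟩ ⟨hg1, hg2⟩
    refine ⟨fun p hp => ?_, fun i σ hσ => ?_⟩
    · rcases Finset.mem_union.mp (MvPolynomial.vars_add_subset f g hp) with h | h
      exacts [hf1 p h, hg1 p h]
    · rw [map_add, hf2 i σ hσ, hg2 i σ hσ]
  zero_mem' := by
    refine ⟨fun p hp => ?_, fun i σ hσ => map_zero _⟩
    simp [MvPolynomial.vars_0] at hp
  smul_mem' := by
    rintro c f ⟨hf1, hf2⟩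
    refine ⟨fun p hp => hf1 p (vars_smul_subset c f hp), fun i σ hσ => ?_⟩
    rw [map_smul, hf2 i σ hσ]

/-- Polynomials all of whose variables sit at vertex `i`. -/
noncomputable def onlyVertex (i : Fin n) : Submodule ℚ (PolyQ n) where
  carrier := {f | ∀ p ∈ f.vars, p.1 = i}
  add_mem' := by
    intro f g hf hg p hp
    rcases Finset.mem_union.mp (MvPolynomial.vars_add_subset f g hp) with h | h
    exacts [hf p h, hg p h]
  zero_mem' := by
    intro p hp
    simp [MvPolynomial.vars_0] at hp
  smul_mem' := by
    intro c f hf p hp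
    exact hf p (vars_smul_subset c f hp)

/-- `𝒜_{β,m}`: the subspace of `ℋ_{m·β}` of polynomials depending only on the
variables `ω_{i,0},…,ω_{i,m−1}` at the distinguished vertex `i`. -/
noncomputable def Aspace (β : Fin n → ℕ) (i : Fin n) (m : ℕ) : Submodule ℚ (PolyQ n) :=
  Hspace (fun v => m * β v) ⊓ onlyVertex i

/-- Substitute for the `j`-th variable at vertex `i` the variable `ω_{i,s}` where `s`
is the `j`-th element of `T i` in increasing order. -/
noncomputable def substAlong (T : Fin n → Finset ℕ) : PolyQ n →ₐ[ℚ] PolyQ n :=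
  aeval fun p : Fin n × ℕ => X (p.1, ((T p.1).sort (· ≤ ·)).getD p.2 0)

/-- The index set of the Kontsevich–Soibelman localization sum:
for each vertex, a `γ₁ i`-element subset of `{0,…,γ₁ i + γ₂ i − 1}`. -/
def shuffles (γ₁ γ₂ : Fin n → ℕ) : Finset (Fin n → Finset ℕ) :=
  Fintype.piFinset fun i => (Finset.range (γ₁ i + γ₂ i)).powerset.filter fun s => s.card = γ₁ i

def shuffleCompl (γ₁ γ₂ : Fin n → ℕ) (S : Fin n → Finset ℕ) : Fin n → Finset ℕ :=
  fun i => Finset.range (γ₁ i + γ₂ i) \ S i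

/-- The numerator factor attached to the arrow `a`:
`∏_{j' ∈ S̄_{h a}} ∏_{j ∈ S_{t a}} (ω_{h a, j'} − ω_{t a, j})`. -/
noncomputable def arrowFactor (Q : FinQuiver n) (γ₁ γ₂ : Fin n → ℕ)
    (S : Fin n → Finset ℕ) (a : Q.Arr) : PolyQ n :=
  ∏ j' ∈ shuffleCompl γ₁ γ₂ S (Q.hd a), ∏ j ∈ S (Q.tl a),
    (X (Q.hd a, j') - X (Q.tl a, j))

noncomputable def interactionNum (Q : FinQuiver n) (γ₁ γ₂ : Fin n → ℕ)
    (S : Fin n → Finset ℕ) : PolyQ n :=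
  ∏ a : Q.Arr, arrowFactor Q γ₁ γ₂ S a

noncomputable def interactionDen (γ₁ γ₂ : Fin n → ℕ) (S : Fin n → Finset ℕ) : PolyQ n :=
  ∏ i : Fin n, ∏ j' ∈ shuffleCompl γ₁ γ₂ S i, ∏ j ∈ S i, (X (i, j') - X (i, j))

/-- The Kontsevich–Soibelman localization sum, an element of the field of rational
functions (the fraction field of `PolyQ n`). -/
noncomputable def cohaMulRat (Q : FinQuiver n) (γ₁ γ₂ : Fin n → ℕ) (f₁ f₂ : PolyQ n) :
    FractionRing (PolyQ n) :=
  ∑ S ∈ shuffles γ₁ γ₂,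
    algebraMap (PolyQ n) (FractionRing (PolyQ n))
        (substAlong S f₁ * substAlong (shuffleCompl γ₁ γ₂ S) f₂ * interactionNum Q γ₁ γ₂ S) /
      algebraMap (PolyQ n) (FractionRing (PolyQ n)) (interactionDen γ₁ γ₂ S)

/-- The CoHA product `f₁ * f₂`: the unique polynomial representing the localization
sum (and `0` if the sum were not a polynomial, which never happens). -/
noncomputable def cohaMul (Q : FinQuiver n) (γ₁ γ₂ : Fin n → ℕ) (f₁ f₂ : PolyQ n) : PolyQ n :=
  if h : ∃ P : PolyQ n,
      algebraMap (PolyQ n) (FractionRing (PolyQ n)) P = cohaMulRat Q γ₁ γ₂ f₁ f₂ then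
    h.choose
  else 0

/-- Iterated, left-to-right, CoHA product of a list of dimension-vector/polynomial pairs.
Returns the total dimension vector together with the product. -/
noncomputable def cohaProd (Q : FinQuiver n) :
    List ((Fin n → ℕ) × PolyQ n) → (Fin n → ℕ) × PolyQ n
  | [] => (fun _ => 0, 1)
  | x :: xs => xs.foldl (fun acc y => (acc.1 + y.1, cohaMul Q acc.1 y.1 acc.2 y.2)) x

/-- Left-to-right CoHA product `f 0 * f 1 * ⋯ * f (r−1)` with `f u ∈ ℋ_{γ u}`. -/
noncomputable def cohaProdFin (Q : FinQuiver n) {r : ℕ} (γ : Fin r → Fin n → ℕ)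
    (f : Fin r → PolyQ n) : PolyQ n :=
  (cohaProd Q (List.ofFn fun u => (γ u, f u))).2

/-- The quiver with one vertex and no arrows. -/
def A1 : FinQuiver 1 := { Arr := Empty, hd := Empty.elim, tl := Empty.elim }

/-- `ψ_p = x₁ ^ p ∈ ℋ₁(A₁)`. -/
noncomputable def psi (p : ℕ) : PolyQ 1 := X ((0 : Fin 1), 0) ^ p

def oneDim : Fin 1 → ℕ := fun _ => 1

/-- The simple dimension vector `e_i`. -/
def simpleDim (i : Fin n) : Fin n → ℕ := fun v => if v = i then 1 else 0

/-- A subquiver of `Q`. -/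
structure Subquiver (Q : FinQuiver n) where
  verts : Finset (Fin n)
  arrows : Finset Q.Arr
  hd_mem : ∀ a ∈ arrows, Q.hd a ∈ verts
  tl_mem : ∀ a ∈ arrows, Q.tl a ∈ verts

def Subquiver.Full {Q : FinQuiver n} (Q' : Subquiver Q) : Prop :=
  ∀ a : Q.Arr, Q.hd a ∈ Q'.verts → Q.tl a ∈ Q'.verts → a ∈ Q'.arrows

/-- Adjacency in the underlying undirected graph of a subquiver. -/
def Subquiver.Adj {Q : FinQuiver n} (Q' : Subquiver Q) (x y : Fin n) : Prop :=
  ∃ a ∈ Q'.arrows, (Q.hd a = x ∧ Q.tl a = y) ∨ (Q.hd a = y ∧ Q.tl a = x)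

def Subquiver.Connected {Q : FinQuiver n} (Q' : Subquiver Q) : Prop :=
  ∀ x ∈ Q'.verts, ∀ y ∈ Q'.verts, Relation.ReflTransGen Q'.Adj x y

/-- The Euler form of the subquiver `Q'` (on `ℤ`-valued vectors). -/
def Subquiver.eulerZ {Q : FinQuiver n} (Q' : Subquiver Q) (α β : Fin n → ℤ) : ℤ :=
  ∑ i ∈ Q'.verts, α i * β i - ∑ a ∈ Q'.arrows, α (Q.tl a) * β (Q.hd a)

/-- Positive definiteness of the Tits form of `Q'` on vectors supported on `Q'`. -/
def Subquiver.PosDefTits {Q : FinQuiver n} (Q' : Subquiver Q) : Prop :=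
  ∀ β : Fin n → ℤ, (∀ i, i ∉ Q'.verts → β i = 0) → β ≠ 0 → 0 < Q'.eulerZ β β

/-- A connected full subquiver with positive definite Tits form. -/
def Subquiver.IsDynkin {Q : FinQuiver n} (Q' : Subquiver Q) : Prop :=
  Q'.Connected ∧ Q'.Full ∧ Q'.PosDefTits

/-- A positive root of `Q'`: a nonzero dimension vector supported on `Q'` with
Tits form equal to `1`. -/
def Subquiver.IsPosRoot {Q : FinQuiver n} (Q' : Subquiver Q) (β : Fin n → ℕ) : Prop :=
  (∀ i, i ∉ Q'.verts → β i = 0) ∧ β ≠ 0 ∧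
    Q'.eulerZ (fun i => (β i : ℤ)) (fun i => (β i : ℤ)) = 1

/-- A subquiver regarded as a quiver in its own right (on the ambient vertex set). -/
def Subquiver.toQuiver {Q : FinQuiver n} (Q' : Subquiver Q) : FinQuiver n :=
  { Arr := {a : Q.Arr // a ∈ Q'.arrows}, hd := fun a => Q.hd a.1, tl := fun a => Q.tl a.1 }

/-- An (ordered list) subquiver partition `𝒬• = (Q¹,…,Q^ℓ)`: nonempty connected
subquivers whose vertex sets partition `Q₀`. -/
structure SubqPartition (Q : FinQuiver n) (ℓ : ℕ) where
  part : Fin ℓ → Subquiver Q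
  nonempty' : ∀ j, (part j).verts.Nonempty
  connected' : ∀ j, (part j).Connected
  cover : ∀ i : Fin n, ∃! j, i ∈ (part j).verts

/-- The set `𝒬•₁` of arrows belonging to one of the parts. -/
noncomputable def SubqPartition.arrs {Q : FinQuiver n} {ℓ : ℕ} (P : SubqPartition Q ℓ) : Finset Q.Arr :=
  Finset.univ.biUnion fun j => (P.part j).arrows

/-- The partition is admissible and ordered: every arrow not inside a part goes from a
later part to an earlier part (head before tail). -/
def SubqPartition.Ordered {Q : FinQuiver n} {ℓ : ℕ} (P : SubqPartition Q ℓ) : Prop :=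
  ∀ a : Q.Arr, a ∉ P.arrs → ∀ i j : Fin ℓ,
    Q.hd a ∈ (P.part i).verts → Q.tl a ∈ (P.part j).verts → i < j

/-- Every part is a Dynkin subquiver. -/
def SubqPartition.Dynkin {Q : FinQuiver n} {ℓ : ℕ} (P : SubqPartition Q ℓ) : Prop :=
  ∀ j, (P.part j).IsDynkin

/-- `β : Fin r → (Fin n → ℕ)` is a Reineke-ordered enumeration of `Φ₊(𝒬•)`, with
`blk u` the part to which `β u` belongs: block-monotone, enumerating all positive roots
without repetition, and within each block `u < v → ⟨β u, β v⟩ ≥ 0`. -/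
def IsReinekeOrder {Q : FinQuiver n} {ℓ : ℕ} (P : SubqPartition Q ℓ) {r : ℕ}
    (β : Fin r → Fin n → ℕ) (blk : Fin r → Fin ℓ) : Prop :=
  Monotone blk ∧
  (∀ u, (P.part (blk u)).IsPosRoot (β u)) ∧
  Function.Injective β ∧
  (∀ j (b : Fin n → ℕ), (P.part j).IsPosRoot b → ∃ u, β u = b) ∧
  (∀ u v : Fin r, u < v → blk u = blk v → 0 ≤ Q.lam (β u) (β v))

open scoped TensorProduct DirectSum

section RootNumerics

variable {M : Type} [AddCommGroup M] {ι : Type} [Fintype ι] [DecidableEq ι]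

/-- nonnegative integral span -/
def NSp (b : ι → M) (γ : M) : Prop := ∃ c : ι → ℤ, (∀ k, 0 ≤ c k) ∧ γ = ∑ k, c k • b k

structure RInv (χ : M →ₗ[ℤ] M →ₗ[ℤ] ℤ) (M' : AddSubgroup M) (L : List M) (b : ι → M) : Prop where
  span : ∀ x ∈ L, NSp b x
  mem : ∀ k, b k ∈ L
  pw : L.Pairwise (fun x y => χ x y ≤ 0 ∧ 0 ≤ χ y x)
  one : ∀ x ∈ L, χ x x = 1
  roots : ∀ x ∈ M', χ x x = 1 → x ∈ L ∨ -x ∈ L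
  sub : ∀ x ∈ L, x ∈ M'
  indep : ∀ c : ι → ℤ, ∑ k, c k • b k = 0 → ∀ k, c k = 0
  simp' : ∀ j k, j ≠ k → χ (b j) (b k) ≤ 0

def DecAlong (χ : M →ₗ[ℤ] M →ₗ[ℤ] ℤ) (L : List M) (γ : M) : Prop :=
  ∃ a : M → ℕ, γ = (L.map fun x => (a x : ℤ) • x).sum ∧
    L.Pairwise (fun x y => a x ≠ 0 → a y ≠ 0 → χ x y = 0)

variable {χ : M →ₗ[ℤ] M →ₗ[ℤ] ℤ} {M' : AddSubgroup M}

lemma RInv.b_inj {L : List M} {b : ι → M} (h : RInv χ M' L b) {j k : ι} (hjk : b j = b k) : j = k := by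
  by_contra hne
  have := h.indep (Pi.single j 1 - Pi.single k 1) (by
    simp [sub_smul, Finset.sum_sub_distrib, Pi.single_apply, ite_smul, hjk]) j
  simp [Pi.single_apply, hne] at this

lemma RInv.first {β : M} {L : List M} {b : ι → M} (h : RInv χ M' (β :: L) b) : ∃ i, b i = β := by
  obtain ⟨c, hc, hβ⟩ := h.span β (by simp)
  have h1 : χ β β = 1 := h.one β (by simp)
  by_contra hno
  push Not at hno
  have h2 : χ β β = ∑ k, c k * χ β (b k) := by
    conv_lhs => rw [show χ β β = χ β (∑ k, c k • b k) from by rw [← hβ]]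
    simp
  have h3 : ∑ k, c k * χ β (b k) ≤ 0 := by
    apply Finset.sum_nonpos
    intro k _
    have hk := h.mem k
    have hk2 : b k ∈ L := by
      rcases List.mem_cons.mp hk with h | h
      · exact absurd h (hno k)
      · exact h
    have := (List.pairwise_cons.mp h.pw).1 _ hk2
    nlinarith [hc k, this.1]
  omega

/-- the reflected simple system -/
def reflB (χ : M →ₗ[ℤ] M →ₗ[ℤ] ℤ) (b : ι → M) (i : ι) : ι → M :=
  fun k => if k = i then - b i else b k - χ (b i) (b k) • b i

variable {β : M} {L : List M} {b : ι → M}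

lemma RInv.memL (h : RInv χ M' (β :: L) b) {i : ι} (hi : b i = β) {k : ι} (hk : k ≠ i) : b k ∈ L := by
  rcases List.mem_cons.mp (h.mem k) with h' | h'
  · exact absurd (h.b_inj (h'.trans hi.symm)) hk
  · exact h'

lemma RInv.chi_right (h : RInv χ M' (β :: L) b) {i : ι} (hi : b i = β) {k : ι} (hk : k ≠ i) :
    χ (b k) β = 0 := by
  have h1 := ((List.pairwise_cons.mp h.pw).1 _ (h.memL hi hk)).2
  have h2 := h.simp' k i hk
  rw [hi] at h2
  omega

lemma RInv.chi_sum_right (h : RInv χ M' (β :: L) b) {i : ι} (hi : b i = β) (c : ι → ℤ) :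
    χ (∑ k, c k • b k) β = c i := by
  have h1 : χ β β = 1 := h.one β (by simp)
  simp only [map_sum, map_smul, LinearMap.sum_apply, LinearMap.smul_apply, smul_eq_mul]
  rw [Finset.sum_eq_single i]
  · rw [hi, h1, mul_one]
  · intro k _ hk
    rw [h.chi_right hi hk, mul_zero]
  · simp

/-- if `χ(β,γ) ≤ 0` then `γ` is in the reflected cone -/
lemma RInv.reflSpan (h : RInv χ M' (β :: L) b) {i : ι} (hi : b i = β) {γ : M}
    (hγ : NSp b γ) (hle : χ β γ ≤ 0) : NSp (reflB χ b i) γ := by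
  obtain ⟨c, hc, rfl⟩ := hγ
  have h1 : χ β β = 1 := h.one β (by simp)
  have e2 : χ β (∑ k, c k • b k) = c i + ∑ x ∈ Finset.univ.erase i, c x * χ β (b x) := by
    rw [← Finset.add_sum_erase _ _ (Finset.mem_univ i)]
    simp [hi, h1]
  generalize χ β (∑ k, c k • b k) = t at hle e2
  refine ⟨fun k => if k = i then - t else c k, ?_, ?_⟩
  · intro k
    dsimp only
    split_ifs
    · omega
    · exact hc k
  · have e1 : ∑ x ∈ Finset.univ.erase i, (if x = i then - t else c x) • reflB χ b i x
        = ∑ x ∈ Finset.univ.erase i, (c x • b x - (c x * χ β (b x)) • β) := by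
      refine Finset.sum_congr rfl fun x hx => ?_
      have hx := (Finset.mem_erase.mp hx).1
      simp [reflB, hx, hi, smul_sub, mul_smul]
    rw [← Finset.add_sum_erase _ _ (Finset.mem_univ i), ← Finset.add_sum_erase Finset.univ (fun k => (if k = i then - t else c k) • reflB χ b i k) (Finset.mem_univ i)]
    rw [e1, e2, Finset.sum_sub_distrib, ← Finset.sum_smul]
    simp only [reflB, if_true, hi]
    simp only [neg_smul, smul_neg, neg_neg, add_smul]
    abel

lemma RInv.rotate (hpos : ∀ x ∈ M', x ≠ 0 → 0 < χ x x)
    (h : RInv χ M' (β :: L) b) {i : ι} (hi : b i = β) :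
    RInv χ M' (L ++ [-β]) (reflB χ b i) := by
  have h1 : χ β β = 1 := h.one β (by simp)
  have hc : ∀ k, k ≠ i → (χ β (b k) = 0 ∨ χ β (b k) = -1) := by
    intro k hk
    have hk1 := ((List.pairwise_cons.mp h.pw).1 _ (h.memL hi hk)).1
    have hne : b k + β ≠ 0 := by
      intro h0
      have := h.indep (Pi.single k 1 + Pi.single i 1) (by
        simp [add_smul, Finset.sum_add_distrib, Pi.single_apply, ite_smul, hi, h0]) k
      simp [Pi.single_apply, hk] at this
    have := hpos _ (M'.add_mem (h.sub _ (h.mem k)) (h.sub β (by simp))) hne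
    simp only [map_add, LinearMap.add_apply, h1, h.one _ (h.mem k), h.chi_right hi hk] at this
    omega
  refine ⟨?_, ?_, ?_, ?_, ?_, ?_, ?_, ?_⟩
  · intro x hx
    rcases List.mem_append.mp hx with hx | hx
    · exact h.reflSpan hi (h.span x (by simp [hx])) ((List.pairwise_cons.mp h.pw).1 _ hx).1
    · rw [List.mem_singleton] at hx
      refine ⟨Pi.single i 1, fun k => ?_, ?_⟩
      · by_cases hk : k = i <;> simp [Pi.single_apply, hk]
      · rw [Finset.sum_eq_single i]
        · simp [reflB, hi, hx]
        · intro k _ hk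
          simp [Pi.single_apply, hk]
        · simp
  · intro k
    by_cases hk : k = i
    · simp [reflB, hk, hi]
    · have hb : reflB χ b i k = b k - χ β (b k) • β := by simp [reflB, hk, hi]
      rw [hb]
      apply List.mem_append_left
      rcases hc k hk with h0 | h0
      · simpa [h0] using h.memL hi hk
      · have hq : χ (b k + β) (b k + β) = 1 := by
          simp only [map_add, LinearMap.add_apply, h1, h.one _ (h.mem k), h.chi_right hi hk, h0]; norm_num
        have e : b k - χ β (b k) • β = b k + β := by simp [h0]
        rw [e]
        rcases h.roots _ (M'.add_mem (h.sub _ (h.mem k)) (h.sub β (by simp))) hq with hm | hm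
        · rcases List.mem_cons.mp hm with hm | hm
          · exfalso
            have : b k = 0 := by simpa using hm
            have h2 := h.one _ (h.mem k)
            rw [this] at h2; simp at h2
          · exact hm
        · exfalso
          obtain ⟨c, hc', hc2⟩ := h.span _ hm
          have := h.indep (c + Pi.single k 1 + Pi.single i 1) (by
            simp only [Pi.add_apply, add_smul, Finset.sum_add_distrib, ← hc2]
            simp [Pi.single_apply, ite_smul, hi]) k
          have h3 := hc' k
          simp [Pi.single_apply, hk] at this
          omega
  · rw [List.pairwise_append]
    refine ⟨(List.pairwise_cons.mp h.pw).2, by simp, ?_⟩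
    intro x hx y hy
    rw [List.mem_singleton] at hy
    subst hy
    have := (List.pairwise_cons.mp h.pw).1 _ hx
    simp only [map_neg, LinearMap.neg_apply]
    omega
  · intro x hx
    rcases List.mem_append.mp hx with hx | hx
    · exact h.one x (by simp [hx])
    · rw [List.mem_singleton] at hx
      subst hx; simp [h1]
  · intro x hx hq
    have := h.roots x hx hq
    simp only [List.mem_cons, List.mem_append, List.mem_singleton, List.not_mem_nil, or_false, neg_inj] at this ⊢
    rcases this with (h | h) | (h | h)
    · right; right; exact h
    · left; left; exact h
    · left; right; rw [← h, neg_neg]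
    · right; left; exact h
  · intro x hx
    rcases List.mem_append.mp hx with hx | hx
    · exact h.sub x (by simp [hx])
    · rw [List.mem_singleton] at hx
      subst hx
      exact M'.neg_mem (h.sub β (by simp))
  · intro c hc0
    have key : ∑ k, (if k = i then - c i - ∑ x ∈ Finset.univ.erase i, c x * χ β (b x) else c k) • b k = 0 := by
      rw [← hc0, ← Finset.add_sum_erase _ _ (Finset.mem_univ i), ← Finset.add_sum_erase Finset.univ (fun k => c k • reflB χ b i k) (Finset.mem_univ i)]
      have e1 : ∑ x ∈ Finset.univ.erase i, c x • reflB χ b i x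
          = ∑ x ∈ Finset.univ.erase i, (c x • b x - (c x * χ β (b x)) • β) := by
        refine Finset.sum_congr rfl fun x hx => ?_
        have hx := (Finset.mem_erase.mp hx).1
        simp [reflB, hx, hi, smul_sub, mul_smul]
      have e2 : ∑ x ∈ Finset.univ.erase i, (if x = i then - c i - ∑ x ∈ Finset.univ.erase i, c x * χ β (b x) else c x) • b x
          = ∑ x ∈ Finset.univ.erase i, c x • b x := by
        refine Finset.sum_congr rfl fun x hx => ?_
        have hx := (Finset.mem_erase.mp hx).1
        simp [hx]
      rw [e1, e2, Finset.sum_sub_distrib, ← Finset.sum_smul]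
      simp only [reflB, if_true, hi]
      simp only [smul_neg, sub_smul, neg_smul]
      abel
    have h0 := h.indep _ key
    have hz : ∀ k, k ≠ i → c k = 0 := by
      intro k hk
      simpa [hk] using h0 k
    intro k
    by_cases hk : k = i
    · subst hk
      have := h0 k
      rw [if_pos rfl, Finset.sum_eq_zero] at this
      · omega
      · intro x hx
        rw [hz x (Finset.mem_erase.mp hx).1, zero_mul]
    · exact hz k hk
  · intro j k hjk
    by_cases hj : j = i
    · have hk : k ≠ i := fun h => hjk (hj.trans h.symm)
      simp [reflB, hj, hk, hi, h1]
    · by_cases hk : k = i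
      · simp [reflB, hj, hk, hi, h1, h.chi_right hi hj]
        exact ((List.pairwise_cons.mp h.pw).1 _ (h.memL hi hj)).1
      · simp [reflB, hj, hk, hi, h1, h.chi_right hi hj]
        exact h.simp' j k hjk

lemma chi_listsum_right (L : List M) (a : M → ℕ) (y : M) :
    χ (L.map fun x => (a x : ℤ) • x).sum y = (L.map fun x => (a x : ℤ) * χ x y).sum := by
  induction L with
  | nil => simp
  | cons x L ih => simp only [List.map_cons, List.sum_cons, map_add, map_smul, LinearMap.add_apply, LinearMap.smul_apply, smul_eq_mul, ih]

lemma chi_listsum_left (L : List M) (a : M → ℕ) (y : M) :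
    χ y (L.map fun x => (a x : ℤ) • x).sum = (L.map fun x => (a x : ℤ) * χ y x).sum := by
  induction L with
  | nil => simp
  | cons x L ih => simp only [List.map_cons, List.sum_cons, map_add, map_smul, LinearMap.add_apply, LinearMap.smul_apply, smul_eq_mul, ih]

lemma list_sum_nonpos_zero (L : List M) (f : M → ℤ) (hf : ∀ x ∈ L, f x ≤ 0)
    (hs : (L.map f).sum = 0) : ∀ x ∈ L, f x = 0 := by
  have aux : ∀ L : List M, (∀ x ∈ L, f x ≤ 0) → (L.map f).sum ≤ 0 := by
    intro L hL
    induction L with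
    | nil => simp
    | cons x L ih =>
      simp only [List.map_cons, List.sum_cons]
      have := ih (fun y hy => hL y (by simp [hy]))
      have := hL x (by simp)
      omega
  induction L with
  | nil => simp
  | cons x L ih =>
    simp only [List.map_cons, List.sum_cons] at hs
    have h1 := aux L (fun y hy => hf y (by simp [hy]))
    have h2 := hf x (by simp)
    intro y hy
    rcases List.mem_cons.mp hy with rfl | hy
    · omega
    · exact ih (fun y hy => hf y (by simp [hy])) (by omega) y hy

lemma RInv.step (h : RInv χ M' (β :: L) b) {i : ι} (hi : b i = β) {γ : M} (c : ℕ)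
    (hγ : NSp b γ) (hc : c ≠ 0 → χ β γ = 0) (hd : DecAlong χ (L ++ [-β]) γ) :
    DecAlong χ (β :: L) (γ + (c : ℤ) • β) := by
  classical
  obtain ⟨a, ha, hp⟩ := hd
  have h1 : χ β β = 1 := h.one β (by simp)
  obtain ⟨d, hd0, hd1⟩ := hγ
  rw [List.pairwise_append] at hp
  have hz : a (-β) = 0 := by
    by_contra hne
    have e1 : χ γ β = d i := by rw [hd1]; exact h.chi_sum_right hi d
    have e2 : χ γ β = - (a (-β) : ℤ) := by
      rw [ha, chi_listsum_right, List.map_append, List.sum_append]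
      have : (L.map fun x => (a x : ℤ) * χ x β).sum = 0 := by
        apply List.sum_eq_zero
        intro y hy
        obtain ⟨x, hx, rfl⟩ := List.mem_map.mp hy
        by_cases hx0 : a x = 0
        · simp [hx0]
        · have := hp.2.2 x hx (-β) (by simp) hx0 hne
          simp at this
          simp [this]
      rw [this]
      simp [h1]
    have := hd0 i
    omega
  have hβL : ∀ x ∈ L, x ≠ β := by
    intro x hx he
    have := ((List.pairwise_cons.mp h.pw).1 _ hx).1
    rw [he, h1] at this
    omega
  have hγL : γ = (L.map fun x => (a x : ℤ) • x).sum := by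
    rw [ha]; simp [hz]
  refine ⟨fun x => if x = β then c else a x, ?_, ?_⟩
  · have : (L.map fun x => (((if x = β then c else a x : ℕ)) : ℤ) • x) = L.map fun x => (a x : ℤ) • x := by
      apply List.map_congr_left
      intro x hx
      simp [hβL x hx]
    rw [List.map_cons, List.sum_cons, this, ← hγL]
    simp [add_comm]
  · rw [List.pairwise_cons]
    constructor
    · intro x hx hc0 hx0
      simp only [if_true] at hc0
      simp only [if_neg (hβL x hx)] at hx0
      have e := hc hc0
      rw [hγL, chi_listsum_left] at e
      have := list_sum_nonpos_zero L (fun x => (a x : ℤ) * χ β x) (fun x hx => by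
        have := ((List.pairwise_cons.mp h.pw).1 _ hx).1
        have h2 : (0 : ℤ) ≤ a x := by positivity
        nlinarith) e x hx
      rcases mul_eq_zero.mp this with h | h
      · exact absurd (by exact_mod_cast h) hx0
      · exact h
    · refine hp.1.imp_of_mem ?_
      intro x y hx hy hxy
      simp only [if_neg (hβL x hx), if_neg (hβL y hy)]
      exact hxy

theorem RInv.dec (hpos : ∀ x ∈ M', x ≠ 0 → 0 < χ x x) :
    ∀ (d : ℕ) (L0 : List M) (b0 : ι → M), RInv χ M' L0 b0 → ∀ γ, γ ∈ M' → NSp b0 γ → χ γ γ ≤ d →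
      DecAlong χ L0 γ := by
  intro d
  induction d using Nat.strong_induction_on with
  | _ d IH =>
  intro L0 b0 h0 γ hγM hγ0 hq
  have main : ∀ (L2 L1 : List M) (b : ι → M), L0 = L1 ++ L2 →
      RInv χ M' (L2 ++ L1.map (fun x => -x)) b → NSp b γ → DecAlong χ (L2 ++ L1.map (fun x => -x)) γ := by
    intro L2
    induction L2 with
    | nil =>
      intro L1 b hL hb hγ
      have hz : γ = 0 := by
        obtain ⟨c, hc, hγc⟩ := hγ0
        have hneg : NSp b0 (-γ) := by
          obtain ⟨e, he, hγe⟩ := hγ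
          have hb' : ∀ k, NSp b0 (- b k) := by
            intro k
            have := hb.mem k
            simp only [List.nil_append, List.mem_map] at this
            obtain ⟨x, hx, hxe⟩ := this
            rw [← hxe, neg_neg]
            exact h0.span x (by simp [hL, hx])
          choose f hf hfe using hb'
          refine ⟨fun l => ∑ k, e k * f k l, fun l => Finset.sum_nonneg fun k _ => mul_nonneg (he k) (hf k l), ?_⟩
          rw [hγe, ← Finset.sum_neg_distrib]
          simp only [Finset.sum_smul]
          rw [Finset.sum_comm]
          refine Finset.sum_congr rfl fun k _ => ?_
          rw [← smul_neg, hfe k, Finset.smul_sum]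
          simp [mul_smul]
        obtain ⟨c', hc', hγc'⟩ := hneg
        have h3 := h0.indep (fun k => c k + c' k) (by
          simp only [add_smul, Finset.sum_add_distrib, ← hγc, ← hγc', add_neg_cancel])
        rw [hγc]
        apply Finset.sum_eq_zero
        intro k _
        have := h3 k; have := hc k; have := hc' k
        have : c k = 0 := by omega
        simp [this]
      refine ⟨fun _ => 0, by rw [hz]; symm; apply List.sum_eq_zero; simp, ?_⟩
      apply List.pairwise_of_forall
      intro x y hx; simp at hx
    | cons β L2 ih =>
      intro L1 b hL hb hγ
      have hb' : RInv χ M' (β :: (L2 ++ L1.map (fun x => -x))) b := hb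
      obtain ⟨i, hi⟩ := hb'.first
      have hrot := hb'.rotate hpos hi
      have h1 : χ β β = 1 := hb'.one β (by simp)
      by_cases hle : χ β γ ≤ 0
      · have := ih (L1 ++ [β]) (reflB χ b i) (by simp [hL]) (by simpa using hrot) (hb'.reflSpan hi hγ hle)
        have := hb'.step hi (γ := γ) 0 hγ (by simp) (by simpa using this)
        simpa using this
      · push Not at hle
        obtain ⟨c, hcc⟩ : ∃ c : ℕ, χ β γ = c := ⟨(χ β γ).toNat, by omega⟩
        have hspan : NSp b (γ - (c : ℤ) • β) := by
          obtain ⟨e, he, hγe⟩ := hγ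
          refine ⟨e - Pi.single i (c : ℤ), ?_, ?_⟩
          · intro k
            by_cases hk : k = i
            · subst hk
              simp only [Pi.sub_apply, Pi.single_eq_same]
              have : χ β γ ≤ e k := by
                rw [hγe, map_sum, ← Finset.add_sum_erase _ _ (Finset.mem_univ k)]
                have : ∑ x ∈ Finset.univ.erase k, χ β (e x • b x) ≤ 0 := by
                  apply Finset.sum_nonpos
                  intro x hx
                  have := ((List.pairwise_cons.mp hb'.pw).1 _ (hb'.memL hi (Finset.mem_erase.mp hx).1)).1
                  rw [map_smul, smul_eq_mul]
                  nlinarith [he x]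
                rw [map_smul, hi, h1]
                simp only [smul_eq_mul, mul_one]
                omega
              omega
            · simp [Pi.single_apply, hk, he k]
          · simp [sub_smul, Finset.sum_sub_distrib, Pi.single_apply, ite_smul, hi, hγe]
        have hz : χ β (γ - (c : ℤ) • β) = 0 := by
          simp [h1, hcc]
        have hβM : β ∈ M' := hb'.sub β (by simp)
        have hM2 : γ - (c : ℤ) • β ∈ M' := M'.sub_mem hγM (M'.zsmul_mem hβM _)
        have hnn : 0 ≤ χ (γ - (c : ℤ) • β) (γ - (c : ℤ) • β) := by
          by_cases h : γ - (c : ℤ) • β = 0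
          · rw [h]; simp
          · exact (hpos _ hM2 h).le
        have hlt : χ (γ - (c : ℤ) • β) (γ - (c : ℤ) • β) < χ γ γ := by
          obtain ⟨e, he, hγe⟩ := hspan
          have e1 : χ (γ - (c : ℤ) • β) β = e i := by rw [hγe]; exact hb'.chi_sum_right hi e
          have e2 : χ γ γ = χ (γ - (c : ℤ) • β) (γ - (c : ℤ) • β) + c * χ (γ - (c : ℤ) • β) β
              + c * χ β (γ - (c : ℤ) • β) + c * c := by
            simp [h1]; ring
          rw [e2, hz, e1]
          have := he i
          have hc0 : 0 < (c : ℤ) := by omega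
          nlinarith
        have := IH (χ (γ - (c : ℤ) • β) (γ - (c : ℤ) • β)).toNat (by omega) _ _ hrot _ hM2
          (hb'.reflSpan hi hspan hz.le) (by omega)
        have := hb'.step hi c hspan (fun _ => hz) this
        simpa using this
  have := main L0 [] b0 (by simp) (by simpa using h0) hγ0
  simpa using this

end RootNumerics

noncomputable def chiZ (Q : FinQuiver n) : (Fin n → ℤ) →ₗ[ℤ] (Fin n → ℤ) →ₗ[ℤ] ℤ :=
  LinearMap.mk₂ ℤ (fun α β => ∑ i : Fin n, α i * β i - ∑ a : Q.Arr, α (Q.tl a) * β (Q.hd a))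
    (by intro x y z; simp only [Pi.add_apply, add_mul, Finset.sum_add_distrib]; ring)
    (by intro c x y; simp only [Pi.smul_apply, smul_eq_mul, mul_sub, Finset.mul_sum, mul_assoc])
    (by intro x y z; simp only [Pi.add_apply, mul_add, Finset.sum_add_distrib]; ring)
    (by intro c x y; simp only [Pi.smul_apply, smul_eq_mul, mul_sub, Finset.mul_sum, mul_left_comm])

lemma chiZ_apply (Q : FinQuiver n) (x y : Fin n → ℤ) :
    chiZ Q x y = ∑ i : Fin n, x i * y i - ∑ a : Q.Arr, x (Q.tl a) * y (Q.hd a) := rfl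

lemma euler_eq_chiZ (Q : FinQuiver n) (α β : Fin n → ℕ) :
    Q.euler α β = chiZ Q (fun i => (α i : ℤ)) (fun i => (β i : ℤ)) := rfl

lemma chiZ_eq_eulerZ {Q : FinQuiver n} (Q' : Subquiver Q) (hF : Q'.Full) (x y : Fin n → ℤ)
    (hx : ∀ i, i ∉ Q'.verts → x i = 0) (hy : ∀ i, i ∉ Q'.verts → y i = 0) :
    chiZ Q x y = Q'.eulerZ x y := by
  rw [chiZ_apply, Subquiver.eulerZ]
  congr 1
  · symm
    apply Finset.sum_subset (Finset.subset_univ _)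
    intro i _ hi; rw [hx i hi, zero_mul]
  · symm
    apply Finset.sum_subset (Finset.subset_univ _)
    intro a _ ha
    by_cases h1 : Q.hd a ∈ Q'.verts
    · by_cases h2 : Q.tl a ∈ Q'.verts
      · exact absurd (hF a h1 h2) ha
      · rw [hx _ h2, zero_mul]
    · rw [hy _ h1, mul_zero]

lemma chiZ_nonpos_of_disj (Q : FinQuiver n) (x y : Fin n → ℤ) (hx : ∀ i, 0 ≤ x i) (hy : ∀ i, 0 ≤ y i)
    (hd : ∀ i, x i * y i = 0) : chiZ Q x y ≤ 0 := by
  rw [chiZ_apply]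
  have h1 : ∑ i, x i * y i = 0 := Finset.sum_eq_zero fun i _ => hd i
  have h2 : 0 ≤ ∑ a : Q.Arr, x (Q.tl a) * y (Q.hd a) :=
    Finset.sum_nonneg fun a _ => mul_nonneg (hx _) (hy _)
  omega

structure RData (Q : FinQuiver n) {r : ℕ} (β : Fin r → Fin n → ℕ) : Prop where
  noloop : ∀ a : Q.Arr, Q.hd a ≠ Q.tl a
  one : ∀ u, Q.euler (β u) (β u) = 1
  neg : ∀ u v, u < v → Q.euler (β u) (β v) ≤ 0
  dec : ∀ u (α : Fin n → ℕ), (∀ i, α i ≤ β u i) → ∃ a : Fin r → ℕ,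
    (∀ i, α i = ∑ w, a w * β w i) ∧
    ∀ w w', w < w' → a w ≠ 0 → a w' ≠ 0 → Q.euler (β w) (β w') = 0

theorem rdata {ℓ r : ℕ} (Q : FinQuiver n) (hQ : Q.Acyclic)
    (P : SubqPartition Q ℓ) (hDyn : P.Dynkin)
    (β : Fin r → Fin n → ℕ) (blk : Fin r → Fin ℓ) (hR : IsReinekeOrder P β blk) :
    RData Q β := by
  obtain ⟨hmono, hroot, hinj, hall, hlam⟩ := hR
  have hnl : ∀ a : Q.Arr, Q.hd a ≠ Q.tl a := by
    intro a
    have := hQ 0 (fun _ => a) (fun m => m.elim0)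
    exact this
  have huniq : ∀ i j j', i ∈ (P.part j).verts → i ∈ (P.part j').verts → j = j' := by
    intro i j j' h h'
    obtain ⟨k, _, hk⟩ := P.cover i
    rw [hk j h, hk j' h']
  have hsup : ∀ u i, β u i ≠ 0 → i ∈ (P.part (blk u)).verts := by
    intro u i h
    by_contra h'
    exact h ((hroot u).1 i h')
  have hsupZ : ∀ u i, i ∉ (P.part (blk u)).verts → (β u i : ℤ) = 0 := by
    intro u i h; rw [(hroot u).1 i h]; rfl
  have hone : ∀ u, Q.euler (β u) (β u) = 1 := by
    intro u
    rw [euler_eq_chiZ, chiZ_eq_eulerZ _ (hDyn (blk u)).2.1 _ _ (hsupZ u) (hsupZ u)]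
    exact (hroot u).2.2
  have hsame : ∀ u v, u < v → blk u = blk v → Q.euler (β u) (β v) ≤ 0 ∧ 0 ≤ Q.euler (β v) (β u) := by
    intro u v huv hb
    have hl := hlam u v huv hb
    rw [FinQuiver.lam] at hl
    have hpos := (hDyn (blk u)).2.2
    have hv : ∀ i, i ∉ (P.part (blk u)).verts → (β v i : ℤ) = 0 := by
      rw [hb]; exact hsupZ v
    have h1 := hpos ((fun i => (β u i : ℤ)) + fun i => (β v i : ℤ))
      (by intro i hi; simp only [Pi.add_apply]; rw [hsupZ u i hi, hv i hi]; rfl) (by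
        intro h0
        apply (hroot u).2.1
        funext i
        have := congrFun h0 i
        simp only [Pi.add_apply, Pi.zero_apply] at this ⊢
        omega)
    have h2 := hpos ((fun i => (β u i : ℤ)) - fun i => (β v i : ℤ))
      (by intro i hi; simp only [Pi.sub_apply]; rw [hsupZ u i hi, hv i hi]; rfl) (by
        intro h0
        apply huv.ne
        apply hinj
        funext i
        have := congrFun h0 i
        simp only [Pi.sub_apply, Pi.zero_apply] at this
        omega)
    rw [← chiZ_eq_eulerZ _ (hDyn (blk u)).2.1] at h1 h2
    rotate_left
    · intro i hi; simp only [Pi.sub_apply]; rw [hsupZ u i hi, hv i hi]; rfl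
    · intro i hi; simp only [Pi.sub_apply]; rw [hsupZ u i hi, hv i hi]; rfl
    · intro i hi; simp only [Pi.add_apply]; rw [hsupZ u i hi, hv i hi]; rfl
    · intro i hi; simp only [Pi.add_apply]; rw [hsupZ u i hi, hv i hi]; rfl
    simp only [map_add, map_sub, LinearMap.add_apply, LinearMap.sub_apply] at h1 h2
    have hu1 := hone u
    have hv1 := hone v
    rw [euler_eq_chiZ] at hu1 hv1 hl ⊢
    rw [euler_eq_chiZ] at hl ⊢
    constructor <;> omega
  refine ⟨hnl, hone, ?_, ?_⟩
  · intro u v huv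
    by_cases hb : blk u = blk v
    · exact (hsame u v huv hb).1
    · rw [euler_eq_chiZ]
      apply chiZ_nonpos_of_disj
      · intro i; positivity
      · intro i; positivity
      · intro i
        by_contra hne
        apply hb
        apply huniq i
        · apply hsup; intro h; apply hne; simp [h]
        · apply hsup; intro h; apply hne; simp [h]
  · intro u α hα
    set j := blk u with hj
    set V := (P.part j).verts with hV
    let M' : AddSubgroup (Fin n → ℤ) :=
      { carrier := {x | ∀ i, i ∉ V → x i = 0}
        add_mem' := by intro a b ha hb i hi; simp [ha i hi, hb i hi]
        zero_mem' := by intro i hi; rfl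
        neg_mem' := by intro a ha i hi; simp [ha i hi] }
    have hM' : ∀ x, x ∈ M' ↔ ∀ i, i ∉ V → x i = 0 := fun x => Iff.rfl
    let L0 : List (Fin n → ℤ) := ((List.finRange r).filter (fun w => blk w = j)).map fun w i => (β w i : ℤ)
    have hL0 : ∀ x, x ∈ L0 ↔ ∃ w, blk w = j ∧ (fun i => (β w i : ℤ)) = x := by
      intro x; simp [L0]
    let b0 : V → (Fin n → ℤ) := fun k => Pi.single k.1 1
    have hsumb : ∀ (c : V → ℤ) (k : V), (∑ l, c l • b0 l) k.1 = c k := by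
      intro c k
      rw [Finset.sum_apply, Finset.sum_eq_single k]
      · simp [b0]
      · intro l _ hl
        have : k.1 ≠ l.1 := fun h => hl (Subtype.ext h.symm)
        simp [b0, Pi.single_apply, this]
      · simp
    have hsumb' : ∀ (c : V → ℤ) (k : Fin n), k ∉ V → (∑ l, c l • b0 l) k = 0 := by
      intro c k hk
      rw [Finset.sum_apply]
      apply Finset.sum_eq_zero
      intro l _
      have : k ≠ l.1 := fun h => hk (h ▸ l.2)
      simp [b0, Pi.single_apply, this]
    have hspan : ∀ x ∈ M', (∀ i, 0 ≤ x i) → NSp b0 x := by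
      intro x hx hx0
      refine ⟨fun k => x k.1, fun k => hx0 _, ?_⟩
      funext i
      by_cases hi : i ∈ V
      · exact (hsumb (fun k => x k.1) ⟨i, hi⟩).symm
      · rw [hsumb' _ i hi, hx i hi]
    have hF := (hDyn j).2.1
    have hpos : ∀ x ∈ M', x ≠ 0 → 0 < chiZ Q x x := by
      intro x hx h0
      rw [chiZ_eq_eulerZ _ hF x x hx hx]
      exact (hDyn j).2.2 x hx h0
    have hnat : ∀ x ∈ M', (∀ i, 0 ≤ x i) → chiZ Q x x = 1 → x ∈ L0 := by
      intro x hx hx0 hq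
      have hxx : (fun i => ((x i).toNat : ℤ)) = x := by
        funext i; exact Int.toNat_of_nonneg (hx0 i)
      obtain ⟨w, hw⟩ := hall j (fun i => (x i).toNat) (by
        refine ⟨fun i hi => by dsimp only; rw [hx i hi]; rfl, ?_, ?_⟩
        · intro h0
          have : x = 0 := by
            rw [← hxx]; funext i; have := congrFun h0 i; simp only [Pi.zero_apply] at this ⊢; rw [this]; rfl
          rw [this] at hq; simp at hq
        · rw [hxx, ← chiZ_eq_eulerZ _ hF x x hx hx]; exact hq)
      rw [hL0]
      refine ⟨w, ?_, ?_⟩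
      · have hw0 := (hroot w).2.1
        obtain ⟨i, hi⟩ := Function.ne_iff.mp hw0
        have h1 := hsup w i hi
        apply huniq i _ _ h1
        by_contra hiV
        apply hi
        rw [hw]
        simp [hx i hiV]
      · rw [hw]; exact hxx
    have hb0M : ∀ k, b0 k ∈ M' := by
      intro k i hi
      have : i ≠ k.1 := fun h => hi (h ▸ k.2)
      simp [b0, Pi.single_apply, this]
    have hb0n : ∀ k i, 0 ≤ b0 k i := by
      intro k i; by_cases h : i = k.1 <;> simp [b0, Pi.single_apply, h]
    have hInv : RInv (chiZ Q) M' L0 b0 := by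
      refine ⟨?_, ?_, ?_, ?_, ?_, ?_, ?_, ?_⟩
      · intro x hx
        obtain ⟨w, hw, rfl⟩ := (hL0 x).mp hx
        apply hspan
        · intro i hi; apply hsupZ; rw [hw]; exact hi
        · intro i; positivity
      · intro k
        apply hnat _ (hb0M k) (hb0n k)
        rw [chiZ_apply]
        have h1 : ∑ i, b0 k i * b0 k i = 1 := by simp [b0, Pi.single_apply]
        have h2 : ∑ a : Q.Arr, b0 k (Q.tl a) * b0 k (Q.hd a) = 0 := by
          apply Finset.sum_eq_zero
          intro a _
          have := hnl a
          by_cases ht : Q.tl a = k.1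
          · have : Q.hd a ≠ k.1 := by rw [← ht]; exact this
            simp [b0, Pi.single_apply, this]
          · simp [b0, Pi.single_apply, ht]
        omega
      · simp only [L0]
        rw [List.pairwise_map, List.pairwise_filter]
        have := List.pairwise_lt_finRange r
        refine this.imp ?_
        intro w w' hww h1 h2
        have h1 := of_decide_eq_true h1
        have h2 := of_decide_eq_true h2
        exact hsame w w' hww (h1.trans h2.symm)
      · intro x hx
        obtain ⟨w, hw, rfl⟩ := (hL0 x).mp hx
        exact hone w
      · intro x hx hq
        set p : Fin n → ℤ := fun i => max (x i) 0 with hp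
        set m : Fin n → ℤ := fun i => max (- x i) 0 with hm
        have hxe : x = p - m := by
          funext i; simp only [hp, hm, Pi.sub_apply]; omega
        have hpM : p ∈ M' := by intro i hi; simp [hp, hx i hi]
        have hmM : m ∈ M' := by intro i hi; simp [hm, hx i hi]
        have hp0 : ∀ i, 0 ≤ p i := fun i => le_max_right _ _
        have hm0 : ∀ i, 0 ≤ m i := fun i => le_max_right _ _
        have hd : ∀ i, p i * m i = 0 := by
          intro i
          rcases le_total (x i) 0 with h | h
          · have : p i = 0 := max_eq_right h
            rw [this, zero_mul]
          · have : m i = 0 := max_eq_right (by omega)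
            rw [this, mul_zero]
        have e1 := chiZ_nonpos_of_disj Q p m hp0 hm0 hd
        have e2 := chiZ_nonpos_of_disj Q m p hm0 hp0 (fun i => by rw [mul_comm]; exact hd i)
        by_cases hpz : p = 0
        · right
          have : -x = m := by rw [hxe, hpz]; simp
          rw [this]
          apply hnat _ hmM hm0
          rw [← this]; simpa using hq
        · by_cases hmz : m = 0
          · left
            have : x = p := by rw [hxe, hmz]; simp
            rw [this]
            apply hnat _ hpM hp0
            rw [← this]; exact hq
          · exfalso
            have e3 := hpos p hpM hpz
            have e4 := hpos m hmM hmz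
            rw [hxe] at hq
            simp only [map_sub, LinearMap.sub_apply] at hq
            omega
      · intro x hx
        obtain ⟨w, hw, rfl⟩ := (hL0 x).mp hx
        intro i hi; apply hsupZ; rw [hw]; exact hi
      · intro c hc k
        rw [← hsumb c k, hc]; rfl
      · intro k l hkl
        apply chiZ_nonpos_of_disj _ _ _ (hb0n k) (hb0n l)
        intro i
        by_cases h : i = k.1
        · have : i ≠ l.1 := fun h' => hkl (Subtype.ext (h.symm.trans h'))
          simp [b0, Pi.single_apply, this]
        · simp [b0, Pi.single_apply, h]
    have hαM : (fun i => (α i : ℤ)) ∈ M' := by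
      intro i hi
      have h1 := hα i
      rw [(hroot u).1 i hi] at h1
      have : α i = 0 := by omega
      simp [this]
    obtain ⟨a, ha, hp⟩ := RInv.dec hpos (chiZ Q (fun i => (α i : ℤ)) (fun i => (α i : ℤ))).toNat L0 b0 hInv _ hαM
      (hspan _ hαM (fun i => by positivity)) (Int.self_le_toNat _)
    refine ⟨fun w => if blk w = j then a (fun i => (β w i : ℤ)) else 0, ?_, ?_⟩
    · intro i
      have h1 := congrFun ha i
      simp only [L0, List.map_map] at h1
      have h2 : ∀ l : List (Fin r), ((l.filter (fun w => blk w = j)).map ((fun x : Fin n → ℤ => (a x : ℤ) • x) ∘ fun w i => (β w i : ℤ))).sum i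
          = (l.map fun w => (((if blk w = j then a (fun i => (β w i : ℤ)) else 0) * β w i : ℕ) : ℤ)).sum := by
        intro l
        induction l with
        | nil => rfl
        | cons w l ih =>
          by_cases hw : blk w = j
          · rw [List.filter_cons_of_pos (by simpa using hw)]
            simp only [List.map_cons, List.sum_cons, Pi.add_apply, ih, if_pos hw]
            simp
          · rw [List.filter_cons_of_neg (by simpa using hw)]
            simp only [List.map_cons, List.sum_cons, ih, if_neg hw]
            simp
      rw [h2] at h1
      rw [← List.ofFn_eq_map, List.sum_ofFn] at h1
      exact_mod_cast h1
    · simp only [L0] at hp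
      rw [List.pairwise_map, List.pairwise_filter, List.pairwise_iff_getElem] at hp
      intro w w' hww h1 h2
      dsimp only at h1 h2
      have hb1 : blk w = j := by by_contra h; simp [h] at h1
      have hb2 : blk w' = j := by by_contra h; simp [h] at h2
      rw [if_pos hb1] at h1
      rw [if_pos hb2] at h2
      have := hp w.1 w'.1 (by simp) (by simp) hww
      simp only [List.getElem_finRange, Fin.cast_mk, Fin.eta] at this
      exact this (by simpa using hb1) (by simpa using hb2) h1 h2

section Del
variable {E : Type} [DecidableEq E]

/-- collapse the variable `a` to `b` -/
def clps (a b : E) : E → E := Function.update id a b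

noncomputable def del (p : E × E) : MvPolynomial E ℚ := X p.2 - X p.1

lemma clps_self (a b : E) : clps a b a = b := by simp [clps]
lemma clps_ne (a b : E) {e : E} (h : e ≠ a) : clps a b e = e := by simp [clps, h]

lemma del_dvd_iff (p : E × E) (A : MvPolynomial E ℚ) :
    del p ∣ A ↔ rename (clps p.1 p.2) A = 0 := by
  constructor
  · rintro ⟨B, rfl⟩
    rw [map_mul]
    have : rename (clps p.1 p.2) (del p) = (0 : MvPolynomial E ℚ) := by
      simp only [del, map_sub, rename_X, clps_self]
      by_cases h : p.2 = p.1
      · rw [h, clps_self, sub_self]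
      · rw [clps_ne _ _ h, sub_self]
    rw [this, zero_mul]
  · intro h
    rw [← Ideal.mem_span_singleton, ← Ideal.Quotient.eq_zero_iff_mem]
    have key : (Ideal.Quotient.mkₐ ℚ (Ideal.span {del p})).comp (rename (clps p.1 p.2))
        = Ideal.Quotient.mkₐ ℚ (Ideal.span {del p}) := by
      apply MvPolynomial.algHom_ext
      intro e
      simp only [AlgHom.comp_apply, rename_X]
      by_cases he : e = p.1
      · rw [he, clps_self]
        rw [Ideal.Quotient.mkₐ_eq_mk, Ideal.Quotient.eq]
        exact Ideal.mem_span_singleton_self _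
      · rw [clps_ne _ _ he]
    have := congrArg (fun φ => φ A) key
    simp only [AlgHom.comp_apply, h, map_zero] at this
    exact this.symm

lemma del_prime {p : E × E} (hp : p.1 ≠ p.2) : Prime (del p) := by
  refine ⟨?_, ?_, ?_⟩
  · intro h
    apply hp
    rw [del, sub_eq_zero] at h
    exact (MvPolynomial.X_injective h).symm
  · intro h
    have h1 := (del_dvd_iff p 1).mp h.dvd
    simp at h1
  · intro a b h
    rw [del_dvd_iff, map_mul, mul_eq_zero] at h
    rw [del_dvd_iff, del_dvd_iff]
    exact h

lemma del_dvd_del {p q : E × E} (hp : p.1 ≠ p.2) (hq : q.1 ≠ q.2) (h : del p ∣ del q) :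
    q = p ∨ q = p.swap := by
  rw [del_dvd_iff] at h
  simp only [del, map_sub, rename_X, sub_eq_zero] at h
  have h := MvPolynomial.X_injective h
  by_cases h1 : q.1 = p.1
  · by_cases h2 : q.2 = p.1
    · exact absurd (h1.trans h2.symm) hq
    · rw [h1, clps_self, clps_ne _ _ h2] at h
      left; exact Prod.ext h1 h
  · rw [clps_ne _ _ h1] at h
    by_cases h2 : q.2 = p.1
    · rw [h2, clps_self] at h
      right; exact Prod.ext h.symm h2
    · rw [clps_ne _ _ h2] at h
      exact absurd h.symm hq

lemma del_sq_dvd {p : E × E} (hp : p.1 ≠ p.2) {A : MvPolynomial E ℚ} (h : del p ∣ A)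
    (hs : rename (Equiv.swap p.1 p.2) A = A) : del p * - del p ∣ A := by
  obtain ⟨B, rfl⟩ := h
  have h1 : rename (Equiv.swap p.1 p.2) (del p) = - del p := by
    simp [del]
  rw [map_mul, h1] at hs
  have h2 : rename (Equiv.swap p.1 p.2) B = - B := by
    have : del p * (rename (Equiv.swap p.1 p.2) B + B) = 0 := by
      linear_combination - hs
    rcases mul_eq_zero.mp this with h | h
    · exact absurd h (del_prime hp).ne_zero
    · exact eq_neg_of_add_eq_zero_left h
  have h3 : rename (clps p.1 p.2) B = 0 := by
    have h4 := congrArg (rename (clps p.1 p.2)) h2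
    rw [rename_rename, map_neg] at h4
    have : (clps p.1 p.2) ∘ (Equiv.swap p.1 p.2) = clps p.1 p.2 := by
      funext e
      simp only [Function.comp]
      by_cases h1 : e = p.1
      · rw [h1, Equiv.swap_apply_left, clps_self, clps_ne _ _ hp.symm]
      · by_cases h2 : e = p.2
        · rw [h2, Equiv.swap_apply_right, clps_self, clps_ne _ _ hp.symm]
        · rw [Equiv.swap_apply_of_ne_of_ne h1 h2]
    rw [this] at h4
    exact self_eq_neg.mp h4
  rw [← del_dvd_iff] at h3
  obtain ⟨C, rfl⟩ := h3
  exact ⟨-C, by ring⟩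

end Del

section W
variable {E : Type} [DecidableEq E] {K : Type}

lemma W_finite (κ : E → K) (H : Finset E) :
    {w : Equiv.Perm E | (∀ e, e ∉ H → w e = e) ∧ ∀ e, κ (w e) = κ e}.Finite := by
  have hmap : ∀ w : Equiv.Perm E, (∀ e, e ∉ H → w e = e) → ∀ e : H, w e.1 ∈ H := by
    intro w hw e
    by_contra h
    have := hw _ h
    have := w.injective this
    rw [this] at h; exact h e.2
  let F : {w : Equiv.Perm E | (∀ e, e ∉ H → w e = e) ∧ ∀ e, κ (w e) = κ e} → (H → H) :=
    fun w e => ⟨w.1 e.1, hmap w.1 w.2.1 e⟩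
  have : Function.Injective F := by
    intro w w' h
    apply Subtype.ext
    ext e
    by_cases he : e ∈ H
    · have := congrArg Subtype.val (congrFun h ⟨e, he⟩)
      exact this
    · rw [w.2.1 e he, w'.2.1 e he]
  exact (Finite.of_injective F this : Finite _)

end W

lemma perm_ai {E : Type} (w : Equiv.Perm E) (e : E) : w (w⁻¹ e) = e := w.apply_symm_apply e

lemma perm_ia {E : Type} (w : Equiv.Perm E) (e : E) : w⁻¹ (w e) = e := w.symm_apply_apply e

section W2
variable {E : Type} [DecidableEq E] {K : Type}

noncomputable def W (κ : E → K) (H : Finset E) : Finset (Equiv.Perm E) := (W_finite κ H).toFinset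

lemma mem_W {κ : E → K} {H : Finset E} {w : Equiv.Perm E} :
    w ∈ W κ H ↔ (∀ e, e ∉ H → w e = e) ∧ ∀ e, κ (w e) = κ e := by
  simp [W]

lemma W_apply_mem {κ : E → K} {H : Finset E} {w : Equiv.Perm E} (hw : w ∈ W κ H) {e : E} :
    w e ∈ H ↔ e ∈ H := by
  have h := (mem_W.mp hw).1
  constructor
  · intro h1
    by_contra h2
    rw [h e h2] at h1; exact h2 h1
  · intro h1
    by_contra h2
    have := w.injective (h _ h2)
    rw [this] at h2; exact h2 h1

lemma W_one {κ : E → K} {H : Finset E} : (1 : Equiv.Perm E) ∈ W κ H := by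
  rw [mem_W]; simp

lemma W_inv {κ : E → K} {H : Finset E} {w : Equiv.Perm E} (hw : w ∈ W κ H) : w⁻¹ ∈ W κ H := by
  have hw' := mem_W.mp hw
  rw [mem_W]
  refine ⟨fun e he => ?_, fun e => ?_⟩
  · rw [Equiv.Perm.inv_eq_iff_eq, hw'.1 e he]
  · conv_rhs => rw [← perm_ai w e]
    rw [hw'.2]

lemma W_mul {κ : E → K} {H : Finset E} {w x : Equiv.Perm E} (hw : w ∈ W κ H) (hx : x ∈ W κ H) :
    w * x ∈ W κ H := by
  have hw' := mem_W.mp hw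
  have hx' := mem_W.mp hx
  rw [mem_W]
  refine ⟨fun e he => ?_, fun e => ?_⟩
  · rw [Equiv.Perm.mul_apply, hx'.1 e he, hw'.1 e he]
  · rw [Equiv.Perm.mul_apply, hw'.2, hx'.2]

lemma W_card_pos (κ : E → K) (H : Finset E) : 0 < (W κ H).card := Finset.card_pos.mpr ⟨1, W_one⟩

lemma W_sum_right {κ : E → K} {H : Finset E} {M : Type} [AddCommMonoid M] {x : Equiv.Perm E} (hx : x ∈ W κ H)
    (F : Equiv.Perm E → M) : ∑ w ∈ W κ H, F (w * x) = ∑ w ∈ W κ H, F w := by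
  refine Finset.sum_nbij' (fun w => w * x) (fun w => w * x⁻¹) ?_ ?_ ?_ ?_ ?_
  · intro w hw; exact W_mul hw hx
  · intro w hw; exact W_mul hw (W_inv hx)
  · intro w _; simp
  · intro w _; simp
  · intro w _; rfl

lemma W_sum_left {κ : E → K} {H : Finset E} {M : Type} [AddCommMonoid M] {x : Equiv.Perm E} (hx : x ∈ W κ H)
    (F : Equiv.Perm E → M) : ∑ w ∈ W κ H, F (x * w) = ∑ w ∈ W κ H, F w := by
  refine Finset.sum_nbij' (fun w => x * w) (fun w => x⁻¹ * w) ?_ ?_ ?_ ?_ ?_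
  · intro w hw; exact W_mul hx hw
  · intro w hw; exact W_mul (W_inv hx) hw
  · intro w _; simp
  · intro w _; simp
  · intro w _; rfl

lemma W_swap {κ : E → K} {H : Finset E} {a b : E} (ha : a ∈ H) (hb : b ∈ H) (hκ : κ a = κ b) :
    Equiv.swap a b ∈ W κ H := by
  rw [mem_W]
  refine ⟨fun e he => ?_, fun e => ?_⟩
  · exact Equiv.swap_apply_of_ne_of_ne (fun h => he (h ▸ ha)) (fun h => he (h ▸ hb))
  · by_cases h1 : e = a
    · rw [h1, Equiv.swap_apply_left, hκ]
    · by_cases h2 : e = b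
      · rw [h2, Equiv.swap_apply_right, hκ]
      · rw [Equiv.swap_apply_of_ne_of_ne h1 h2]

lemma prod_pairs_perm {M : Type} [CommMonoid M] (S : Finset (E × E)) (w : Equiv.Perm E)
    (h1 : ∀ p ∈ S, (w p.1, w p.2) ∈ S) (h2 : ∀ p ∈ S, (w⁻¹ p.1, w⁻¹ p.2) ∈ S) (f : E → E → M) :
    ∏ p ∈ S, f (w p.1) (w p.2) = ∏ p ∈ S, f p.1 p.2 := by
  refine Finset.prod_nbij' (fun p => (w p.1, w p.2)) (fun p => (w⁻¹ p.1, w⁻¹ p.2)) h1 h2 ?_ ?_ ?_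
  · intro p _; simp
  · intro p _; simp
  · intro p _; rfl

/-- product of differences -/
def Dd {R : Type} [CommRing R] (S : Finset (E × E)) (z : E → R) : R := ∏ p ∈ S, (z p.2 - z p.1)

lemma Dd_map {R R' : Type} [CommRing R] [CommRing R'] [Algebra ℚ R] [Algebra ℚ R'] (φ : R →ₐ[ℚ] R')
    (S : Finset (E × E)) (z : E → R) : φ (Dd S z) = Dd S (fun e => φ (z e)) := by
  simp [Dd, map_prod]

lemma Dd_aeval {R : Type} [CommRing R] [Algebra ℚ R] (S : Finset (E × E)) (z : E → R) :
    aeval z (Dd S (X : E → MvPolynomial E ℚ)) = Dd S z := by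
  rw [Dd_map]; simp

/-- full set of ordered κ-same pairs -/
noncomputable def Vf (κ : E → K) (H : Finset E) : Finset (E × E) :=
  (H ×ˢ H).filter fun p => p.1 ≠ p.2 ∧ κ p.1 = κ p.2

lemma mem_Vf {κ : E → K} {H : Finset E} {p : E × E} :
    p ∈ Vf κ H ↔ (p.1 ∈ H ∧ p.2 ∈ H) ∧ p.1 ≠ p.2 ∧ κ p.1 = κ p.2 := by
  simp [Vf]

lemma Vf_perm {κ : E → K} {H : Finset E} {w : Equiv.Perm E} (hw : w ∈ W κ H) {p : E × E}
    (hp : p ∈ Vf κ H) : (w p.1, w p.2) ∈ Vf κ H := by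
  rw [mem_Vf] at hp ⊢
  simp only [W_apply_mem hw, (mem_W.mp hw).2]
  exact ⟨hp.1, fun h => hp.2.1 (w.injective h), hp.2.2⟩

theorem Vf_dvd (κ : E → K) (H : Finset E) (A : MvPolynomial E ℚ)
    (hd : ∀ p ∈ Vf κ H, del p ∣ A) (hs : ∀ w ∈ W κ H, rename w A = A) :
    Dd (Vf κ H) X ∣ A := by
  set O := (Vf κ H).filter fun p => WellOrderingRel p.1 p.2 with hO
  have hsplit : Dd (Vf κ H) (X : E → MvPolynomial E ℚ) = ∏ p ∈ O, (del p * - del p) := by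
    rw [Dd, ← Finset.prod_filter_mul_prod_filter_not _ (fun p => WellOrderingRel p.1 p.2), Finset.prod_mul_distrib]
    congr 1
    refine Finset.prod_nbij' Prod.swap Prod.swap ?_ ?_ ?_ ?_ ?_
    · intro p hp
      simp only [Finset.mem_filter, mem_Vf, hO] at hp ⊢
      refine ⟨⟨⟨hp.1.1.2, hp.1.1.1⟩, hp.1.2.1.symm, hp.1.2.2.symm⟩, ?_⟩
      rcases trichotomous_of WellOrderingRel p.1 p.2 with h | h | h
      · exact absurd h hp.2
      · exact absurd h hp.1.2.1
      · exact h
    · intro p hp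
      simp only [Finset.mem_filter, mem_Vf, hO] at hp ⊢
      refine ⟨⟨⟨hp.1.1.2, hp.1.1.1⟩, hp.1.2.1.symm, hp.1.2.2.symm⟩, ?_⟩
      exact fun h => asymm_of WellOrderingRel h hp.2
    · simp
    · simp
    · intro p _; simp [del]
  rw [hsplit]
  apply Finset.prod_dvd_of_isRelPrime
  · intro p hp q hq hpq
    have hp := Finset.mem_coe.mp hp
    have hq := Finset.mem_coe.mp hq
    simp only [Finset.mem_filter, mem_Vf, hO] at hp hq
    have hpp := del_prime hp.1.2.1
    have hqq := del_prime hq.1.2.1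
    have hrel : IsRelPrime (del p) (del q) := by
      rw [hpp.irreducible.isRelPrime_iff_not_dvd]
      intro h
      rcases del_dvd_del hp.1.2.1 hq.1.2.1 h with h | h
      · exact hpq h.symm
      · rw [h] at hq
        exact asymm_of WellOrderingRel hq.2 hp.2
    show IsRelPrime (del p * - del p) (del q * - del q)
    exact ((hrel.mul_left hrel.neg_left).mul_right (hrel.mul_left hrel.neg_left).neg_right)
  · intro p hp
    simp only [Finset.mem_filter, hO] at hp
    have hp' := mem_Vf.mp hp.1
    exact del_sq_dvd hp'.2.1 (hd p hp.1) (hs _ (W_swap hp'.1.1 hp'.1.2 hp'.2.2))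

/-- points injective on H -/
def InjH {L : Type} (H : Finset E) (z : E → L) : Prop := ∀ e ∈ H, ∀ e' ∈ H, z e = z e' → e = e'

lemma Dd_ne_zero {L : Type} [Field L] {S : Finset (E × E)} {z : E → L}
    (h : ∀ p ∈ S, z p.2 ≠ z p.1) : Dd S z ≠ 0 := by
  rw [Dd, Finset.prod_ne_zero_iff]
  intro p hp; exact sub_ne_zero.mpr (h p hp)

theorem lemA (κ : E → K) (H : Finset E) (S : Finset (E × E)) (hS : S ⊆ Vf κ H)
    (hasym : ∀ p ∈ S, p.swap ∉ S) (N : MvPolynomial E ℚ) :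
    ∃ P : MvPolynomial E ℚ, ∀ (L : Type) [Field L] [Algebra ℚ L] (z : E → L), InjH H z →
      aeval z P = ∑ w ∈ W κ H, aeval (z ∘ w) N / Dd S (z ∘ w) := by
  set A : MvPolynomial E ℚ := ∑ w ∈ W κ H, rename w (N * Dd (Vf κ H \ S) X) with hA
  obtain ⟨P, hP⟩ : Dd (Vf κ H) X ∣ A := by
    apply Vf_dvd
    · intro p hp
      apply Finset.dvd_sum
      intro w hw
      rw [map_mul]
      apply Dvd.dvd.mul_left
      rw [Dd_map]
      have hq := Vf_perm (W_inv hw) hp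
      have hps : p.swap ∈ Vf κ H := by
        rw [mem_Vf] at hp ⊢
        exact ⟨⟨hp.1.2, hp.1.1⟩, hp.2.1.symm, hp.2.2.symm⟩
      have hq2 := Vf_perm (W_inv hw) hps
      by_cases h : (w⁻¹ p.1, w⁻¹ p.2) ∈ S
      · have h2 := hasym _ h
        have h3 : (w⁻¹ p.2, w⁻¹ p.1) ∈ Vf κ H \ S := Finset.mem_sdiff.mpr ⟨hq2, h2⟩
        refine Dvd.dvd.trans ?_ (Finset.dvd_prod_of_mem _ h3)
        simp only [rename_X, perm_ai]
        exact ⟨-1, by simp [del]⟩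
      · have h3 : (w⁻¹ p.1, w⁻¹ p.2) ∈ Vf κ H \ S := Finset.mem_sdiff.mpr ⟨hq, h⟩
        refine Dvd.dvd.trans ?_ (Finset.dvd_prod_of_mem _ h3)
        simp only [rename_X, perm_ai]
        exact ⟨1, by simp [del]⟩
    · intro x hx
      rw [hA, map_sum]
      rw [← W_sum_left hx (fun w => rename w (N * Dd (Vf κ H \ S) X))]
      refine Finset.sum_congr rfl fun w hw => ?_
      rw [rename_rename]; rfl
  refine ⟨P, ?_⟩
  intro L _ _ z hz
  have h0 : ∀ w ∈ W κ H, Dd (Vf κ H) (z ∘ w) = Dd (Vf κ H) z := by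
    intro w hw
    exact prod_pairs_perm _ w (fun p hp => Vf_perm hw hp) (fun p hp => Vf_perm (W_inv hw) hp)
      (fun a b => z b - z a)
  have h1 : Dd (Vf κ H) z ≠ 0 := by
    apply Dd_ne_zero
    intro p hp h
    rw [mem_Vf] at hp
    exact hp.2.1 (hz _ hp.1.2 _ hp.1.1 h).symm
  have h2 := congrArg (aeval z) hP
  rw [map_mul, Dd_aeval, hA, map_sum] at h2
  apply mul_left_cancel₀ h1
  rw [← h2, Finset.mul_sum]
  refine Finset.sum_congr rfl fun w hw => ?_
  rw [aeval_rename, map_mul, Dd_aeval, ← h0 w hw]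
  have h3 : Dd (Vf κ H) (z ∘ w) = Dd (Vf κ H \ S) (z ∘ w) * Dd S (z ∘ w) := by
    rw [Dd, Dd, Dd, Finset.prod_sdiff hS]
  have h4 : Dd S (z ∘ w) ≠ 0 := by
    intro h; rw [h, mul_zero, h0 w hw] at h3; exact h1 h3
  rw [h3]
  field_simp

end W2

noncomputable def ep (Q : FinQuiver n) (i j : Fin n) : ℤ :=
  ((Finset.univ.filter fun a : Q.Arr => Q.tl a = i ∧ Q.hd a = j).card : ℤ) - if i = j then 1 else 0

section K3
variable {E : Type} [DecidableEq E] {K : Type} (Q : FinQuiver n) (vert : E → Fin n)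

/-- dimension vector of a finite set of positions -/
def dimv (A : Finset E) : Fin n → ℕ := fun i => (A.filter fun e => vert e = i).card

lemma sum_vert (A : Finset E) (g : Fin n → ℤ) :
    ∑ e ∈ A, g (vert e) = ∑ i, (dimv vert A i : ℤ) * g i := by
  rw [← Finset.sum_fiberwise A vert]
  refine Finset.sum_congr rfl fun i _ => ?_
  rw [Finset.sum_congr rfl (g := fun _ => g i)]
  · simp [dimv]
  · intro e he; rw [(Finset.mem_filter.mp he).2]

lemma sum_ep (A B : Finset E) :
    ∑ p ∈ A ×ˢ B, ep Q (vert p.1) (vert p.2) = - Q.euler (dimv vert A) (dimv vert B) := by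
  rw [Finset.sum_product]
  dsimp only
  have h1 : ∀ e ∈ A, ∑ e' ∈ B, ep Q (vert e) (vert e') = ∑ j, (dimv vert B j : ℤ) * ep Q (vert e) j :=
    fun e _ => sum_vert vert B (fun j => ep Q (vert e) j)
  rw [Finset.sum_congr rfl h1, sum_vert vert A (fun i => ∑ j, (dimv vert B j : ℤ) * ep Q i j)]
  generalize dimv vert A = α
  generalize dimv vert B = β
  rw [FinQuiver.euler, neg_sub]
  have h2 : ∑ a : Q.Arr, (α (Q.tl a) : ℤ) * β (Q.hd a)
      = ∑ i, ∑ j, (α i : ℤ) * (β j * ((Finset.univ.filter fun a : Q.Arr => Q.tl a = i ∧ Q.hd a = j).card : ℤ)) := by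
    have h3 : ∀ i j, (((Finset.univ.filter fun a : Q.Arr => Q.tl a = i ∧ Q.hd a = j).card : ℕ) : ℤ) =
        ∑ a : Q.Arr, if Q.tl a = i ∧ Q.hd a = j then (1:ℤ) else 0 := by
      intro i j; simp
    simp only [h3, Finset.mul_sum]
    have h4 : ∀ i, ∑ j, ∑ a : Q.Arr, (α i : ℤ) * ((β j : ℤ) * if Q.tl a = i ∧ Q.hd a = j then 1 else 0)
        = ∑ a : Q.Arr, if Q.tl a = i then (α i : ℤ) * β (Q.hd a) else 0 := by
      intro i
      rw [Finset.sum_comm]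
      refine Finset.sum_congr rfl fun a _ => ?_
      rw [Finset.sum_eq_single (Q.hd a)]
      · by_cases h : Q.tl a = i <;> simp [h]
      · intro j _ hj; simp [hj.symm]
      · simp
    simp only [h4]
    rw [Finset.sum_comm]
    refine Finset.sum_congr rfl fun a _ => ?_
    simp
  rw [h2, ← Finset.sum_sub_distrib]
  refine Finset.sum_congr rfl fun i _ => ?_
  simp only [ep, mul_sub, Finset.mul_sum, Finset.sum_sub_distrib]
  simp

noncomputable def Kk {L : Type} [Field L] (S : Finset (E × E)) (z : E → L) : L :=
  ∏ p ∈ S, (z p.2 - z p.1) ^ ep Q (vert p.1) (vert p.2)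

noncomputable def numK {R : Type} [CommRing R] (S : Finset (E × E)) (z : E → R) : R :=
  ∏ p ∈ S, (z p.2 - z p.1) ^ (ep Q (vert p.1) (vert p.2) + if vert p.1 = vert p.2 then 1 else 0).toNat

lemma numK_aeval {R : Type} [CommRing R] [Algebra ℚ R] (S : Finset (E × E)) (z : E → R) :
    aeval z (numK Q vert S (X : E → MvPolynomial E ℚ)) = numK Q vert S z := by
  simp [numK, map_prod]

lemma Kk_eq {L : Type} [Field L] (S : Finset (E × E)) (z : E → L) (hz : ∀ p ∈ S, z p.2 ≠ z p.1) :
    Kk Q vert S z = numK Q vert S z / Dd (S.filter fun p => vert p.1 = vert p.2) z := by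
  rw [Kk, numK, Dd, Finset.prod_filter, ← Finset.prod_div_distrib]
  refine Finset.prod_congr rfl fun p hp => ?_
  have h := sub_ne_zero.mpr (hz p hp)
  by_cases hv : vert p.1 = vert p.2
  · simp only [if_pos hv]
    rw [eq_div_iff h, ← zpow_add_one₀ h, ← zpow_natCast, Int.toNat_of_nonneg]
    simp [ep, hv]
  · simp only [if_neg hv, div_one, add_zero]
    rw [← zpow_natCast, Int.toNat_of_nonneg]
    simp [ep, hv]

lemma Kk_ne_zero {L : Type} [Field L] (S : Finset (E × E)) (z : E → L) (hz : ∀ p ∈ S, z p.2 ≠ z p.1) :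
    Kk Q vert S z ≠ 0 := by
  rw [Kk, Finset.prod_ne_zero_iff]
  intro p hp
  exact zpow_ne_zero _ (sub_ne_zero.mpr (hz p hp))

lemma InjH.comp {L : Type} {H : Finset E} {z : E → L} (hz : InjH H z) {κ : E → K} {w : Equiv.Perm E}
    (hw : w ∈ W κ H) : InjH H (z ∘ w) := by
  intro e he e' he' h
  exact w.injective (hz _ ((W_apply_mem hw).mpr he) _ ((W_apply_mem hw).mpr he') h)

theorem lemA' (κ : E → K) (H : Finset E) (S : Finset (E × E)) (hS : S ⊆ H ×ˢ H)
    (hne : ∀ p ∈ S, p.1 ≠ p.2)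
    (hκ : ∀ p ∈ S, vert p.1 = vert p.2 → κ p.1 = κ p.2)
    (hasym : ∀ p ∈ S, p.swap ∉ S) (N : MvPolynomial E ℚ) :
    ∃ P : MvPolynomial E ℚ, ∀ (L : Type) [Field L] [Algebra ℚ L] (z : E → L), InjH H z →
      aeval z P = ∑ w ∈ W κ H, aeval (z ∘ w) N * Kk Q vert S (z ∘ w) := by
  obtain ⟨P, hP⟩ := lemA κ H (S.filter fun p => vert p.1 = vert p.2) (by
    intro p hp
    rw [Finset.mem_filter] at hp
    rw [mem_Vf]
    have := Finset.mem_product.mp (hS hp.1)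
    exact ⟨this, hne p hp.1, hκ p hp.1 hp.2⟩) (by
    intro p hp hp'
    exact hasym p (Finset.mem_filter.mp hp).1 (Finset.mem_filter.mp hp').1) (N * numK Q vert S X)
  refine ⟨P, ?_⟩
  intro L _ _ z hz
  rw [hP L z hz]
  refine Finset.sum_congr rfl fun w hw => ?_
  rw [map_mul, numK_aeval, Kk_eq, mul_div_assoc]
  intro p hp h
  have := Finset.mem_product.mp (hS hp)
  exact hne p hp (hz.comp hw _ this.2 _ this.1 h).symm

/-- universal point -/
noncomputable def ux : E → FractionRing (MvPolynomial E ℚ) := fun e => algebraMap _ _ (X e : MvPolynomial E ℚ)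

lemma aeval_ux (P : MvPolynomial E ℚ) :
    aeval (ux : E → FractionRing (MvPolynomial E ℚ)) P = algebraMap _ _ P := by
  have := MvPolynomial.aeval_algebraMap_apply (FractionRing (MvPolynomial E ℚ)) (X : E → MvPolynomial E ℚ) P
  rw [aeval_X_left_apply] at this
  exact this

lemma ux_inj : Function.Injective (ux : E → FractionRing (MvPolynomial E ℚ)) := by
  intro a b h
  exact X_injective (IsFractionRing.injective (MvPolynomial E ℚ) (FractionRing (MvPolynomial E ℚ)) h)

lemma eq_of_ux {P P' : MvPolynomial E ℚ}
    (h : aeval (ux : E → FractionRing (MvPolynomial E ℚ)) P = aeval ux P') : P = P' := by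
  rw [aeval_ux, aeval_ux] at h
  exact IsFractionRing.injective (MvPolynomial E ℚ) (FractionRing (MvPolynomial E ℚ)) h

lemma ux_injH (H : Finset E) : InjH H (ux : E → FractionRing (MvPolynomial E ℚ)) :=
  fun _ _ _ _ h => ux_inj h

def ConstH {L : Type} (H : Finset E) (z : E → L) : Prop := ∀ e ∈ H, ∀ e' ∈ H, z e = z e'

lemma prod_zpow_sum {L : Type} [Field L] {T : L} (hT : T ≠ 0) {ι : Type} (S : Finset ι) (f : ι → ℤ) :
    ∏ p ∈ S, T ^ f p = T ^ ∑ p ∈ S, f p := by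
  induction S using Finset.induction_on with
  | empty => simp
  | insert a s ha ih => rw [Finset.prod_insert ha, Finset.sum_insert ha, zpow_add₀ hT, ih]

theorem lemB (κ : E → K) (H : Finset E) (S : Finset (E × E)) (hS : S ⊆ H ×ˢ H)
    (hsum : 0 < ∑ p ∈ S, ep Q (vert p.1) (vert p.2)) (N P : MvPolynomial E ℚ)
    (hP : ∀ (L : Type) [Field L] [Algebra ℚ L] (z : E → L), InjH H z →
      aeval z P = ∑ w ∈ W κ H, aeval (z ∘ w) N * Kk Q vert S (z ∘ w))
    (L : Type) [Field L] [Algebra ℚ L] (z : E → L) (hz : ConstH H z) : aeval z P = 0 := by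
  haveI : CharZero L := algebraRat.charZero L
  obtain ⟨k, hk⟩ : ∃ k : ℕ, ∑ p ∈ S, ep Q (vert p.1) (vert p.2) = k := ⟨_, (Int.toNat_of_nonneg hsum.le).symm⟩
  have hk0 : k ≠ 0 := by omega
  let y : E → L := fun e => if h : e ∈ H then ((H.equivFin ⟨e, h⟩ : ℕ) : L) else 0
  have hy : InjH H y := by
    intro e he e' he' h
    simp only [y, dif_pos he, dif_pos he', Nat.cast_inj] at h
    have := H.equivFin.injective (Fin.ext h)
    exact congrArg Subtype.val this
  let zp : E → Polynomial L := fun e => Polynomial.C (z e) + Polynomial.X * Polynomial.C (y e)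
  let F := FractionRing (Polynomial L)
  let zz : E → F := fun e => algebraMap (Polynomial L) F (zp e)
  have hinj : Function.Injective (algebraMap (Polynomial L) F) := IsFractionRing.injective _ _
  have hzz : InjH H zz := by
    intro e he e' he' h
    have h1 := hinj h
    have h2 := congrArg (Polynomial.coeff · 1) h1
    simp [zp] at h2
    exact hy e he e' he' h2
  have haev : ∀ (v : Equiv.Perm E) (A : MvPolynomial E ℚ), aeval (zz ∘ v) A = algebraMap (Polynomial L) F (aeval (zp ∘ v) A) := by
    intro v A
    exact MvPolynomial.aeval_algebraMap_apply F (zp ∘ v) A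
  have hT : algebraMap (Polynomial L) F Polynomial.X ≠ 0 := by
    intro h
    have := hinj (h.trans (map_zero _).symm)
    exact Polynomial.X_ne_zero this
  have hK : ∀ w ∈ W κ H, Kk Q vert S (zz ∘ w) =
      algebraMap (Polynomial L) F (Polynomial.X ^ k * Polynomial.C (Kk Q vert S (y ∘ w))) := by
    intro w hw
    rw [map_mul, map_pow, ← zpow_natCast, ← hk, ← prod_zpow_sum hT]
    rw [show algebraMap (Polynomial L) F (Polynomial.C (Kk Q vert S (y ∘ w)))
      = ((algebraMap (Polynomial L) F).comp Polynomial.C) (Kk Q vert S (y ∘ w)) from rfl]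
    rw [Kk, Kk, map_prod, ← Finset.prod_mul_distrib]
    refine Finset.prod_congr rfl fun p hp => ?_
    rw [map_zpow₀, ← mul_zpow]
    congr 1
    have hm := Finset.mem_product.mp (hS hp)
    have := hz (w p.2) ((W_apply_mem hw).mpr hm.2) (w p.1) ((W_apply_mem hw).mpr hm.1)
    simp only [Function.comp, zz, zp, this, RingHom.comp_apply]
    rw [← map_sub, ← map_mul]
    congr 1
    rw [map_sub]; ring
  have h1 := hP F zz hzz
  have e0 := haev 1 P
  simp only [Equiv.Perm.coe_one, Function.comp_id] at e0
  rw [e0, Finset.sum_congr rfl (fun w hw => by rw [hK w hw, haev w N, ← map_mul]), ← map_sum] at h1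
  have h2 := hinj h1
  have h3 := congrArg (Polynomial.eval 0) h2
  rw [Polynomial.eval_finset_sum] at h3
  have h4 : Polynomial.eval 0 (aeval zp P) = aeval z P := by
    have := MvPolynomial.comp_aeval_apply (φ := (Polynomial.aeval (0 : L)).restrictScalars ℚ) (f := zp) P
    simp only [AlgHom.restrictScalars_apply, Polynomial.coe_aeval_eq_eval] at this
    rw [this]
    congr 2
    funext e; simp [zp]
  rw [h4] at h3
  rw [h3]
  apply Finset.sum_eq_zero
  intro w _
  simp [hk0]

end K3

section K4
variable {E : Type} [DecidableEq E] (Q : FinQuiver n) (vert : E → Fin n) {r : ℕ}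
  (β : Fin r → Fin n → ℕ)

noncomputable def ec (α : Fin n → ℕ) (i : Fin n) : ℤ :=
  (α i : ℤ) - ∑ a : Q.Arr, if Q.hd a = i then (α (Q.tl a) : ℤ) else 0

lemma euler_ec (α γ : Fin n → ℕ) : Q.euler α γ = ∑ i, (γ i : ℤ) * ec Q α i := by
  simp only [FinQuiver.euler, ec, mul_sub, Finset.sum_sub_distrib, Finset.mul_sum]
  congr 1
  · exact Finset.sum_congr rfl fun i _ => mul_comm _ _
  · rw [Finset.sum_comm]
    refine Finset.sum_congr rfl fun a _ => ?_
    rw [Finset.sum_eq_single (Q.hd a)]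
    · simp [mul_comm]
    · intro j _ hj; simp [hj.symm]
    · simp

lemma euler_dimv (α : Fin n → ℕ) (B : Finset E) :
    Q.euler α (dimv vert B) = ∑ e ∈ B, ec Q α (vert e) := by
  rw [euler_ec, sum_vert]

lemma dimv_mono {A B : Finset E} (h : A ⊆ B) (i : Fin n) : dimv vert A i ≤ dimv vert B i :=
  Finset.card_le_card (Finset.filter_subset_filter _ h)

lemma card_dimv (A : Finset E) : A.card = ∑ i, dimv vert A i := by
  rw [Finset.card_eq_sum_card_fiberwise (f := vert) (t := Finset.univ) (by simp)]
  rfl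

lemma eq_of_dimv {A B : Finset E} (h : A ⊆ B) (hd : dimv vert A = dimv vert B) : A = B := by
  apply Finset.eq_of_subset_of_card_le h
  rw [card_dimv vert A, card_dimv vert B, hd]

def Bad (u v : Fin r) (α : Fin n → ℕ) : Prop :=
  (v < u ∧ 0 < Q.euler (β v) α) ∨ (v = u ∧ α ≠ β u ∧ 0 < Q.euler (β u) α)

variable {Q β}

lemma Bad.ne (RD : RData Q β) {u v : Fin r} {α : Fin n → ℕ} (h : Bad Q β u v α) : α ≠ β u := by
  rcases h with h | h
  · intro he
    rw [he] at h
    have := RD.neg v u h.1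
    omega
  · exact h.2.1

lemma RData.ne_zero (RD : RData Q β) (u : Fin r) : ∃ i, β u i ≠ 0 := by
  by_contra h
  push Not at h
  have := RD.one u
  rw [euler_ec] at this
  simp [h] at this

theorem bad_exists (RD : RData Q β) (H : Finset E) (t : E → ℕ) (grp : E → Fin r × ℕ) (m m' : Fin r → ℕ)
    (ht : ∀ e ∈ H, t e < r)
    (htm : ∀ u : Fin r, ∀ i, dimv vert (H.filter fun e => t e = u) i = m u * β u i)
    (hg : ∀ e ∈ H, (grp e).2 < m' (grp e).1)
    (hgm : ∀ u k, k < m' u → dimv vert (H.filter fun e => grp e = (u, k)) = β u)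
    (hlex : ∀ v, (∀ w, w < v → m w = m' w) → m' v ≤ m v)
    (hbad : ∃ e ∈ H, t e ≠ (grp e).1) :
    ∃ e0 ∈ H, ∃ v : Fin r, (∀ e ∈ H, grp e = grp e0 → (v : ℕ) ≤ t e) ∧
      Bad Q β (grp e0).1 v (dimv vert ((H.filter fun e => grp e = grp e0).filter fun e => t e = v)) := by
  by_contra hno
  push Not at hno
  have hex : ∃ v : ℕ, ∃ e ∈ H, t e ≠ (grp e).1 ∧ (t e = v ∨ (grp e).1.val = v) := by
    obtain ⟨e, he, h⟩ := hbad
    exact ⟨t e, e, he, h, Or.inl rfl⟩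
  obtain ⟨e1, he1, hne1, hv1⟩ := Nat.find_spec hex
  have hmin : ∀ e ∈ H, t e ≠ (grp e).1 → Nat.find hex ≤ t e ∧ Nat.find hex ≤ (grp e).1.val := by
    intro e he h
    exact ⟨Nat.find_min' hex ⟨e, he, h, Or.inl rfl⟩, Nat.find_min' hex ⟨e, he, h, Or.inr rfl⟩⟩
  generalize Nat.find hex = v0 at hv1 hmin
  have hv0 : v0 < r := by
    rcases hv1 with h | h
    · rw [← h]; exact ht _ he1
    · rw [← h]; exact (grp e1).1.2
  set v : Fin r := ⟨v0, hv0⟩ with hv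
  -- dims of types
  have htype : ∀ (p : E → Prop) [DecidablePred p] (w : Fin r) (f : E → ℤ),
      ∑ e ∈ H.filter (fun e => (grp e).1 = w ∧ p e), f e
        = ∑ k ∈ Finset.range (m' w), ∑ e ∈ (H.filter fun e => grp e = (w, k)).filter p, f e := by
    intro p _ w f
    rw [← Finset.sum_fiberwise_of_maps_to (t := Finset.range (m' w)) (g := fun e => (grp e).2)]
    · refine Finset.sum_congr rfl fun k _ => ?_
      apply Finset.sum_congr _ fun _ _ => rfl
      ext e
      simp only [Finset.mem_filter, Prod.ext_iff]
      tauto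
    · intro e he
      rw [Finset.mem_filter] at he
      rw [Finset.mem_range, ← he.2.1]
      exact hg e he.1
  have hdimtype : ∀ w : Fin r, ∀ i, dimv vert (H.filter fun e => (grp e).1 = w) i = m' w * β w i := by
    intro w i
    have h := htype (fun e => vert e = i) w (fun _ => 1)
    have h2 : ∀ k ∈ Finset.range (m' w), ∑ e ∈ (H.filter fun e => grp e = (w, k)).filter (fun e => vert e = i), (1 : ℤ) = β w i := by
      intro k hk
      rw [← hgm w k (Finset.mem_range.mp hk)]
      simp [dimv]
    rw [Finset.sum_congr rfl h2] at h
    simp only [Finset.sum_const, Finset.card_range, smul_eq_mul] at h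
    rw [dimv, Finset.filter_filter]
    have : (((H.filter fun e => (grp e).1 = w ∧ vert e = i).card : ℕ) : ℤ) = m' w * β w i := by
      simpa using h
    exact_mod_cast this
  have hlt : ∀ w, w < v → m w = m' w := by
    intro w hw
    have hw' : w.1 < v0 := hw
    have hset : (H.filter fun e => t e = w) = H.filter fun e => (grp e).1 = w := by
      apply Finset.filter_congr
      intro e he
      constructor
      · intro h
        by_contra h2
        have := (hmin e he (by rw [h]; exact fun h' => h2 (Fin.ext h'.symm))).1
        omega
      · intro h
        by_contra h2
        have := (hmin e he (by rw [h]; exact h2)).2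
        rw [h] at this
        omega
    obtain ⟨i, hi⟩ := RD.ne_zero w
    have h1 := htm w i
    rw [hset, hdimtype w i] at h1
    exact (Nat.eq_of_mul_eq_mul_right (Nat.pos_of_ne_zero hi) h1).symm
  have hle := hlex v hlt
  -- labels at least v on groups of type at least v
  have hlab : ∀ e ∈ H, v ≤ (grp e).1 → v0 ≤ t e := by
    intro e he h
    by_contra h2
    have h3 : t e ≠ (grp e).1 := by
      intro h4; have : v0 ≤ (grp e).1.val := h; omega
    have := (hmin e he h3).1
    omega
  have hsm : ∀ e ∈ H, t e = v0 → v ≤ (grp e).1 := by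
    intro e he h
    by_cases h3 : t e = (grp e).1
    · show v0 ≤ _; omega
    · exact (hmin e he h3).2
  set c : E → ℤ := fun e => ec Q (β v) (vert e) with hc
  have htot : ∑ e ∈ H.filter (fun e => t e = v0), c e = m v := by
    rw [hc, ← euler_dimv]
    have : dimv vert (H.filter fun e => t e = v0) = fun i => m v * β v i := funext (htm v)
    rw [this, euler_ec]
    have h1 := RD.one v
    rw [euler_ec] at h1
    push_cast
    simp only [mul_assoc]
    rw [← Finset.mul_sum, h1, mul_one]
  have hnob : ∀ e0 ∈ H, v ≤ (grp e0).1 →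
      ¬ Bad Q β (grp e0).1 v (dimv vert ((H.filter fun e => grp e = grp e0).filter fun e => t e = v0)) := by
    intro e0 he0 h
    exact hno e0 he0 v (fun e he hge => hlab e he (by rw [hge]; exact h))
  have hsplit : ∑ e ∈ H.filter (fun e => t e = v0), c e
      = ∑ e ∈ H.filter (fun e => (grp e).1 = v ∧ t e = v0), c e
        + ∑ e ∈ H.filter (fun e => (grp e).1 ≠ v ∧ t e = v0), c e := by
    rw [← Finset.sum_filter_add_sum_filter_not (H.filter (fun e => t e = v0)) (fun e => (grp e).1 = v)]
    rw [Finset.filter_filter, Finset.filter_filter]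
    congr 1 <;> (apply Finset.sum_congr _ fun _ _ => rfl; ext e; simp only [Finset.mem_filter]; tauto)
  have h2nd : ∑ e ∈ H.filter (fun e => (grp e).1 ≠ v ∧ t e = v0), c e ≤ 0 := by
    rw [← Finset.sum_fiberwise_of_maps_to (t := (H.filter (fun e => (grp e).1 ≠ v ∧ t e = v0)).image grp) (g := grp)
      (fun e he => Finset.mem_image_of_mem _ he)]
    apply Finset.sum_nonpos
    intro g hgi
    obtain ⟨e0, he0, rfl⟩ := Finset.mem_image.mp hgi
    rw [Finset.mem_filter] at he0
    have hge := hsm e0 he0.1 he0.2.2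
    have hnb := hnob e0 he0.1 hge
    have hset : ((H.filter fun e => (grp e).1 ≠ v ∧ t e = v0).filter fun e => grp e = grp e0)
        = ((H.filter fun e => grp e = grp e0).filter fun e => t e = v0) := by
      ext e
      simp only [Finset.mem_filter]
      constructor
      · tauto
      · rintro ⟨⟨h1, h2⟩, h3⟩
        exact ⟨⟨h1, by rw [h2]; exact he0.2.1, h3⟩, h2⟩
    rw [hset, hc, ← euler_dimv]
    by_contra hpos
    push Not at hpos
    exact hnb (Or.inl ⟨lt_of_le_of_ne hge (Ne.symm he0.2.1), hpos⟩)
  have hk1 : ∀ k ∈ Finset.range (m' v), ∑ e ∈ (H.filter fun e => grp e = (v, k)).filter (fun e => t e = v0), c e ≤ 1 ∧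
      (∑ e ∈ (H.filter fun e => grp e = (v, k)).filter (fun e => t e = v0), c e = 1 →
        dimv vert ((H.filter fun e => grp e = (v, k)).filter (fun e => t e = v0)) = β v) := by
    intro k hk
    have hd := hgm v k (Finset.mem_range.mp hk)
    obtain ⟨i, hi⟩ := RD.ne_zero v
    obtain ⟨e0, he0⟩ : (H.filter fun e => grp e = (v, k)).Nonempty := by
      by_contra hem
      rw [Finset.not_nonempty_iff_eq_empty] at hem
      apply hi
      rw [← hd, hem]; rfl
    rw [Finset.mem_filter] at he0
    have hnb := hnob e0 he0.1 (by rw [he0.2])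
    rw [he0.2] at hnb
    rw [hc, ← euler_dimv]
    by_cases hα : dimv vert ((H.filter fun e => grp e = (v, k)).filter (fun e => t e = v0)) = β v
    · rw [hα, RD.one v]; simp
    · have : ¬ 0 < Q.euler (β v) (dimv vert ((H.filter fun e => grp e = (v, k)).filter (fun e => t e = v0))) :=
        fun h => hnb (Or.inr ⟨rfl, hα, h⟩)
      constructor
      · omega
      · intro h; omega
  have h1st := htype (fun e => t e = v0) v c
  have hub : ∑ k ∈ Finset.range (m' v), ∑ e ∈ (H.filter fun e => grp e = (v, k)).filter (fun e => t e = v0), c e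
      ≤ ∑ k ∈ Finset.range (m' v), (1 : ℤ) := Finset.sum_le_sum fun k hk => (hk1 k hk).1
  have hcard : ∑ k ∈ Finset.range (m' v), (1 : ℤ) = m' v := by simp
  have hmm : m v = m' v := by
    have : (m' v : ℤ) ≤ m v := by exact_mod_cast hle
    omega
  have heach : ∀ k ∈ Finset.range (m' v), ∑ e ∈ (H.filter fun e => grp e = (v, k)).filter (fun e => t e = v0), c e = 1 := by
    apply (Finset.sum_eq_sum_iff_of_le (fun k hk => (hk1 k hk).1)).mp
    apply le_antisymm hub
    have : (m' v : ℤ) ≤ m v := by exact_mod_cast hle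
    omega
  have hsub : (H.filter fun e => (grp e).1 = v) ⊆ H.filter fun e => t e = v0 := by
    intro e he
    rw [Finset.mem_filter] at he
    have hk : (grp e).2 ∈ Finset.range (m' v) := by
      rw [Finset.mem_range, ← he.2]; exact hg e he.1
    have h1 := (hk1 _ hk).2 (heach _ hk)
    have h2 : (H.filter fun e' => grp e' = (v, (grp e).2)).filter (fun e' => t e' = v0) = H.filter fun e' => grp e' = (v, (grp e).2) := by
      apply eq_of_dimv vert (Finset.filter_subset _ _)
      rw [h1, hgm v _ (Finset.mem_range.mp hk)]
    have h3 : e ∈ (H.filter fun e' => grp e' = (v, (grp e).2)).filter (fun e' => t e' = v0) := by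
      rw [h2, Finset.mem_filter]
      exact ⟨he.1, Prod.ext he.2 rfl⟩
    rw [Finset.mem_filter]
    exact ⟨he.1, (Finset.mem_filter.mp h3).2⟩
  have heq := eq_of_dimv vert hsub (by
    funext i
    have := htm v i
    rw [hdimtype v i, this, hmm])
  apply hne1
  rcases hv1 with h | h
  · have : e1 ∈ H.filter fun e => t e = v0 := Finset.mem_filter.mpr ⟨he1, h⟩
    rw [← heq, Finset.mem_filter] at this
    rw [h, this.2]
  · have : e1 ∈ H.filter fun e => (grp e).1 = v := Finset.mem_filter.mpr ⟨he1, Fin.ext h⟩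
    rw [heq, Finset.mem_filter] at this
    rw [h, this.2]

end K4

section K5
variable {E : Type} [DecidableEq E] {K : Type} (Q : FinQuiver n) (vert : E → Fin n) {r : ℕ}
  (β : Fin r → Fin n → ℕ)

/-- pairs ordered by label -/
def Pr (s : E → ℕ) (H : Finset E) : Finset (E × E) := (H ×ˢ H).filter fun p => s p.1 < s p.2

lemma mem_Pr {s : E → ℕ} {H : Finset E} {p : E × E} :
    p ∈ Pr s H ↔ (p.1 ∈ H ∧ p.2 ∈ H) ∧ s p.1 < s p.2 := by simp [Pr]

def SumRep (H : Finset E) (S : Finset (E × E)) (N P : MvPolynomial E ℚ) : Prop :=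
  ∀ (L : Type) [Field L] [Algebra ℚ L] (z : E → L), InjH H z →
      aeval z P = ∑ w ∈ W vert H, aeval (z ∘ w) N * Kk Q vert S (z ∘ w)

def Kill (H : Finset E) (s : E → ℕ) : Prop :=
  ∀ N P, SumRep Q vert H (Pr s H) N P → ∀ (L : Type) [Field L] [Algebra ℚ L] (z : E → L),
    ConstH H z → aeval z P = 0

def VH (k : ℕ) : Prop :=
  ∀ (H : Finset E) (s : E → ℕ) (u v : Fin r), dimv vert H = β u → (∀ e ∈ H, (v : ℕ) ≤ s e) →
    Bad Q β u v (dimv vert (H.filter fun e => s e = v)) → (H.filter fun e => s e = v).card < k →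
    Kill Q vert H s

lemma Kk_Pr_perm {L : Type} [Field L] (s : E → ℕ) (H : Finset E) {w : Equiv.Perm E} (hw : w ∈ W vert H)
    (z : E → L) : Kk Q vert (Pr s H) (z ∘ w) = Kk Q vert (Pr (fun e => s (w⁻¹ e)) H) z := by
  have hw' := (mem_W.mp hw).2
  refine Finset.prod_nbij' (fun p => (w p.1, w p.2)) (fun p => (w⁻¹ p.1, w⁻¹ p.2)) ?_ ?_ ?_ ?_ ?_
  · intro p hp
    rw [mem_Pr] at hp ⊢
    simp only [W_apply_mem hw, perm_ia]; exact hp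
  · intro p hp
    rw [mem_Pr] at hp ⊢
    simp only [W_apply_mem (W_inv hw)]; exact hp
  · intro p _; simp
  · intro p _; simp
  · intro p _; simp [hw']

lemma dimv_perm (s : E → ℕ) (H : Finset E) {w : Equiv.Perm E} (hw : w ∈ W vert H) (u : ℕ) :
    dimv vert (H.filter fun e => s (w⁻¹ e) = u) = dimv vert (H.filter fun e => s e = u) := by
  have hw' := (mem_W.mp hw).2
  have hw2 := (mem_W.mp (W_inv hw)).2
  funext i
  refine Finset.card_nbij' (fun e => w⁻¹ e) (fun e => w e) ?_ ?_ ?_ ?_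
  · intro e he
    simp only [Finset.mem_coe, Finset.mem_filter, W_apply_mem (W_inv hw), hw2] at he ⊢
    exact he
  · intro e he
    simp only [Finset.mem_coe, Finset.mem_filter, W_apply_mem hw, hw', perm_ia] at he ⊢
    exact he
  · intro e _; simp
  · intro e _; simp

/-- clearing denominators -/
lemma Kk_clear {L : Type} [Field L] (C D : Finset (E × E)) (z : E → L)
    (hC : (C.filter fun p => vert p.1 = vert p.2) ⊆ D) (hz : ∀ p ∈ C, z p.2 ≠ z p.1) :
    Dd D z * Kk Q vert C z = numK Q vert C z * Dd (D \ C.filter fun p => vert p.1 = vert p.2) z := by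
  rw [Kk_eq Q vert C z hz]
  have h3 : Dd D z = Dd (D \ C.filter fun p => vert p.1 = vert p.2) z * Dd (C.filter fun p => vert p.1 = vert p.2) z := by
    rw [Dd, Dd, Dd, Finset.prod_sdiff hC]
  have h4 : Dd (C.filter fun p => vert p.1 = vert p.2) z ≠ 0 :=
    Dd_ne_zero fun p hp => hz p (Finset.mem_filter.mp hp).1
  rw [h3]
  field_simp

theorem partial_collapse (κ : E → K) (H G : Finset E) (hGH : G ⊆ H) (S : Finset (E × E))
    (hS : ∀ p ∈ S, (p.1 ∈ H \ G ∧ p.2 ∈ H \ G) ∧ p.1 ≠ p.2)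
    (hκ : ∀ p ∈ S, vert p.1 = vert p.2 → κ p.1 = κ p.2)
    (hGW : ∀ w ∈ W κ H, ∀ e, w e ∈ G ↔ e ∈ G)
    (c : ℕ) (hc : c ≠ 0) (Y P0 : MvPolynomial E ℚ)
    (hY : ∀ (L : Type) [Field L] [Algebra ℚ L] (z : E → L), InjH H z →
      (c : L) * aeval z Y = ∑ w ∈ W κ H, aeval (z ∘ w) P0 * Kk Q vert S (z ∘ w))
    (hP0 : ∀ (L : Type) [Field L] [Algebra ℚ L] (z : E → L), ConstH G z → aeval z P0 = 0)
    (L : Type) [Field L] [Algebra ℚ L] (z : E → L) (hz : ConstH G z) : aeval z Y = 0 := by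
  set D := Vf κ (H \ G) with hD
  set S' := S.filter fun p => vert p.1 = vert p.2 with hS'
  have hSD : S' ⊆ D := by
    intro p hp
    rw [hS', Finset.mem_filter] at hp
    rw [hD, mem_Vf]
    exact ⟨(hS p hp.1).1, (hS p hp.1).2, hκ p hp.1 hp.2⟩
  have hW : ∀ w ∈ W κ H, ∀ p ∈ D, (w p.1, w p.2) ∈ D := by
    intro w hw p hp
    rw [hD, mem_Vf] at hp ⊢
    simp only [Finset.mem_sdiff, W_apply_mem hw, hGW w hw, (mem_W.mp hw).2] at hp ⊢
    exact ⟨hp.1, fun h => hp.2.1 (w.injective h), hp.2.2⟩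
  have hDw : ∀ w ∈ W κ H, ∀ (L : Type) [Field L] (z : E → L), Dd D (z ∘ w) = Dd D z := by
    intro w hw L _ z
    exact prod_pairs_perm _ w (hW w hw) (hW _ (W_inv hw)) (fun a b => z b - z a)
  have key : (c : MvPolynomial E ℚ) * Dd D X * Y = ∑ w ∈ W κ H, rename w (P0 * (numK Q vert S X * Dd (D \ S') X)) := by
    apply eq_of_ux
    rw [map_mul, map_mul, Dd_aeval, map_natCast, map_sum, mul_right_comm, hY _ ux (ux_injH H), Finset.sum_mul]
    refine Finset.sum_congr rfl fun w hw => ?_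
    rw [aeval_rename, map_mul, map_mul, numK_aeval, Dd_aeval, ← Kk_clear Q vert S D _ hSD, hDw w hw]
    · ring
    · intro p hp h
      exact (hS p hp).2 (w.injective (ux_inj h)).symm
  have key2 : ∀ (L : Type) [Field L] [Algebra ℚ L] (z : E → L), ConstH G z → InjH (H \ G) z → aeval z Y = 0 := by
    intro L _ _ z hz hi
    haveI : CharZero L := algebraRat.charZero L
    have h := congrArg (aeval z) key
    rw [map_mul, map_mul, Dd_aeval, map_natCast, map_sum, Finset.sum_eq_zero] at h
    · have h1 : (c : L) ≠ 0 := Nat.cast_ne_zero.mpr hc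
      have h2 : Dd D z ≠ 0 := by
        apply Dd_ne_zero
        intro p hp h
        rw [hD, mem_Vf] at hp
        exact hp.2.1 (hi _ hp.1.2 _ hp.1.1 h).symm
      exact (mul_eq_zero.mp h).resolve_left (mul_ne_zero h1 h2)
    · intro w hw
      rw [aeval_rename, map_mul, hP0, zero_mul]
      intro e he e' he'
      exact hz _ ((hGW w hw e).mpr he) _ ((hGW w hw e').mpr he')
  by_cases hG : G.Nonempty
  · obtain ⟨e0, he0⟩ := hG
    let π : E → E := fun e => if e ∈ G then e0 else e
    have h1 : rename π Y = 0 := by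
      apply eq_of_ux
      rw [aeval_rename, map_zero]
      apply key2
      · intro e he e' he'
        simp [π, he, he']
      · intro e he e' he' h
        rw [Finset.mem_sdiff] at he he'
        simp only [Function.comp, π, if_neg he.2, if_neg he'.2] at h
        exact ux_inj h
    have h2 : z = z ∘ π := by
      funext e
      by_cases he : e ∈ G
      · simp only [Function.comp, π, if_pos he]; exact hz _ he _ he0
      · simp [π, he]
    rw [h2, ← aeval_rename, h1, map_zero]
  · rw [Finset.not_nonempty_iff_eq_empty] at hG
    have : Y = 0 := by
      apply eq_of_ux
      rw [map_zero]
      apply key2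
      · intro e he; rw [hG] at he; simp at he
      · exact ux_injH _
    rw [this, map_zero]

end K5

section K6
variable {E : Type} [DecidableEq E] {Q : FinQuiver n} (vert : E → Fin n) {r : ℕ}
  {β : Fin r → Fin n → ℕ}

lemma bad_term (RD : RData Q β) (k : ℕ) (hV : VH Q vert β k) (H : Finset E) (hk : H.card ≤ k)
    (t : E → ℕ) (grp : E → Fin r × ℕ) (m m' : Fin r → ℕ)
    (ht : ∀ e ∈ H, t e < r)
    (htm : ∀ u : Fin r, ∀ i, dimv vert (H.filter fun e => t e = u) i = m u * β u i)
    (hg : ∀ e ∈ H, (grp e).2 < m' (grp e).1)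
    (hgm : ∀ u k, k < m' u → dimv vert (H.filter fun e => grp e = (u, k)) = β u)
    (hlex : ∀ v, (∀ w, w < v → m w = m' w) → m' v ≤ m v)
    (hbad : ∃ e ∈ H, t e ≠ (grp e).1) (N Y : MvPolynomial E ℚ)
    (hY : ∀ (L : Type) [Field L] [Algebra ℚ L] (z : E → L), InjH H z →
      aeval z Y = ∑ w ∈ W (fun e => (vert e, grp e)) H, aeval (z ∘ w) N *
        Kk Q vert ((Pr t H).filter fun p => grp p.1 = grp p.2) (z ∘ w))
    (L : Type) [Field L] [Algebra ℚ L] (x : Fin r × ℕ → L) : aeval (x ∘ grp) Y = 0 := by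
  obtain ⟨e0, he0, v, hv, hb⟩ := bad_exists vert RD H t grp m m' ht htm hg hgm hlex hbad
  set G := H.filter fun e => grp e = grp e0 with hG
  have hGH : G ⊆ H := Finset.filter_subset _ _
  have hdG : dimv vert G = β (grp e0).1 := hgm (grp e0).1 (grp e0).2 (hg e0 he0)
  have hcard : (G.filter fun e => t e = v).card < k := by
    refine lt_of_lt_of_le (Finset.card_lt_card ?_) ((Finset.card_le_card hGH).trans hk)
    refine (Finset.filter_subset _ _).ssubset_of_ne ?_
    intro h
    apply hb.ne RD
    rw [h, hdG]
  have hkill : Kill Q vert G t := hV G t (grp e0).1 v hdG (by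
    intro e he
    rw [hG, Finset.mem_filter] at he
    exact hv e he.1 he.2) hb hcard
  have hGiff : ∀ e, e ∈ G ↔ e ∈ H ∧ grp e = grp e0 := by intro e; rw [hG, Finset.mem_filter]
  obtain ⟨P0, hP0⟩ := lemA' Q vert vert G (Pr t G) (Finset.filter_subset _ _)
    (fun p hp h => by rw [mem_Pr, h] at hp; omega) (fun p _ h => h)
    (fun p hp hp' => by
      rw [mem_Pr] at hp hp'
      have := hp.2; have := hp'.2; simp only [Prod.fst_swap, Prod.snd_swap] at this; omega) N
  have hsub : ∀ x ∈ W vert G, x ∈ W (fun e => (vert e, grp e)) H := by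
    intro x hx
    have hx' := mem_W.mp hx
    rw [mem_W]
    refine ⟨fun e he => hx'.1 e fun h => he (hGH h), fun e => ?_⟩
    refine Prod.ext (hx'.2 e) ?_
    show grp (x e) = grp e
    by_cases he : e ∈ G
    · have h2 := (W_apply_mem hx).mpr he
      rw [((hGiff _).mp he).2, ((hGiff _).mp h2).2]
    · rw [hx'.1 e he]
  have hGW : ∀ w ∈ W (fun e => (vert e, grp e)) H, ∀ e, w e ∈ G ↔ e ∈ G := by
    intro w hw e
    have : grp (w e) = grp e := congrArg Prod.snd ((mem_W.mp hw).2 e)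
    rw [hGiff, hGiff, W_apply_mem hw, this]
  refine partial_collapse Q vert (fun e => (vert e, grp e)) H G hGH
    (((Pr t H).filter fun p => grp p.1 = grp p.2).filter fun p => p.1 ∉ G) ?_ ?_ hGW
    (W vert G).card (W_card_pos vert G).ne' Y P0 ?_ (hkill N P0 hP0) L _ ?_
  · intro p hp
    simp only [Finset.mem_filter, mem_Pr, hGiff, Finset.mem_sdiff] at hp ⊢
    refine ⟨⟨⟨hp.1.1.1.1, hp.2⟩, hp.1.1.1.2, ?_⟩, fun h => ?_⟩
    · rw [← hp.1.2]; intro h; exact hp.2 ⟨hp.1.1.1.1, h.2⟩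
    · rw [h] at hp; omega
  · intro p hp h
    simp only [Finset.mem_filter] at hp
    exact Prod.ext h hp.1.2
  · intro L _ _ z hz
    rw [hY L z hz]
    have h1 : ∀ y ∈ W vert G, ∑ w ∈ W (fun e => (vert e, grp e)) H, aeval (z ∘ w) N *
        Kk Q vert ((Pr t H).filter fun p => grp p.1 = grp p.2) (z ∘ w)
        = ∑ w ∈ W (fun e => (vert e, grp e)) H, aeval (z ∘ (w * y : Equiv.Perm E)) N *
        Kk Q vert ((Pr t H).filter fun p => grp p.1 = grp p.2) (z ∘ (w * y : Equiv.Perm E)) := by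
      intro y hy
      exact (W_sum_right (hsub y hy) (fun w : Equiv.Perm E => aeval (z ∘ w) N *
        Kk Q vert ((Pr t H).filter fun p => grp p.1 = grp p.2) (z ∘ w))).symm
    have h2 := Finset.sum_congr (rfl : W vert G = W vert G) h1
    rw [Finset.sum_const, nsmul_eq_mul, Finset.sum_comm] at h2
    rw [h2]
    refine Finset.sum_congr rfl fun w hw => ?_
    rw [hP0 L (z ∘ w) (fun e he e' he' h => hz.comp hw e (hGH he) e' (hGH he') h), Finset.sum_mul]
    refine Finset.sum_congr rfl fun y hy => ?_
    have h3 : (z ∘ (w * y : Equiv.Perm E)) = (z ∘ w) ∘ y := rfl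
    rw [h3, mul_assoc]
    congr 1
    rw [Kk, ← Finset.prod_filter_mul_prod_filter_not _ (fun p => p.1 ∈ G)]
    congr 1
    · apply Finset.prod_congr _ fun _ _ => rfl
      ext p
      simp only [Finset.mem_filter, mem_Pr, hGiff]
      constructor
      · rintro ⟨⟨⟨⟨a, b⟩, c⟩, d⟩, e⟩
        exact ⟨⟨e, b, d ▸ e.2⟩, c⟩
      · rintro ⟨⟨a, b⟩, c⟩
        exact ⟨⟨⟨⟨a.1, b.1⟩, c⟩, a.2.trans b.2.symm⟩, a⟩
    · refine Finset.prod_congr rfl fun p hp => ?_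
      simp only [Finset.mem_filter, mem_Pr, hGiff] at hp
      have hy1 := (mem_W.mp hy).1
      have e1 : y p.1 = p.1 := hy1 _ fun h => hp.2 ((hGiff _).mp h)
      have e2 : y p.2 = p.2 := hy1 _ fun h => hp.2 ⟨hp.1.1.1.1, hp.1.2.trans ((hGiff _).mp h).2⟩
      simp only [Function.comp, e1, e2]
  · intro e he e' he'
    simp only [Function.comp, ((hGiff _).mp he).2, ((hGiff _).mp he').2]

theorem evalL (RD : RData Q β) (k : ℕ) (hV : VH Q vert β k) (H : Finset E) (hk : H.card ≤ k)
    (s : E → ℕ) (grp : E → Fin r × ℕ) (m m' : Fin r → ℕ)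
    (hs : ∀ e ∈ H, s e < r)
    (hsm : ∀ u : Fin r, ∀ i, dimv vert (H.filter fun e => s e = u) i = m u * β u i)
    (hg : ∀ e ∈ H, (grp e).2 < m' (grp e).1)
    (hgm : ∀ u k, k < m' u → dimv vert (H.filter fun e => grp e = (u, k)) = β u)
    (hlex : ∀ v, (∀ w, w < v → m w = m' w) → m' v ≤ m v)
    (N P : MvPolynomial E ℚ) (hP : SumRep Q vert H (Pr s H) N P)
    (L : Type) [Field L] [Algebra ℚ L] (x : Fin r × ℕ → L) (hx : Function.Injective x) :
    aeval (x ∘ grp) P = ∑ w ∈ (W vert H).filter (fun w => ∀ e ∈ H, s e = (grp (w e)).1),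
      aeval (x ∘ grp ∘ w) N * Kk Q vert (Pr s H) (x ∘ grp ∘ w) := by
  haveI : CharZero L := algebraRat.charZero L
  set κ : E → Fin n × (Fin r × ℕ) := fun e => (vert e, grp e) with hκ
  set D := (H ×ˢ H).filter fun p => vert p.1 = vert p.2 ∧ grp p.1 ≠ grp p.2 with hD
  let t : Equiv.Perm E → E → ℕ := fun w e => s (w⁻¹ e)
  let C : Equiv.Perm E → Finset (E × E) := fun w => (Pr (t w) H).filter fun p => ¬ grp p.1 = grp p.2
  let S : Equiv.Perm E → Finset (E × E) := fun w => (Pr (t w) H).filter fun p => grp p.1 = grp p.2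
  let M : Equiv.Perm E → MvPolynomial E ℚ := fun w =>
    numK Q vert (C w) X * Dd (D \ (C w).filter fun p => vert p.1 = vert p.2) X
  have hCD : ∀ w, ((C w).filter fun p => vert p.1 = vert p.2) ⊆ D := by
    intro w p hp
    simp only [C, Finset.mem_filter, mem_Pr, hD, Finset.mem_product] at hp ⊢
    tauto
  have hY : ∀ w : Equiv.Perm E, ∃ Y : MvPolynomial E ℚ, ∀ (L : Type) [Field L] [Algebra ℚ L] (z : E → L), InjH H z →
      aeval z Y = ∑ x ∈ W κ H, aeval (z ∘ x) (rename w N * M w) * Kk Q vert (S w) (z ∘ x) := by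
    intro w
    apply lemA'
    · exact (Finset.filter_subset _ _).trans (Finset.filter_subset _ _)
    · intro p hp h
      simp only [S, Finset.mem_filter, mem_Pr, h] at hp; omega
    · intro p hp h
      simp only [S, Finset.mem_filter] at hp
      exact Prod.ext h hp.2
    · intro p hp hp'
      simp only [S, Finset.mem_filter, mem_Pr, Prod.fst_swap, Prod.snd_swap] at hp hp'
      omega
  choose Y hY using hY
  have hDw : ∀ w ∈ W κ H, ∀ (L : Type) [Field L] (z : E → L), Dd D (z ∘ w) = Dd D z := by
    have aux : ∀ w ∈ W κ H, ∀ p ∈ D, (w p.1, w p.2) ∈ D := by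
      intro w hw p hp
      have h := fun e => (mem_W.mp hw).2 e
      simp only [hκ, Prod.mk.injEq] at h
      simp only [hD, Finset.mem_filter, Finset.mem_product, W_apply_mem hw, (h _).1, (h _).2] at hp ⊢
      exact hp
    intro w hw L _ z
    exact prod_pairs_perm _ w (aux w hw) (aux _ (W_inv hw)) (fun a b => z b - z a)
  have hsub : ∀ x ∈ W κ H, x ∈ W vert H := by
    intro x hx
    rw [mem_W] at hx ⊢
    exact ⟨hx.1, fun e => congrArg Prod.fst (hx.2 e)⟩
  have key : ((W κ H).card : MvPolynomial E ℚ) * Dd D X * P = ∑ w ∈ W vert H, Y w := by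
    apply eq_of_ux
    rw [map_mul, map_mul, Dd_aeval, map_natCast, map_sum, mul_assoc, ← nsmul_eq_mul, ← Finset.sum_const]
    have h1 : ∀ w ∈ W vert H, aeval ux (Y w) = ∑ x ∈ W κ H, Dd D ux *
        (aeval (ux ∘ (x * w : Equiv.Perm E)) N * Kk Q vert (Pr s H) (ux ∘ (x * w : Equiv.Perm E))) := by
      intro w hw
      rw [hY w _ ux (ux_injH H)]
      refine Finset.sum_congr rfl fun x hx => ?_
      have h2 : (ux ∘ (x * w : Equiv.Perm E) : E → FractionRing (MvPolynomial E ℚ)) = (ux ∘ x) ∘ w := rfl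
      have hin : Function.Injective (ux ∘ x : E → FractionRing (MvPolynomial E ℚ)) := ux_inj.comp x.injective
      rw [h2, Kk_Pr_perm Q vert s H hw, map_mul, aeval_rename, map_mul, numK_aeval, Dd_aeval,
        ← Kk_clear Q vert (C w) D _ (hCD w), hDw x hx]
      · have h3 : Kk Q vert (Pr (t w) H) (ux ∘ x : E → FractionRing (MvPolynomial E ℚ)) = Kk Q vert (S w) (ux ∘ x) * Kk Q vert (C w) (ux ∘ x) := by
          rw [Kk, Kk, Kk, Finset.prod_filter_mul_prod_filter_not]
        show _ = Dd D ux * (_ * Kk Q vert (Pr (t w) H) (ux ∘ x))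
        rw [h3]; ring
      · intro p hp h
        have := hin h
        simp only [C, Finset.mem_filter] at hp
        exact hp.2 (by rw [this])
    rw [Finset.sum_congr rfl h1, Finset.sum_comm]
    refine Finset.sum_congr rfl fun x hx => ?_
    rw [hP _ ux (ux_injH H), ← Finset.mul_sum]
    congr 1
    exact (W_sum_left (hsub x hx) (fun w : Equiv.Perm E => aeval (ux ∘ w) N * Kk Q vert (Pr s H) (ux ∘ w : E → FractionRing (MvPolynomial E ℚ)))).symm
  have key2 := congrArg (aeval (x ∘ grp)) key
  rw [map_mul, map_mul, Dd_aeval, map_natCast, map_sum,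
    ← Finset.sum_filter_add_sum_filter_not _ (fun w : Equiv.Perm E => ∀ e ∈ H, s e = (grp (w e)).1)] at key2
  have hc : ((W κ H).card : L) ≠ 0 := Nat.cast_ne_zero.mpr (W_card_pos κ H).ne'
  have hDne : Dd D (x ∘ grp) ≠ 0 := by
    apply Dd_ne_zero
    intro p hp h
    simp only [hD, Finset.mem_filter] at hp
    exact hp.2.2 (hx h).symm
  have hbad : ∑ w ∈ (W vert H).filter (fun w => ¬ ∀ e ∈ H, s e = (grp (w e)).1), aeval (x ∘ grp) (Y w) = 0 := by
    apply Finset.sum_eq_zero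
    intro w hw
    rw [Finset.mem_filter] at hw
    refine bad_term vert RD k hV H hk (t w) grp m m' ?_ ?_ hg hgm hlex ?_ _ (Y w) (hY w) L x
    · intro e he
      exact hs _ ((W_apply_mem (W_inv hw.1)).mpr he)
    · intro u i
      rw [← hsm u i]
      exact congrFun (dimv_perm vert s H hw.1 u) i
    · have := hw.2
      push Not at this
      obtain ⟨e, he, h⟩ := this
      refine ⟨w e, (W_apply_mem hw.1).mpr he, ?_⟩
      simpa [t] using h
  have hgood : ∀ w ∈ (W vert H).filter (fun w => ∀ e ∈ H, s e = (grp (w e)).1), aeval (x ∘ grp) (Y w)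
      = (W κ H).card * Dd D (x ∘ grp) * (aeval (x ∘ grp ∘ w) N * Kk Q vert (Pr s H) (x ∘ grp ∘ w)) := by
    intro w hw
    rw [Finset.mem_filter] at hw
    have htg : ∀ e ∈ H, t w e = (grp e).1 := by
      intro e he
      have := hw.2 (w⁻¹ e) ((W_apply_mem (W_inv hw.1)).mpr he)
      rw [perm_ai] at this
      exact this
    have hS0 : S w = ∅ := by
      apply Finset.filter_eq_empty_iff.mpr
      intro p hp h
      rw [mem_Pr, htg _ hp.1.1, htg _ hp.1.2, h] at hp
      omega
    have hC0 : C w = Pr (t w) H := by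
      have := Finset.filter_union_filter_not_eq (fun p : E × E => grp p.1 = grp p.2) (Pr (t w) H)
      rw [← this]
      show C w = S w ∪ C w
      rw [hS0, Finset.empty_union]
    have hYp : Y w = ∑ y ∈ W κ H, rename y (rename w N * M w) := by
      apply eq_of_ux
      rw [hY w _ ux (ux_injH H), map_sum]
      refine Finset.sum_congr rfl fun y _ => ?_
      rw [hS0, aeval_rename]
      simp [Kk]
    have hcst : ∀ y ∈ W κ H, aeval (x ∘ grp) (rename y (rename w N * M w)) = aeval (x ∘ grp) (rename w N * M w) := by
      intro y hy
      rw [aeval_rename]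
      congr 2
      funext e
      have := congrArg Prod.snd ((mem_W.mp hy).2 e)
      simp only [hκ] at this
      simp [this]
    rw [hYp, map_sum, Finset.sum_congr rfl hcst, Finset.sum_const, nsmul_eq_mul, map_mul, aeval_rename, map_mul,
      numK_aeval, Dd_aeval, ← Kk_clear Q vert (C w) D _ (hCD w), hC0]
    · have := Kk_Pr_perm Q vert s H hw.1 (x ∘ grp)
      rw [← Function.comp_assoc, this]
      ring
    · intro p hp h
      simp only [C, Finset.mem_filter] at hp
      exact hp.2 (hx h).symm
  rw [hbad, add_zero, Finset.sum_congr rfl hgood, ← Finset.mul_sum] at key2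
  exact mul_left_cancel₀ (mul_ne_zero hc hDne) key2

end K6

section K7
variable {E : Type} [DecidableEq E] {Q : FinQuiver n} (vert : E → Fin n) {r : ℕ}
  {β : Fin r → Fin n → ℕ}

lemma fibre_map {ι : Type} [Nonempty ι] [DecidableEq ι] (A : Finset E) (J : Finset ι) (b : ι → ℕ)
    (hc : A.card = ∑ j ∈ J, b j) :
    ∃ f : E → ι, (∀ e ∈ A, f e ∈ J) ∧ ∀ j ∈ J, (A.filter fun e => f e = j).card = b j := by
  have h1 : A.card = (J.sigma fun j => Finset.range (b j)).card := by
    rw [Finset.card_sigma, hc]; simp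
  let φ := Finset.equivOfCardEq h1
  refine ⟨fun e => if h : e ∈ A then (φ ⟨e, h⟩).1.1 else Classical.arbitrary ι, ?_, ?_⟩
  · intro e he
    simp only [dif_pos he]
    exact (Finset.mem_sigma.mp (φ ⟨e, he⟩).2).1
  · intro j hj
    rw [← Finset.card_range (b j)]
    refine Finset.card_bij' (fun e he => (φ ⟨e, (Finset.mem_filter.mp he).1⟩).1.2)
      (fun k hk => (φ.symm ⟨⟨j, k⟩, Finset.mem_sigma.mpr ⟨hj, hk⟩⟩).1) ?_ ?_ ?_ ?_
    · intro e he
      have he' := Finset.mem_filter.mp he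
      simp only [dif_pos he'.1] at he'
      have heA := he'.1
      have heq : (φ ⟨e, heA⟩).1.1 = j := he'.2
      have := (Finset.mem_sigma.mp (φ ⟨e, heA⟩).2).2
      rw [heq] at this
      exact this
    · intro k hk
      rw [Finset.mem_filter]
      refine ⟨(φ.symm _).2, ?_⟩
      simp only [dif_pos (φ.symm _).2]
      simp
    · intro e he
      have he' := Finset.mem_filter.mp he
      simp only [dif_pos he'.1] at he'
      have heA := he'.1
      have heq : (φ ⟨e, heA⟩).1.1 = j := he'.2
      have h2 : (⟨⟨j, (φ ⟨e, heA⟩).1.2⟩, Finset.mem_sigma.mpr ⟨hj, by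
        have := (Finset.mem_sigma.mp (φ ⟨e, heA⟩).2).2
        rw [heq] at this
        exact this⟩⟩ : (J.sigma fun j => Finset.range (b j))) = φ ⟨e, heA⟩ := by
        apply Subtype.ext
        refine Sigma.ext heq.symm HEq.rfl
      simp only [h2, Equiv.symm_apply_apply]
    · intro k hk
      simp

lemma exists_grp (u0 : Fin r) (A : Finset E) (a : Fin r → ℕ)
    (h : ∀ i, dimv vert A i = ∑ w, a w * β w i) :
    ∃ grp : E → Fin r × ℕ, (∀ e ∈ A, (grp e).2 < a (grp e).1) ∧
      ∀ u k, k < a u → dimv vert (A.filter fun e => grp e = (u, k)) = β u := by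
  haveI : Nonempty (Fin r × ℕ) := ⟨(u0, 0)⟩
  let J : Finset (Fin r × ℕ) := Finset.univ.biUnion fun u => (Finset.range (a u)).image fun k => (u, k)
  have hJ : ∀ j, j ∈ J ↔ j.2 < a j.1 := by
    rintro ⟨u, k⟩
    simp [J]
  have hsum : ∀ i, ∑ j ∈ J, β j.1 i = ∑ w, a w * β w i := by
    intro i
    rw [Finset.sum_biUnion]
    · refine Finset.sum_congr rfl fun w _ => ?_
      rw [Finset.sum_image (by intro _ _ _ _ h; simpa using h)]
      simp
    · intro u _ v _ huv
      rw [Function.onFun, Finset.disjoint_left]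
      intro j hj hj'
      simp only [Finset.mem_image] at hj hj'
      obtain ⟨_, _, rfl⟩ := hj
      obtain ⟨_, _, h⟩ := hj'
      exact huv (congrArg Prod.fst h).symm
  have hf : ∀ i : Fin n, ∃ f : E → Fin r × ℕ, (∀ e ∈ A.filter fun e => vert e = i, f e ∈ J) ∧
      ∀ j ∈ J, ((A.filter fun e => vert e = i).filter fun e => f e = j).card = β j.1 i := by
    intro i
    exact fibre_map (A.filter fun e => vert e = i) J (fun j => β j.1 i) ((h i).trans (hsum i).symm)
  choose f hf1 hf2 using hf
  refine ⟨fun e => f (vert e) e, ?_, ?_⟩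
  · intro e he
    exact (hJ _).mp (hf1 (vert e) e (Finset.mem_filter.mpr ⟨he, rfl⟩))
  · intro u k hk
    funext i
    rw [← hf2 i (u, k) ((hJ _).mpr hk), dimv]
    congr 1
    ext e
    simp only [Finset.mem_filter]
    constructor
    · rintro ⟨⟨h1, h2⟩, h3⟩
      rw [h3] at h2
      exact ⟨⟨h1, h3⟩, h2⟩
    · rintro ⟨⟨h1, h3⟩, h2⟩
      rw [h3]
      exact ⟨⟨h1, h2⟩, rfl⟩

lemma dimv_grp (A : Finset E) (a : Fin r → ℕ) (grp : E → Fin r × ℕ)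
    (hg : ∀ e ∈ A, (grp e).2 < a (grp e).1)
    (hgm : ∀ u k, k < a u → dimv vert (A.filter fun e => grp e = (u, k)) = β u) (u : Fin r) (i : Fin n) :
    dimv vert (A.filter fun e => ((grp e).1 : ℕ) = u) i = a u * β u i := by
  rw [dimv, Finset.card_eq_sum_card_fiberwise (f := fun e => (grp e).2) (t := Finset.range (a u))]
  · rw [Finset.sum_congr rfl (g := fun _ => β u i)]
    · simp
    · intro k hk
      rw [← hgm u k (Finset.mem_range.mp hk), dimv]
      congr 1
      ext e
      simp only [Finset.mem_filter, Prod.ext_iff, Fin.ext_iff]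
      tauto
  · intro e he
    simp only [Finset.mem_coe, Finset.mem_filter, Finset.mem_range] at he ⊢
    have := hg e he.1.1
    rwa [Fin.ext he.1.2] at this

lemma Pr_congr {s t : E → ℕ} {H : Finset E} (h : ∀ e ∈ H, s e = t e) : Pr s H = Pr t H := by
  apply Finset.filter_congr
  intro p hp
  rw [Finset.mem_product] at hp
  rw [h _ hp.1, h _ hp.2]

lemma good_Kk {L : Type} [Field L] (H : Finset E) (s : E → ℕ) (grp : E → Fin r × ℕ) {w : Equiv.Perm E}
    (hw : w ∈ W vert H) (h : ∀ e ∈ H, s e = (grp (w e)).1) (x : Fin r × ℕ → L) :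
    Kk Q vert (Pr s H) (x ∘ grp ∘ w) = Kk Q vert (Pr (fun e => ((grp e).1 : ℕ)) H) (x ∘ grp) := by
  rw [← Function.comp_assoc, Kk_Pr_perm Q vert s H hw]
  rw [Pr_congr]
  intro e he
  rw [h _ ((W_apply_mem (W_inv hw)).mpr he), perm_ai]

lemma const_of_deg (A : Finset E) (S : Finset (E × E))
    (hsum : ∑ p ∈ S, ep Q (vert p.1) (vert p.2) = 0) (P : MvPolynomial E ℚ)
    (hP : SumRep Q vert A S 1 P) : ∃ c, P = C c := by
  refine ⟨constantCoeff P, ?_⟩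
  apply eq_of_ux
  let L := FractionRing (MvPolynomial E ℚ)
  let F := FractionRing (Polynomial L)
  let a : Polynomial L →+* F := algebraMap (Polynomial L) F
  have hinj : Function.Injective a := IsFractionRing.injective _ _
  let z1 : E → Polynomial L := fun e => Polynomial.C (ux e)
  let z2 : E → Polynomial L := fun e => Polynomial.X * Polynomial.C (ux e)
  have hT : a Polynomial.X ≠ 0 := fun h => Polynomial.X_ne_zero (hinj (h.trans (map_zero _).symm))
  have i1 : InjH A (fun e => a (z1 e)) := fun e _ e' _ h => ux_inj (Polynomial.C_injective (hinj h))
  have i2 : InjH A (fun e => a (z2 e)) := fun e _ e' _ h =>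
    ux_inj (Polynomial.C_injective (mul_left_cancel₀ Polynomial.X_ne_zero (hinj h)))
  have h1 := hP F _ i1
  have h2 := hP F _ i2
  have h3 : aeval (fun e => a (z1 e)) P = aeval (fun e => a (z2 e)) P := by
    rw [h1, h2]
    refine Finset.sum_congr rfl fun w _ => ?_
    simp only [map_one, one_mul]
    have : Kk Q vert S ((fun e => a (z2 e)) ∘ w) = (a Polynomial.X) ^ (∑ p ∈ S, ep Q (vert p.1) (vert p.2)) * Kk Q vert S ((fun e => a (z1 e)) ∘ w) := by
      rw [← prod_zpow_sum hT, Kk, Kk, ← Finset.prod_mul_distrib]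
      refine Finset.prod_congr rfl fun p _ => ?_
      rw [← mul_zpow]
      simp only [Function.comp, z1, z2, map_mul]
      rw [mul_sub]
    rw [this, hsum, zpow_zero, one_mul]
  have e1 : aeval (fun e => a (z1 e)) P = a (aeval z1 P) := MvPolynomial.aeval_algebraMap_apply F z1 P
  have e2 : aeval (fun e => a (z2 e)) P = a (aeval z2 P) := MvPolynomial.aeval_algebraMap_apply F z2 P
  rw [e1, e2] at h3
  have h4 := congrArg (Polynomial.eval 0) (hinj h3)
  have hev : ∀ z : E → Polynomial L, Polynomial.eval 0 (aeval z P) = aeval (fun e => Polynomial.eval 0 (z e)) P := by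
    intro z
    have := MvPolynomial.comp_aeval_apply (φ := (Polynomial.aeval (0 : L)).restrictScalars ℚ) (f := z) P
    simpa only [AlgHom.restrictScalars_apply, Polynomial.coe_aeval_eq_eval] using this
  rw [hev, hev] at h4
  simp only [z1, z2, Polynomial.eval_C, Polynomial.eval_mul, Polynomial.eval_X, zero_mul] at h4
  rw [h4]
  rw [algHom_C]
  exact MvPolynomial.aeval_zero' P

theorem const_lemma (RD : RData Q β) (k : ℕ) (hV : VH Q vert β k) (u0 : Fin r) (A : Finset E) (hk : A.card ≤ k)
    (a : Fin r → ℕ) (ha : ∀ i, dimv vert A i = ∑ w, a w * β w i)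
    (hcompat : ∀ w w', w < w' → a w ≠ 0 → a w' ≠ 0 → Q.euler (β w) (β w') = 0) :
    ∃ s : E → Fin r, (∀ u i, dimv vert (A.filter fun e => s e = u) i = a u * β u i) ∧
      ∃ c : ℚ, c ≠ 0 ∧ SumRep Q vert A (Pr (fun e => (s e : ℕ)) A) 1 (C c) := by
  obtain ⟨grp, hg, hgm⟩ := exists_grp vert u0 A a ha
  have hd := dimv_grp vert A a grp hg hgm
  set s : E → ℕ := fun e => ((grp e).1 : ℕ) with hs
  have hd' : ∀ u i, dimv vert (A.filter fun e => (grp e).1 = u) i = a u * β u i := by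
    intro u i
    rw [← hd u i]
    simp only [hs, Fin.ext_iff]
  refine ⟨fun e => (grp e).1, hd', ?_⟩
  obtain ⟨P, hP⟩ := lemA' Q vert vert A (Pr s A) (Finset.filter_subset _ _)
    (fun p hp h => by rw [mem_Pr, h] at hp; omega) (fun p _ h => h)
    (fun p hp hp' => by
      rw [mem_Pr] at hp hp'
      have := hp.2; have := hp'.2; simp only [Prod.fst_swap, Prod.snd_swap] at this; omega) 1
  have hsum : ∑ p ∈ Pr s A, ep Q (vert p.1) (vert p.2) = 0 := by
    rw [← Finset.sum_fiberwise (Pr s A) (fun p => ((grp p.1).1, (grp p.2).1))]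
    apply Finset.sum_eq_zero
    rintro ⟨w, w'⟩ _
    by_cases hww : w < w'
    · have hset : (Pr s A).filter (fun p => ((grp p.1).1, (grp p.2).1) = (w, w'))
          = (A.filter fun e => (grp e).1 = w) ×ˢ (A.filter fun e => (grp e).1 = w') := by
        ext p
        simp only [Finset.mem_filter, mem_Pr, Prod.mk.injEq, Finset.mem_product, hs]
        constructor
        · tauto
        · rintro ⟨⟨h1, h2⟩, h3, h4⟩
          refine ⟨⟨⟨h1, h3⟩, ?_⟩, h2, h4⟩
          rw [h2, h4]; exact hww
      rw [hset, sum_ep, show dimv vert (A.filter fun e => (grp e).1 = w) = fun i => a w * β w i from funext (hd' w),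
        show dimv vert (A.filter fun e => (grp e).1 = w') = fun i => a w' * β w' i from funext (hd' w')]
      have hlin : Q.euler (fun i => a w * β w i) (fun i => a w' * β w' i) = a w * a w' * Q.euler (β w) (β w') := by
        simp only [FinQuiver.euler, mul_sub, Finset.mul_sum]
        push_cast
        congr 1 <;> exact Finset.sum_congr rfl fun _ _ => by ring
      rw [hlin]
      by_cases h1 : a w = 0
      · simp [h1]
      · by_cases h2 : a w' = 0
        · simp [h2]
        · rw [hcompat w w' hww h1 h2]; simp
    · apply Finset.sum_eq_zero
      intro p hp
      simp only [Finset.mem_filter, mem_Pr, Prod.mk.injEq, hs] at hp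
      exfalso; apply hww
      have := hp.1.2
      rw [hp.2.1, hp.2.2] at this
      exact this
  obtain ⟨c, rfl⟩ := const_of_deg vert A (Pr s A) hsum P hP
  refine ⟨c, ?_, hP⟩
  rintro rfl
  have hev := evalL vert RD k hV A hk s grp a a (fun e _ => (grp e).1.2) hd hg hgm (fun v _ => le_rfl) 1 _ hP
    (FractionRing (MvPolynomial (Fin r × ℕ) ℚ)) ux ux_inj
  rw [map_zero, map_zero] at hev
  have hval : ∀ w ∈ (W vert A).filter (fun w => ∀ e ∈ A, s e = (grp (w e)).1),
      aeval (ux ∘ grp ∘ w : E → FractionRing (MvPolynomial (Fin r × ℕ) ℚ)) (1 : MvPolynomial E ℚ) * Kk Q vert (Pr s A) (ux ∘ grp ∘ w) = Kk Q vert (Pr s A) (ux ∘ grp) := by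
    intro w hw
    rw [Finset.mem_filter] at hw
    rw [map_one, one_mul, good_Kk vert A s grp hw.1 hw.2 ux]
  rw [Finset.sum_congr rfl hval, Finset.sum_const, nsmul_eq_mul] at hev
  have h1 : ((W vert A).filter (fun w => ∀ e ∈ A, s e = (grp (w e)).1)).card ≠ 0 := by
    apply Finset.card_ne_zero_of_mem (a := 1)
    rw [Finset.mem_filter]
    exact ⟨W_one, fun e _ => rfl⟩
  have h2 : Kk Q vert (Pr s A) (ux ∘ grp : E → FractionRing (MvPolynomial (Fin r × ℕ) ℚ)) ≠ 0 := by
    apply Kk_ne_zero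
    intro p hp h
    rw [mem_Pr] at hp
    have := ux_inj h
    have h3 := hp.2
    simp only [hs, this] at h3
    omega
  rcases mul_eq_zero.mp hev.symm with h | h
  · exact h1 (by exact_mod_cast h)
  · exact h2 h

end K7

section K8
variable {E : Type} [DecidableEq E] {Q : FinQuiver n} (vert : E → Fin n) {r : ℕ}
  {β : Fin r → Fin n → ℕ}

lemma euler_sum_right (α γ : Fin n → ℕ) (a : Fin r → ℕ) (h : ∀ i, γ i = ∑ w, a w * β w i) :
    Q.euler α γ = ∑ w, (a w : ℤ) * Q.euler α (β w) := by
  simp only [euler_ec, Finset.mul_sum]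
  rw [Finset.sum_comm]
  refine Finset.sum_congr rfl fun i _ => ?_
  rw [h i]
  push_cast
  rw [Finset.sum_mul]
  exact Finset.sum_congr rfl fun _ _ => by ring

lemma Pr_asym {s : E → ℕ} {H : Finset E} : ∀ p ∈ Pr s H, p.swap ∉ Pr s H := by
  intro p hp hp'
  rw [mem_Pr] at hp hp'
  have := hp.2; have := hp'.2; simp only [Prod.fst_swap, Prod.snd_swap] at this; omega

lemma Pr_ne {s : E → ℕ} {H : Finset E} : ∀ p ∈ Pr s H, p.1 ≠ p.2 := by
  intro p hp h; rw [mem_Pr, h] at hp; omega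

lemma W_mono {H G : Finset E} (h : G ⊆ H) {w : Equiv.Perm E} (hw : w ∈ W vert G) : w ∈ W vert H := by
  rw [mem_W] at hw ⊢
  exact ⟨fun e he => hw.1 e fun h' => he (h h'), hw.2⟩

/-- inserting a constant symmetrization -/
lemma insert_const (H A : Finset E) (hA : A ⊆ H) (s s' s'' : E → ℕ) (c : ℚ)
    (hc : SumRep Q vert A (Pr s' A) 1 (C c))
    (hsA : ∀ e ∈ A, ∀ e' ∈ A, s e = s e')
    (hsp : Disjoint (Pr s H) (Pr s' A)) (hsp2 : Pr s'' H = Pr s H ∪ Pr s' A)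
    (N P : MvPolynomial E ℚ) (hP : SumRep Q vert H (Pr s H) N P) :
    SumRep Q vert H (Pr s'' H) (∑ x ∈ W vert A, rename (x⁻¹ : Equiv.Perm E) N) (C c * P) := by
  intro L _ _ z hz
  have hinv : ∀ x ∈ W vert A, ∀ y : E → L, Kk Q vert (Pr s H) (y ∘ x) = Kk Q vert (Pr s H) y := by
    intro x hx y
    rw [Kk_Pr_perm Q vert s H (W_mono vert hA hx), Pr_congr]
    intro e _
    by_cases he : e ∈ A
    · exact hsA _ ((W_apply_mem (W_inv hx)).mpr he) _ he
    · rw [(mem_W.mp (W_inv hx)).1 e he]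
  rw [map_mul, hP L z hz, Finset.mul_sum]
  have h1 : ∀ w ∈ W vert H, aeval z (C c) * (aeval (z ∘ w) N * Kk Q vert (Pr s H) (z ∘ w))
      = ∑ x ∈ W vert A, aeval ((z ∘ (w * x : Equiv.Perm E)) ∘ (x⁻¹ : Equiv.Perm E)) N * Kk Q vert (Pr s'' H) (z ∘ (w * x : Equiv.Perm E)) := by
    intro w hw
    have h2 := hc L (z ∘ w) (fun e he e' he' h => hz.comp hw e (hA he) e' (hA he') h)
    rw [algHom_C] at h2 ⊢
    rw [h2, Finset.sum_mul]
    refine Finset.sum_congr rfl fun x hx => ?_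
    have h3 : (z ∘ (w * x : Equiv.Perm E)) ∘ (x⁻¹ : Equiv.Perm E) = z ∘ w := by
      funext e; simp
    have h4 : z ∘ (w * x : Equiv.Perm E) = (z ∘ w) ∘ x := rfl
    rw [h3, h4, map_one, one_mul]
    have h5 : Kk Q vert (Pr s'' H) ((z ∘ w) ∘ x) = Kk Q vert (Pr s H) ((z ∘ w) ∘ x) * Kk Q vert (Pr s' A) ((z ∘ w) ∘ x) := by
      rw [Kk, hsp2, Finset.prod_union hsp, Kk, Kk]
    rw [h5, hinv x hx]
    ring
  rw [Finset.sum_congr rfl h1, Finset.sum_comm]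
  have h6 : ∀ x ∈ W vert A, ∑ w ∈ W vert H, aeval ((z ∘ (w * x : Equiv.Perm E)) ∘ (x⁻¹ : Equiv.Perm E)) N * Kk Q vert (Pr s'' H) (z ∘ (w * x : Equiv.Perm E))
      = ∑ w ∈ W vert H, aeval ((z ∘ w) ∘ (x⁻¹ : Equiv.Perm E)) N * Kk Q vert (Pr s'' H) (z ∘ w) := by
    intro x hx
    exact W_sum_right (W_mono vert hA hx) (fun w : Equiv.Perm E => aeval ((z ∘ w) ∘ (x⁻¹ : Equiv.Perm E)) N * Kk Q vert (Pr s'' H) (z ∘ w))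
  rw [Finset.sum_congr rfl h6, Finset.sum_comm]
  refine Finset.sum_congr rfl fun w _ => ?_
  rw [map_sum, Finset.sum_mul]
  refine Finset.sum_congr rfl fun x _ => ?_
  rw [aeval_rename]

/-- absorbing a symmetrization over a later block -/
lemma absorb (H B : Finset E) (hB : B ⊆ H) (s : E → ℕ) (c0 : ℕ)
    (hs1 : ∀ e ∈ H \ B, s e = c0) (hs2 : ∀ e ∈ B, c0 < s e)
    (N P : MvPolynomial E ℚ) (hP : SumRep Q vert H (Pr s H) N P) :
    ∃ N', SumRep Q vert H ((H \ B) ×ˢ B) N' (C ((W vert B).card : ℚ) * P) := by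
  obtain ⟨N', hN'⟩ := lemA' Q vert vert B (Pr s B) (Finset.filter_subset _ _) Pr_ne (fun p _ h => h) Pr_asym N
  refine ⟨N', ?_⟩
  intro L _ _ z hz
  have hdis : Disjoint ((H \ B) ×ˢ B) (Pr s B) := by
    rw [Finset.disjoint_left]
    intro p hp hp'
    rw [Finset.mem_product, Finset.mem_sdiff] at hp
    rw [mem_Pr] at hp'
    exact hp.1.2 hp'.1.1
  have hun : Pr s H = ((H \ B) ×ˢ B) ∪ Pr s B := by
    ext p
    rw [Finset.mem_union, mem_Pr, mem_Pr, Finset.mem_product, Finset.mem_sdiff]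
    constructor
    · rintro ⟨⟨h1, h2⟩, h3⟩
      by_cases h4 : p.2 ∈ B
      · by_cases h5 : p.1 ∈ B
        · exact Or.inr ⟨⟨h5, h4⟩, h3⟩
        · exact Or.inl ⟨⟨h1, h5⟩, h4⟩
      · exfalso
        rw [hs1 p.2 (Finset.mem_sdiff.mpr ⟨h2, h4⟩)] at h3
        by_cases h5 : p.1 ∈ B
        · have := hs2 _ h5; omega
        · rw [hs1 p.1 (Finset.mem_sdiff.mpr ⟨h1, h5⟩)] at h3; omega
    · rintro (⟨⟨h1, h2⟩, h3⟩ | ⟨⟨h1, h2⟩, h3⟩)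
      · refine ⟨⟨h1, hB h3⟩, ?_⟩
        rw [hs1 p.1 (Finset.mem_sdiff.mpr ⟨h1, h2⟩)]
        exact hs2 _ h3
      · exact ⟨⟨hB h1, hB h2⟩, h3⟩
  have hinv : ∀ x ∈ W vert B, ∀ y : E → L, Kk Q vert ((H \ B) ×ˢ B) (y ∘ x) = Kk Q vert ((H \ B) ×ˢ B) y := by
    intro x hx y
    have hv := (mem_W.mp hx).2
    have aux : ∀ x ∈ W vert B, ∀ p ∈ (H \ B) ×ˢ B, (x p.1, x p.2) ∈ (H \ B) ×ˢ B := by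
      intro x hx p hp
      rw [Finset.mem_product, Finset.mem_sdiff] at hp ⊢
      simp only [W_apply_mem hx, W_apply_mem (W_mono vert hB hx)]
      exact hp
    have := prod_pairs_perm _ x (aux x hx) (aux _ (W_inv hx)) (fun a b => (y b - y a) ^ ep Q (vert a) (vert b))
    rw [Kk, Kk, ← this]
    refine Finset.prod_congr rfl fun p _ => ?_
    simp only [Function.comp, hv]
  rw [map_mul, algHom_C, map_natCast, hP L z hz, ← nsmul_eq_mul, ← Finset.sum_const]
  have h1 : ∀ x ∈ W vert B, ∑ w ∈ W vert H, aeval (z ∘ w) N * Kk Q vert (Pr s H) (z ∘ w)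
      = ∑ w ∈ W vert H, aeval (z ∘ (w * x : Equiv.Perm E)) N * Kk Q vert (Pr s H) (z ∘ (w * x : Equiv.Perm E)) := by
    intro x hx
    exact (W_sum_right (W_mono vert hB hx) (fun w : Equiv.Perm E => aeval (z ∘ w) N * Kk Q vert (Pr s H) (z ∘ w))).symm
  rw [Finset.sum_congr rfl h1, Finset.sum_comm]
  refine Finset.sum_congr rfl fun w hw => ?_
  rw [hN' L (z ∘ w) (fun e he e' he' h => hz.comp hw e (hB he) e' (hB he') h), Finset.sum_mul]
  refine Finset.sum_congr rfl fun x hx => ?_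
  have h4 : z ∘ (w * x : Equiv.Perm E) = (z ∘ w) ∘ x := rfl
  have h5 : Kk Q vert (Pr s H) ((z ∘ w) ∘ x) = Kk Q vert ((H \ B) ×ˢ B) ((z ∘ w) ∘ x) * Kk Q vert (Pr s B) ((z ∘ w) ∘ x) := by
    rw [Kk, hun, Finset.prod_union hdis, Kk, Kk]
  rw [h4, h5, hinv x hx]
  ring

theorem VH_all (RD : RData Q β) (k : ℕ) : VH Q vert β k := by
  induction k with
  | zero => intro H s u v _ _ _ h; omega
  | succ k ih =>
    intro H s u v hdim hv hbad hcard
    set A := H.filter fun e => s e = v with hA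
    have hAH : A ⊆ H := Finset.filter_subset _ _
    have hle : ∀ i, dimv vert A i ≤ β u i := by
      intro i; rw [← hdim]; exact dimv_mono vert hAH i
    obtain ⟨a, ha, hcomp⟩ := RD.dec u _ hle
    have hpos : ∃ w, a w ≠ 0 ∧ 0 < Q.euler (β v) (β w) := by
      have h1 : 0 < Q.euler (β v) (dimv vert A) := by
        rcases hbad with h | h
        · exact h.2
        · rw [h.1]; exact h.2.2
      rw [euler_sum_right _ _ a ha] at h1
      by_contra hno
      push Not at hno
      have : ∑ w, (a w : ℤ) * Q.euler (β v) (β w) ≤ 0 := by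
        apply Finset.sum_nonpos
        intro w _
        by_cases h : a w = 0
        · simp [h]
        · exact mul_nonpos_of_nonneg_of_nonpos (by positivity) (hno w h)
      omega
    have hmin : ∃ w0, a w0 ≠ 0 ∧ ∀ w, a w ≠ 0 → w0 ≤ w := by
      obtain ⟨w, hw, _⟩ := hpos
      obtain ⟨w0, h0, h1⟩ := Finset.exists_min_image (Finset.univ.filter fun w => a w ≠ 0) id ⟨w, by simp [hw]⟩
      refine ⟨w0, by simpa using h0, fun w hw => h1 w (by simp [hw])⟩
    obtain ⟨w0, hw0, hw0min⟩ := hmin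
    have hw0u : w0 < u := by
      obtain ⟨w, hw, hwe⟩ := hpos
      have h1 : w ≤ v := by
        by_contra h
        have := RD.neg v w (not_le.mp h)
        omega
      have h2 := (hw0min w hw).trans h1
      rcases hbad with h | h
      · exact h2.trans_lt h.1
      · rw [h.1] at h2
        refine lt_of_le_of_ne h2 ?_
        intro h3
        apply h.2.1
        funext i
        apply le_antisymm (hle i)
        rw [ha i]
        refine le_trans ?_ (Finset.single_le_sum (f := fun w => a w * β w i) (fun _ _ => Nat.zero_le _) (Finset.mem_univ w0))
        rw [h3]
        rw [h3] at hw0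
        exact Nat.le_mul_of_pos_left _ (Nat.pos_of_ne_zero hw0)
    obtain ⟨s', hs'd, c, hc0, hc⟩ := const_lemma vert RD k ih u A (by omega) a ha hcomp
    intro N P hP L _ _ z hz
    let s'' : E → ℕ := fun e => if e ∈ A then (s' e : ℕ) else r + s e
    have hAiff : ∀ e, e ∈ A ↔ e ∈ H ∧ s e = v := by intro e; rw [hA, Finset.mem_filter]
    have hnA : ∀ e ∈ H, e ∉ A → (v : ℕ) < s e := by
      intro e he h
      have h1 := hv e he
      have h2 : s e ≠ v := fun h3 => h ((hAiff e).mpr ⟨he, h3⟩)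
      omega
    have hdis : Disjoint (Pr s H) (Pr (fun e => (s' e : ℕ)) A) := by
      rw [Finset.disjoint_left]
      intro p hp hp'
      rw [mem_Pr] at hp hp'
      have h1 := ((hAiff _).mp hp'.1.1).2
      have h2 := ((hAiff _).mp hp'.1.2).2
      omega
    have hun : Pr s'' H = Pr s H ∪ Pr (fun e => (s' e : ℕ)) A := by
      ext p
      rw [Finset.mem_union, mem_Pr, mem_Pr, mem_Pr]
      by_cases h1 : p.1 ∈ A
      · have h1' := (hAiff _).mp h1
        by_cases h2 : p.2 ∈ A
        · have h2' := (hAiff _).mp h2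
          simp only [s'', if_pos h1, if_pos h2, h1'.1, h2'.1, h1'.2, h2'.2, h1, h2]
          simp
        · simp only [s'', if_pos h1, if_neg h2, h1, h2, h1'.1, h1'.2]
          simp only [true_and, false_and, and_false, or_false]
          have := (s' p.1).2
          constructor
          · rintro ⟨h3, _⟩; exact ⟨h3, hnA _ h3 h2⟩
          · rintro ⟨h3, _⟩; exact ⟨h3, by omega⟩
      · by_cases h2 : p.2 ∈ A
        · have h2' := (hAiff _).mp h2
          simp only [s'', if_neg h1, if_pos h2, h1, h2, h2'.1, h2'.2]
          simp only [true_and, false_and, and_true, or_false]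
          have := (s' p.2).2
          constructor
          · rintro ⟨h3, h4⟩; omega
          · rintro ⟨h3, h4⟩; have := hnA _ h3 h1; omega
        · simp only [s'', if_neg h1, if_neg h2, h1, h2]
          simp
    have hrep := insert_const vert H A hAH s (fun e => (s' e : ℕ)) s'' c hc (by
      intro e he e' he'
      rw [((hAiff _).mp he).2, ((hAiff _).mp he').2]) hdis hun N P hP
    set B := H.filter fun e => ¬ (e ∈ A ∧ s' e = w0) with hB
    have hA0 : H \ B = A.filter fun e => s' e = w0 := by
      ext e
      simp only [hB, Finset.mem_sdiff, Finset.mem_filter]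
      constructor
      · rintro ⟨h1, h2⟩
        by_contra h3
        exact h2 ⟨h1, h3⟩
      · rintro h
        exact ⟨hAH h.1, fun h2 => h2.2 h⟩
    have hBH : B ⊆ H := Finset.filter_subset _ _
    obtain ⟨N', hN'⟩ := absorb vert H B hBH s'' w0 (by
      intro e he
      rw [hA0, Finset.mem_filter] at he
      simp only [s'', if_pos he.1, he.2]) (by
      intro e he
      rw [hB, Finset.mem_filter] at he
      by_cases h : e ∈ A
      · simp only [s'', if_pos h]
        have h1 : s' e ≠ w0 := fun h2 => he.2 ⟨h, h2⟩
        have h2 : a (s' e) ≠ 0 := by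
          intro h0
          have h3 := hs'd (s' e) (vert e)
          rw [h0, zero_mul, dimv, Finset.card_eq_zero] at h3
          have : e ∈ (A.filter fun e' => s' e' = s' e).filter fun e' => vert e' = vert e := by
            simp [h]
          rw [h3] at this
          simp at this
        exact lt_of_le_of_ne (hw0min _ h2) (fun h => h1 (Fin.ext h.symm))
      · simp only [s'', if_neg h]
        have := w0.2
        omega) _ _ hrep
    have hsum : 0 < ∑ p ∈ (H \ B) ×ˢ B, ep Q (vert p.1) (vert p.2) := by
      rw [sum_ep, euler_dimv]
      have h1 := Finset.sum_sdiff (f := fun e => ec Q (dimv vert (H \ B)) (vert e)) hBH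
      rw [← euler_dimv, ← euler_dimv, ← euler_dimv, hdim] at h1
      rw [← euler_dimv]
      have hd0 : dimv vert (H \ B) = fun i => a w0 * β w0 i := by
        rw [hA0]; exact funext (hs'd w0)
      rw [hd0] at h1 ⊢
      have e1 : ∀ γ, Q.euler (fun i => a w0 * β w0 i) γ = a w0 * Q.euler (β w0) γ := by
        intro γ
        simp only [FinQuiver.euler, mul_sub, Finset.mul_sum]
        push_cast
        congr 1 <;> exact Finset.sum_congr rfl fun _ _ => by ring
      have e2 : Q.euler (β w0) (fun i => a w0 * β w0 i) = a w0 * Q.euler (β w0) (β w0) := by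
        simp only [FinQuiver.euler, mul_sub, Finset.mul_sum]
        push_cast
        congr 1 <;> exact Finset.sum_congr rfl fun _ _ => by ring
      have e3 := e1 (β u)
      have e4 := e1 (fun i => a w0 * β w0 i)
      rw [e2, RD.one] at e4
      have e5 := RD.neg w0 u hw0u
      have e6 : (0 : ℤ) < a w0 := by exact_mod_cast Nat.pos_of_ne_zero hw0
      have e7 : (a w0 : ℤ) * Q.euler (β w0) (β u) ≤ 0 := mul_nonpos_of_nonneg_of_nonpos e6.le e5
      have e8 : (0 : ℤ) < a w0 * (a w0 * 1) := by positivity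
      rw [e4, e3] at h1
      linarith
    have hfin := lemB Q vert vert H _ (by
      intro p hp
      rw [Finset.mem_product] at hp ⊢
      exact ⟨(Finset.mem_sdiff.mp hp.1).1, hBH hp.2⟩) hsum N' _ hN' L z hz
    rw [map_mul, map_mul, algHom_C, algHom_C] at hfin
    haveI : CharZero L := algebraRat.charZero L
    have n1 : algebraMap ℚ L ((W vert B).card : ℚ) ≠ 0 := by
      rw [map_natCast]; exact Nat.cast_ne_zero.mpr (W_card_pos vert B).ne'
    have n2 : algebraMap ℚ L c ≠ 0 := by
      intro h; exact hc0 ((algebraMap ℚ L).injective (h.trans (map_zero _).symm))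
    exact ((mul_eq_zero.mp ((mul_eq_zero.mp hfin).resolve_left n1)).resolve_left n2)

end K8

section K9

/-- positions from a family of finite sets -/
def gset (T : Fin n → Finset ℕ) : Finset (Fin n × ℕ) :=
  Finset.univ.biUnion fun i => (T i).image fun j => (i, j)

lemma mem_gset {T : Fin n → Finset ℕ} {e : Fin n × ℕ} : e ∈ gset T ↔ e.2 ∈ T e.1 := by
  rcases e with ⟨i, j⟩
  simp [gset]

lemma prod_gset {M : Type} [CommMonoid M] (T : Fin n → Finset ℕ) (g : Fin n × ℕ → M) :
    ∏ e ∈ gset T, g e = ∏ i, ∏ j ∈ T i, g (i, j) := by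
  rw [gset, Finset.prod_biUnion]
  · refine Finset.prod_congr rfl fun i _ => ?_
    rw [Finset.prod_image (by intro _ _ _ _ h; simpa using h)]
  · intro u _ v _ huv
    rw [Function.onFun, Finset.disjoint_left]
    intro j hj hj'
    simp only [Finset.mem_image] at hj hj'
    obtain ⟨_, _, rfl⟩ := hj
    obtain ⟨_, _, h⟩ := hj'
    exact huv (congrArg Prod.fst h).symm

def Hset (γ : Fin n → ℕ) : Finset (Fin n × ℕ) := gset fun i => Finset.range (γ i)

lemma mem_Hset {γ : Fin n → ℕ} {e : Fin n × ℕ} : e ∈ Hset γ ↔ e.2 < γ e.1 := by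
  rw [Hset, mem_gset, Finset.mem_range]

def shf (γ : Fin n → ℕ) : Fin n × ℕ → Fin n × ℕ := fun e => (e.1, γ e.1 + e.2)

lemma rename_congr_vars {σ τ : Type} {f : MvPolynomial σ ℚ} {ρ ρ' : σ → τ} (h : ∀ v ∈ f.vars, ρ v = ρ' v) :
    rename ρ f = rename ρ' f := by
  refine hom_congr_vars (f₁ := (rename ρ : MvPolynomial σ ℚ →ₐ[ℚ] MvPolynomial τ ℚ).toRingHom)
    (f₂ := (rename ρ' : MvPolynomial σ ℚ →ₐ[ℚ] MvPolynomial τ ℚ).toRingHom) ?_ ?_ rfl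
  · ext; simp
  · intro i hi _
    simp [h i hi]

lemma aeval_congr_vars {σ : Type} {L : Type} [CommRing L] [Algebra ℚ L] {f : MvPolynomial σ ℚ} {z z' : σ → L}
    (h : ∀ v ∈ f.vars, z v = z' v) : aeval z f = aeval z' f := by
  refine hom_congr_vars (f₁ := (aeval z : MvPolynomial σ ℚ →ₐ[ℚ] L).toRingHom)
    (f₂ := (aeval z' : MvPolynomial σ ℚ →ₐ[ℚ] L).toRingHom) ?_ ?_ rfl
  · ext; simp
  · intro i hi _
    simp [h i hi]

lemma mkW {E K : Type} [DecidableEq E] (κ : E → K) (H : Finset E) (y : E → E) (hv : ∀ e ∈ H, κ (y e) = κ e)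
    (hm : ∀ e ∈ H, y e ∈ H) (hi : ∀ e ∈ H, ∀ e' ∈ H, y e = y e' → e = e') :
    ∃ x ∈ W κ H, ∀ e ∈ H, x e = y e := by
  let f : {e // e ∈ H} → {e // e ∈ H} := fun e => ⟨y e.1, hm _ e.2⟩
  have hf : Function.Injective f := by
    intro a b h
    exact Subtype.ext (hi _ a.2 _ b.2 (congrArg Subtype.val h))
  let p : Equiv.Perm {e // e ∈ H} := Equiv.ofBijective f (Finite.injective_iff_bijective.mp hf)
  have h1 : ∀ e ∈ H, Equiv.Perm.ofSubtype p e = y e := by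
    intro e he
    rw [Equiv.Perm.ofSubtype_apply_of_mem p he]
    rfl
  have h2 : ∀ e, e ∉ H → Equiv.Perm.ofSubtype p e = e := fun e he =>
    Equiv.Perm.ofSubtype_apply_of_not_mem p he
  refine ⟨Equiv.Perm.ofSubtype p, ?_, h1⟩
  rw [mem_W]
  refine ⟨h2, fun e => ?_⟩
  by_cases he : e ∈ H
  · rw [h1 e he, hv e he]
  · rw [h2 e he]

lemma symm_W {γ : Fin n → ℕ} {f : PolyQ n} (hf : f ∈ Hspace γ) {x : Equiv.Perm (Fin n × ℕ)}
    (hx : x ∈ W Prod.fst (Hset γ)) : rename x f = f := by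
  have hx' := mem_W.mp hx
  have hxi := mem_W.mp (W_inv hx)
  have hgen : ∀ T : Finset (Fin n), rename (fun p : Fin n × ℕ => if p.1 ∈ T then x p else p) f = f := by
    intro T
    induction T using Finset.induction_on with
    | empty =>
      simp only [Finset.notMem_empty, if_false]
      exact rename_id_apply f
    | insert i T hi ih =>
      have hfst : ∀ j, (i, (x (i, j)).2) = x (i, j) := fun j => Prod.ext (hx'.2 (i, j)).symm rfl
      have hfst' : ∀ j, (i, (x⁻¹ (i, j)).2) = x⁻¹ (i, j) := fun j => Prod.ext (hxi.2 (i, j)).symm rfl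
      let σ : Equiv.Perm ℕ :=
        { toFun := fun j => (x (i, j)).2
          invFun := fun j => (x⁻¹ (i, j)).2
          left_inv := fun j => by
            show (x⁻¹ (i, (x (i, j)).2)).2 = j
            rw [hfst, perm_ia]
          right_inv := fun j => by
            show (x (i, (x⁻¹ (i, j)).2)).2 = j
            rw [hfst', perm_ai] }
      have hσ : ∀ j, σ j ≠ j → j < γ i := by
        intro j h
        by_contra h2
        apply h
        show (x (i, j)).2 = j
        rw [hx'.1 (i, j) (by rw [mem_Hset]; exact h2)]
      have h1 := hf.2 i σ hσ
      conv_rhs => rw [← h1, ← ih, rename_rename]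
      conv_lhs => rw [← ih, ← ih]
      rw [ih, ih]
      apply rename_congr_vars
      intro p _
      by_cases hp : p.1 = i
      · obtain ⟨p1, p2⟩ := p
        simp only at hp
        subst hp
        simp only [Function.comp, if_neg hi, vertexPerm, Finset.mem_insert, true_or, if_true]
        exact (hfst p2).symm
      · by_cases hpT : p.1 ∈ T
        · simp only [Function.comp, if_pos hpT, vertexPerm, Finset.mem_insert, hpT, or_true, if_true]
          rw [if_neg]
          rw [hx'.2 p]; exact hp
        · simp only [Function.comp, if_neg hpT, vertexPerm, Finset.mem_insert, hp, false_or, if_false]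
  have := hgen Finset.univ
  simpa using this

lemma symm_rename {γ : Fin n → ℕ} {f : PolyQ n} (hf : f ∈ Hspace γ) (ρ ρ' : Fin n × ℕ → Fin n × ℕ)
    (h1 : ∀ e, (ρ e).1 = e.1) (h2 : ∀ e, (ρ' e).1 = e.1)
    (hi : ∀ e ∈ Hset γ, ∀ e' ∈ Hset γ, ρ e = ρ e' → e = e')
    (him : ∀ e ∈ Hset γ, ∃ e' ∈ Hset γ, ρ' e' = ρ e) : rename ρ f = rename ρ' f := by
  choose! y hy1 hy2 using him
  obtain ⟨x, hx, hxy⟩ := mkW Prod.fst (Hset γ) y (by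
    intro e he
    rw [← h2 (y e), hy2 e he, h1]) hy1 (by
    intro e he e' he' h
    apply hi e he e' he'
    rw [← hy2 e he, ← hy2 e' he', h])
  conv_rhs => rw [← symm_W hf hx, rename_rename]
  apply rename_congr_vars
  intro e he
  have he' : e ∈ Hset γ := mem_Hset.mpr (hf.1 e he)
  simp only [Function.comp, hxy e he', hy2 e he']

lemma mem_Hspace_of {γ : Fin n → ℕ} {f : PolyQ n} (hv : ∀ p ∈ f.vars, p ∈ Hset γ)
    (hs : ∀ x ∈ W Prod.fst (Hset γ), rename x f = f) : f ∈ Hspace γ := by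
  refine ⟨fun p hp => mem_Hset.mp (hv p hp), fun i σ hσ => ?_⟩
  have hmove : ∀ j, σ j < γ i → j < γ i := by
    intro j h
    by_contra h2
    have : σ j = j := by by_contra h3; exact h2 (hσ j h3)
    omega
  obtain ⟨x, hx, hxy⟩ := mkW Prod.fst (Hset γ) (vertexPerm i σ) (by
    intro e _
    by_cases h : e.1 = i <;> simp [vertexPerm, h]) (by
    intro e he
    rw [mem_Hset] at he ⊢
    by_cases h : e.1 = i
    · simp only [vertexPerm, if_pos h]
      by_contra h2
      have h3 : σ (σ e.2) = σ e.2 := by by_contra h4; exact h2 (hσ _ h4)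
      have h5 := σ.injective h3
      rw [h5] at h2; rw [h] at he; exact h2 he
    · simp only [vertexPerm, if_neg h]; exact he) (by
    intro e _ e' _ h
    by_cases h1 : e.1 = i <;> by_cases h2 : e'.1 = i <;> simp only [vertexPerm, h1, h2, if_true, if_false] at h
    · have := σ.injective (congrArg Prod.snd h)
      exact Prod.ext (h1.trans h2.symm) this
    · exact absurd (congrArg Prod.fst h).symm h2
    · exact absurd (congrArg Prod.fst h) h1
    · exact h)
  conv_rhs => rw [← hs x hx]
  apply rename_congr_vars
  intro e he
  exact (hxy e (hv e he)).symm

/-- membership of symmetrized sums -/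
lemma SumRep_mem {Q : FinQuiver n} {γ : Fin n → ℕ} {S : Finset ((Fin n × ℕ) × (Fin n × ℕ))} (hS : S ⊆ Hset γ ×ˢ Hset γ)
    {N P : PolyQ n} (hN : ∀ p ∈ N.vars, p ∈ Hset γ) (hP : SumRep Q Prod.fst (Hset γ) S N P) :
    P ∈ Hspace γ := by
  apply mem_Hspace_of
  · let g : Fin n × ℕ → PolyQ n := fun e => if e ∈ Hset γ then X e else 0
    let a := algebraMap (PolyQ n) (FractionRing (PolyQ n))
    have hinj : Function.Injective a := IsFractionRing.injective _ _
    have h1 := hP _ ux (ux_injH _)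
    have h2 := hP _ (fun e => a (g e)) (by
      intro e he e' he' h
      have := hinj h
      simp only [g, if_pos he, if_pos he'] at this
      exact X_injective this)
    have h3 : aeval (fun e => a (g e)) P = aeval ux P := by
      rw [h1, h2]
      refine Finset.sum_congr rfl fun w hw => ?_
      have hz : ∀ e ∈ Hset γ, a (g (w e)) = ux (w e) := by
        intro e he
        simp only [g, if_pos ((W_apply_mem hw).mpr he)]
        rfl
      congr 1
      · exact aeval_congr_vars fun v hv => hz v (hN v hv)
      · refine Finset.prod_congr rfl fun p hp => ?_
        have := Finset.mem_product.mp (hS hp)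
        simp only [Function.comp, hz _ this.1, hz _ this.2]
    have h4 : aeval (fun e => a (g e)) P = a (aeval g P) := MvPolynomial.aeval_algebraMap_apply _ g P
    rw [h4, aeval_ux] at h3
    have h5 : bind₁ g P = P := hinj h3
    intro p hp
    rw [← h5] at hp
    have := vars_bind₁ g P hp
    rw [Finset.mem_biUnion] at this
    obtain ⟨q, _, hq⟩ := this
    by_cases hqH : q ∈ Hset γ
    · simp only [g, if_pos hqH, vars_X, Finset.mem_singleton] at hq
      rw [hq]; exact hqH
    · simp [g, if_neg hqH] at hq
  · intro x hx
    apply eq_of_ux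
    rw [aeval_rename, hP _ _ ((ux_injH _).comp hx), hP _ _ (ux_injH _)]
    exact W_sum_left hx (fun w : Equiv.Perm (Fin n × ℕ) => aeval (ux ∘ w) N * Kk Q Prod.fst S (ux ∘ w : Fin n × ℕ → FractionRing (PolyQ n)))

lemma sort_facts (T : Finset ℕ) {j : ℕ} (hj : j < T.card) :
    (T.sort (· ≤ ·)).getD j 0 ∈ T ∧ ∀ j', j' < T.card →
      (T.sort (· ≤ ·)).getD j 0 = (T.sort (· ≤ ·)).getD j' 0 → j = j' := by
  have hlen := Finset.length_sort (s := T) (· ≤ ·)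
  have e : ∀ k (hk : k < T.card), (T.sort (· ≤ ·)).getD k 0 = (T.sort (· ≤ ·))[k]'(by rw [hlen]; exact hk) := by
    intro k hk
    exact List.getD_eq_getElem _ _ _
  constructor
  · rw [e j hj, ← Finset.mem_sort (· ≤ ·)]
    exact List.getElem_mem _
  · intro j' hj' h
    rw [e j hj, e j' hj'] at h
    exact (List.Nodup.getElem_inj_iff (Finset.sort_nodup T (· ≤ ·))).mp h

end K9

section D1

lemma sort_surj (T : Finset ℕ) {t : ℕ} (ht : t ∈ T) :
    ∃ j, j < T.card ∧ (T.sort (· ≤ ·)).getD j 0 = t := by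
  rw [← Finset.mem_sort (· ≤ ·), List.mem_iff_getElem] at ht
  obtain ⟨j, hj, h⟩ := ht
  refine ⟨j, by rwa [Finset.length_sort] at hj, ?_⟩
  rw [List.getD_eq_getElem _ _ hj, h]

noncomputable def srt (T : Fin n → Finset ℕ) : Fin n × ℕ → Fin n × ℕ :=
  fun p => (p.1, ((T p.1).sort (· ≤ ·)).getD p.2 0)

lemma substAlong_eq (T : Fin n → Finset ℕ) (f : PolyQ n) : substAlong T f = rename (srt T) f := by
  have h : substAlong T = rename (srt T) := by
    apply MvPolynomial.algHom_ext
    intro i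
    rw [substAlong, aeval_X, rename_X]
    rfl
  rw [h]

lemma mem_shuffles {γ₁ γ₂ : Fin n → ℕ} {S : Fin n → Finset ℕ} :
    S ∈ shuffles γ₁ γ₂ ↔ ∀ i, S i ⊆ Finset.range (γ₁ i + γ₂ i) ∧ (S i).card = γ₁ i := by
  simp [shuffles, Fintype.mem_piFinset]

lemma compl_card {γ₁ γ₂ : Fin n → ℕ} {S : Fin n → Finset ℕ} (hS : S ∈ shuffles γ₁ γ₂) (i : Fin n) :
    (shuffleCompl γ₁ γ₂ S i).card = γ₂ i := by
  have h := mem_shuffles.mp hS i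
  rw [shuffleCompl, Finset.card_sdiff_of_subset h.1, h.2, Finset.card_range]
  omega

lemma mem_compl {γ₁ γ₂ : Fin n → ℕ} {S : Fin n → Finset ℕ} {e : Fin n × ℕ} :
    e ∈ gset (shuffleCompl γ₁ γ₂ S) ↔ e ∈ Hset (γ₁ + γ₂) ∧ e ∉ gset S := by
  simp [mem_gset, shuffleCompl, mem_Hset]

/-- the kernel in terms of numerator and denominator -/
lemma kernel_eq (Q : FinQuiver n) (γ₁ γ₂ : Fin n → ℕ) (S : Fin n → Finset ℕ) :
    Kk Q Prod.fst (gset S ×ˢ gset (shuffleCompl γ₁ γ₂ S)) (ux : Fin n × ℕ → FractionRing (PolyQ n)) =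
      algebraMap (PolyQ n) (FractionRing (PolyQ n)) (interactionNum Q γ₁ γ₂ S) /
      algebraMap (PolyQ n) (FractionRing (PolyQ n)) (interactionDen γ₁ γ₂ S) := by
  set T := shuffleCompl γ₁ γ₂ S with hT
  let G : Fin n → Fin n → FractionRing (PolyQ n) := fun i i' =>
    ∏ j ∈ S i, ∏ j' ∈ T i', (ux (i', j') - ux (i, j))
  have hne : ∀ i i' j j', j ∈ S i → j' ∈ T i' →
      (ux (i', j') - ux (i, j) : FractionRing (PolyQ n)) ≠ 0 := by
    intro i i' j j' hj hj' h
    have := ux_inj (sub_eq_zero.mp h)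
    rw [Prod.mk.injEq] at this
    rw [hT, shuffleCompl, Finset.mem_sdiff] at hj'
    apply hj'.2
    rw [this.1, this.2]; exact hj
  have hG : ∀ i i', G i i' ≠ 0 := by
    intro i i'
    simp only [G]
    rw [Finset.prod_ne_zero_iff]
    intro j hj
    rw [Finset.prod_ne_zero_iff]
    intro j' hj'
    exact hne i i' j j' hj hj'
  have h1 : Kk Q Prod.fst (gset S ×ˢ gset T) (ux : Fin n × ℕ → FractionRing (PolyQ n)) =
      ∏ i, ∏ i', G i i' ^ ep Q i i' := by
    rw [Kk, Finset.prod_product, prod_gset]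
    refine Finset.prod_congr rfl fun i _ => ?_
    have : ∀ j ∈ S i, ∏ e' ∈ gset T, ((ux e' - ux (i, j) : FractionRing (PolyQ n))) ^ ep Q i e'.1 =
        ∏ i', ∏ j' ∈ T i', ((ux (i', j') - ux (i, j) : FractionRing (PolyQ n))) ^ ep Q i i' := by
      intro j _
      exact prod_gset T _
    rw [Finset.prod_congr rfl this, Finset.prod_comm]
    refine Finset.prod_congr rfl fun i' _ => ?_
    simp only [G, ← Finset.prod_zpow]
  have h2 : algebraMap (PolyQ n) (FractionRing (PolyQ n)) (interactionDen γ₁ γ₂ S) = ∏ i, G i i := by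
    rw [interactionDen, map_prod]
    refine Finset.prod_congr rfl fun i _ => ?_
    simp only [G, map_prod, map_sub]
    rw [Finset.prod_comm]
    rfl
  have h3 : algebraMap (PolyQ n) (FractionRing (PolyQ n)) (interactionNum Q γ₁ γ₂ S) =
      ∏ a : Q.Arr, G (Q.tl a) (Q.hd a) := by
    rw [interactionNum, map_prod]
    refine Finset.prod_congr rfl fun a _ => ?_
    simp only [G, arrowFactor, map_prod, map_sub]
    rw [Finset.prod_comm]
    rfl
  have h4 : ∏ a : Q.Arr, G (Q.tl a) (Q.hd a) =
      ∏ i, ∏ i', G i i' ^ (Finset.univ.filter fun a : Q.Arr => Q.tl a = i ∧ Q.hd a = i').card := by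
    rw [← Finset.prod_product']
    rw [← Finset.prod_fiberwise_of_maps_to (t := (Finset.univ ×ˢ Finset.univ : Finset (Fin n × Fin n)))
      (g := fun a => (Q.tl a, Q.hd a)) (by simp)]
    refine Finset.prod_congr rfl fun p _ => ?_
    rw [Finset.prod_congr rfl (g := fun _ => G p.1 p.2)]
    · rw [Finset.prod_const]
      congr 2
      ext a
      simp [Prod.ext_iff]
    · intro a ha
      have := (Finset.mem_filter.mp ha).2
      rw [← this]
  rw [h1, h2, h3, h4, ← Finset.prod_div_distrib]
  refine Finset.prod_congr rfl fun i _ => ?_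
  have h5 : G i i = ∏ i', (if i = i' then G i i' else 1) := by
    rw [Finset.prod_ite_eq]; simp
  rw [h5, ← Finset.prod_div_distrib]
  refine Finset.prod_congr rfl fun i' _ => ?_
  rw [ep, zpow_sub₀ (hG i i'), zpow_natCast]
  congr 1
  split_ifs <;> simp

/-- set of images -/
noncomputable def Sw (γ₁ γ₂ : Fin n → ℕ) (w : Equiv.Perm (Fin n × ℕ)) : Fin n → Finset ℕ :=
  fun i => (Finset.range (γ₁ i + γ₂ i)).filter fun j => w⁻¹ (i, j) ∈ Hset γ₁

lemma Hset_le {γ₁ γ₂ : Fin n → ℕ} : Hset γ₁ ⊆ Hset (γ₁ + γ₂) := by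
  intro e he
  rw [mem_Hset] at he ⊢
  rw [Pi.add_apply]; omega

lemma mem_Sw {γ₁ γ₂ : Fin n → ℕ} {w : Equiv.Perm (Fin n × ℕ)} (hw : w ∈ W Prod.fst (Hset (γ₁ + γ₂)))
    {e : Fin n × ℕ} : w e ∈ gset (Sw γ₁ γ₂ w) ↔ e ∈ Hset γ₁ := by
  rw [mem_gset, Sw, Finset.mem_filter]
  rw [Prod.mk.eta, perm_ia]
  constructor
  · exact fun h => h.2
  · intro h
    refine ⟨?_, h⟩
    have := (W_apply_mem hw).mpr (Hset_le h)
    rw [mem_Hset] at this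
    exact Finset.mem_range.mpr this

lemma Sw_shuffle {γ₁ γ₂ : Fin n → ℕ} {w : Equiv.Perm (Fin n × ℕ)} (hw : w ∈ W Prod.fst (Hset (γ₁ + γ₂))) :
    Sw γ₁ γ₂ w ∈ shuffles γ₁ γ₂ := by
  rw [mem_shuffles]
  intro i
  refine ⟨Finset.filter_subset _ _, ?_⟩
  rw [← Finset.card_range (γ₁ i)]
  have h1 := (mem_W.mp hw).2
  have h2 := (mem_W.mp (W_inv hw)).2
  have e1 : ∀ j, (i, (w⁻¹ (i, j)).2) = w⁻¹ (i, j) := fun j => Prod.ext (h2 (i, j)).symm rfl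
  have e2 : ∀ j, (i, (w (i, j)).2) = w (i, j) := fun j => Prod.ext (h1 (i, j)).symm rfl
  refine Finset.card_nbij' (fun j => (w⁻¹ (i, j)).2) (fun j => (w (i, j)).2) ?_ ?_ ?_ ?_
  · intro j hj
    have := (Finset.mem_filter.mp hj).2
    rw [← e1, mem_Hset] at this
    exact Finset.mem_coe.mpr (Finset.mem_range.mpr this)
  · intro j hj
    have hj' : (i, j) ∈ Hset γ₁ := by rw [mem_Hset]; exact Finset.mem_range.mp hj
    have := (mem_Sw hw).mpr hj'
    rw [← e2, mem_gset] at this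
    exact this
  · intro j _
    show (w (i, (w⁻¹ (i, j)).2)).2 = j
    rw [e1, perm_ai]
  · intro j _
    show (w⁻¹ (i, (w (i, j)).2)).2 = j
    rw [e2, perm_ia]

lemma Sw_eq_iff {γ₁ γ₂ : Fin n → ℕ} {w : Equiv.Perm (Fin n × ℕ)} (hw : w ∈ W Prod.fst (Hset (γ₁ + γ₂)))
    {S : Fin n → Finset ℕ} : Sw γ₁ γ₂ w = S ↔ ∀ e, w e ∈ gset S ↔ e ∈ Hset γ₁ := by
  constructor
  · rintro rfl e; exact mem_Sw hw
  · intro h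
    funext i
    ext j
    have h1 := mem_Sw hw (e := w⁻¹ (i, j))
    have h2 := h (w⁻¹ (i, j))
    rw [perm_ai, mem_gset] at h1 h2
    exact h1.trans h2.symm

lemma exists_wS {γ₁ γ₂ : Fin n → ℕ} {S : Fin n → Finset ℕ} (hS : S ∈ shuffles γ₁ γ₂) :
    ∃ w ∈ W Prod.fst (Hset (γ₁ + γ₂)), ∀ e, w e ∈ gset S ↔ e ∈ Hset γ₁ := by
  have hS' := mem_shuffles.mp hS
  have hC := compl_card hS
  let T := shuffleCompl γ₁ γ₂ S
  let y : Fin n × ℕ → Fin n × ℕ := fun e =>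
    if e.2 < γ₁ e.1 then srt S e else srt T (e.1, e.2 - γ₁ e.1)
  have hyS : ∀ e, e.2 < γ₁ e.1 → y e ∈ gset S := by
    intro e he
    simp only [y, if_pos he, mem_gset, srt]
    exact (sort_facts (S e.1) (by rw [(hS' _).2]; exact he)).1
  have hyT : ∀ e ∈ Hset (γ₁ + γ₂), ¬ e.2 < γ₁ e.1 → y e ∈ gset T := by
    intro e he h
    rw [mem_Hset, Pi.add_apply] at he
    simp only [y, if_neg h, mem_gset, srt]
    exact (sort_facts (T e.1) (by rw [hC]; omega)).1
  have hSH : ∀ e, e ∈ gset S → e ∈ Hset (γ₁ + γ₂) := by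
    intro e he
    rw [mem_gset] at he
    rw [mem_Hset]
    exact Finset.mem_range.mp ((hS' _).1 he)
  have hfst : ∀ e, (y e).1 = e.1 := by
    intro e; simp only [y]; split_ifs <;> rfl
  obtain ⟨w, hw, hwy⟩ := mkW Prod.fst (Hset (γ₁ + γ₂)) y (fun e _ => hfst e) (by
    intro e he
    by_cases h : e.2 < γ₁ e.1
    · exact hSH _ (hyS e h)
    · exact (mem_compl.mp (hyT e he h)).1) (by
    intro e he e' he' h
    have h1 : e.1 = e'.1 := by rw [← hfst e, h, hfst]
    by_cases hc : e.2 < γ₁ e.1 <;> by_cases hc' : e'.2 < γ₁ e'.1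
    · simp only [y, if_pos hc, if_pos hc', srt] at h
      refine Prod.ext h1 ((sort_facts (S e.1) (by rw [(hS' _).2]; exact hc)).2 _ (by rw [(hS' _).2, h1]; exact hc') ?_)
      have := congrArg Prod.snd h
      simp only at this
      rw [this, h1]
    · have a := hyS e hc
      have b := hyT e' he' hc'
      rw [← h] at b
      exact absurd a (mem_compl.mp b).2
    · have a := hyS e' hc'
      have b := hyT e he hc
      rw [h] at b
      exact absurd a (mem_compl.mp b).2
    · simp only [y, if_neg hc, if_neg hc', srt] at h
      rw [mem_Hset, Pi.add_apply] at he he'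
      have := (sort_facts (T e.1) (j := e.2 - γ₁ e.1) (by rw [hC]; omega)).2 (e'.2 - γ₁ e'.1) (by rw [hC, h1]; omega) (by
        have := congrArg Prod.snd h
        simp only at this
        rw [this, h1])
      refine Prod.ext h1 ?_
      rw [h1] at this hc he
      omega)
  refine ⟨w, hw, fun e => ?_⟩
  rw [mem_Hset]
  by_cases he : e ∈ Hset (γ₁ + γ₂)
  · rw [hwy e he]
    constructor
    · intro h
      by_contra h2
      exact (mem_compl.mp (hyT e he h2)).2 h
    · exact hyS e
  · rw [(mem_W.mp hw).1 e he]
    constructor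
    · intro h; exact absurd (hSH _ h) he
    · intro h; exact absurd (Hset_le (mem_Hset.mpr h)) he

noncomputable def stab (γ₁ γ₂ : Fin n → ℕ) : Finset (Equiv.Perm (Fin n × ℕ)) :=
  (W Prod.fst (Hset (γ₁ + γ₂))).filter fun w => ∀ e, w e ∈ Hset γ₁ ↔ e ∈ Hset γ₁

lemma stab_pos (γ₁ γ₂ : Fin n → ℕ) : 0 < (stab γ₁ γ₂).card :=
  Finset.card_pos.mpr ⟨1, Finset.mem_filter.mpr ⟨W_one, fun _ => Iff.rfl⟩⟩

lemma fibre_card {γ₁ γ₂ : Fin n → ℕ} {S : Fin n → Finset ℕ} (hS : S ∈ shuffles γ₁ γ₂) :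
    ((W Prod.fst (Hset (γ₁ + γ₂))).filter fun w => Sw γ₁ γ₂ w = S).card = (stab γ₁ γ₂).card := by
  obtain ⟨v, hv, hvS⟩ := exists_wS hS
  refine Finset.card_nbij' (fun w => v⁻¹ * w) (fun w => v * w) ?_ ?_ ?_ ?_
  · intro w hw
    obtain ⟨hw1, hw2⟩ := Finset.mem_filter.mp hw
    rw [Sw_eq_iff hw1] at hw2
    refine Finset.mem_coe.mpr (Finset.mem_filter.mpr ⟨W_mul (W_inv hv) hw1, fun e => ?_⟩)
    rw [← hw2 e, ← hvS, Equiv.Perm.mul_apply, perm_ai]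
  · intro w hw
    obtain ⟨hw1, hw2⟩ := Finset.mem_filter.mp hw
    refine Finset.mem_coe.mpr (Finset.mem_filter.mpr ⟨W_mul hv hw1, ?_⟩)
    rw [Sw_eq_iff (W_mul hv hw1)]
    intro e
    rw [← hw2 e, ← hvS, Equiv.Perm.mul_apply]
  · intro w _; simp
  · intro w _; simp

lemma term_eq (Q : FinQuiver n) {γ₁ γ₂ : Fin n → ℕ} {f₁ f₂ : PolyQ n} (hf₁ : f₁ ∈ Hspace γ₁) (hf₂ : f₂ ∈ Hspace γ₂)
    {w : Equiv.Perm (Fin n × ℕ)} (hw : w ∈ W Prod.fst (Hset (γ₁ + γ₂))) {L : Type} [Field L] [Algebra ℚ L]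
    (z : Fin n × ℕ → L) :
    aeval (z ∘ w) (f₁ * rename (shf γ₁) f₂) * Kk Q Prod.fst (Hset γ₁ ×ˢ (Hset (γ₁ + γ₂) \ Hset γ₁)) (z ∘ w) =
      aeval z (substAlong (Sw γ₁ γ₂ w) f₁) * aeval z (substAlong (shuffleCompl γ₁ γ₂ (Sw γ₁ γ₂ w)) f₂) *
        Kk Q Prod.fst (gset (Sw γ₁ γ₂ w) ×ˢ gset (shuffleCompl γ₁ γ₂ (Sw γ₁ γ₂ w))) z := by
  have hS := Sw_shuffle hw
  have hS' := mem_shuffles.mp hS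
  have hC := compl_card hS
  have hm := fun e => mem_Sw hw (e := e)
  set S := Sw γ₁ γ₂ w with hSdef
  set T := shuffleCompl γ₁ γ₂ S with hT
  have hw' := mem_W.mp hw
  have hwi := mem_W.mp (W_inv hw)
  have hmT : ∀ e, w e ∈ gset T ↔ e ∈ Hset (γ₁ + γ₂) \ Hset γ₁ := by
    intro e
    rw [mem_compl, hm e, W_apply_mem hw, Finset.mem_sdiff]
  have e1 : aeval (z ∘ w) f₁ = aeval z (substAlong S f₁) := by
    rw [← aeval_rename, substAlong_eq]
    congr 1
    apply symm_rename hf₁ w (srt S) hw'.2 (fun _ => rfl) (fun e _ e' _ h => w.injective h)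
    intro e he
    have h1 := (hm e).mpr he
    rw [mem_gset] at h1
    obtain ⟨j, hj, hj'⟩ := sort_surj _ h1
    refine ⟨((w e).1, j), ?_, Prod.ext rfl hj'⟩
    rw [mem_Hset]
    rw [(hS' _).2] at hj
    exact hj
  have e2 : aeval (z ∘ w) (rename (shf γ₁) f₂) = aeval z (substAlong T f₂) := by
    rw [← aeval_rename, rename_rename, substAlong_eq]
    congr 1
    apply symm_rename hf₂ (w ∘ shf γ₁) (srt T) (fun e => hw'.2 _) (fun _ => rfl)
    · intro e _ e' _ h
      have := w.injective h
      simp only [shf, Prod.mk.injEq] at this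
      refine Prod.ext this.1 ?_
      have h2 := this.2
      rw [this.1] at h2
      omega
    · intro e he
      have h1 : w (shf γ₁ e) ∈ gset T := by
        rw [hmT, Finset.mem_sdiff, mem_Hset, mem_Hset]
        rw [mem_Hset] at he
        simp only [shf, Pi.add_apply]
        omega
      rw [mem_gset] at h1
      obtain ⟨j, hj, hj'⟩ := sort_surj _ h1
      refine ⟨((w (shf γ₁ e)).1, j), ?_, Prod.ext rfl hj'⟩
      rw [mem_Hset]
      rw [hC] at hj
      exact hj
  have e3 : Kk Q Prod.fst (Hset γ₁ ×ˢ (Hset (γ₁ + γ₂) \ Hset γ₁)) (z ∘ w) = Kk Q Prod.fst (gset S ×ˢ gset T) z := by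
    refine Finset.prod_nbij' (fun p => (w p.1, w p.2)) (fun p => (w⁻¹ p.1, w⁻¹ p.2)) ?_ ?_ ?_ ?_ ?_
    · intro p hp
      rw [Finset.mem_product] at hp ⊢
      exact ⟨(hm _).mpr hp.1, (hmT _).mpr hp.2⟩
    · intro p hp
      rw [Finset.mem_product] at hp ⊢
      refine ⟨(hm _).mp ?_, (hmT _).mp ?_⟩
      · rw [perm_ai]; exact hp.1
      · rw [perm_ai]; exact hp.2
    · intro p _; simp
    · intro p _; simp
    · intro p _
      simp only [Function.comp, hw'.2]
  rw [map_mul, e1, e2, e3]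

theorem link2 (Q : FinQuiver n) {γ₁ γ₂ : Fin n → ℕ} {f₁ f₂ : PolyQ n} (hf₁ : f₁ ∈ Hspace γ₁) (hf₂ : f₂ ∈ Hspace γ₂) :
    SumRep Q Prod.fst (Hset (γ₁ + γ₂)) (Hset γ₁ ×ˢ (Hset (γ₁ + γ₂) \ Hset γ₁)) (f₁ * rename (shf γ₁) f₂)
      (C ((stab γ₁ γ₂).card : ℚ) * cohaMul Q γ₁ γ₂ f₁ f₂) := by
  obtain ⟨P, hP⟩ := lemA' Q Prod.fst Prod.fst (Hset (γ₁ + γ₂)) (Hset γ₁ ×ˢ (Hset (γ₁ + γ₂) \ Hset γ₁)) (by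
    intro p hp
    rw [Finset.mem_product, Finset.mem_sdiff] at hp
    exact Finset.mem_product.mpr ⟨Hset_le hp.1, hp.2.1⟩) (by
    intro p hp h
    rw [Finset.mem_product, Finset.mem_sdiff] at hp
    exact hp.2.2 (h ▸ hp.1)) (fun _ _ h => h) (by
    intro p hp h
    rw [Finset.mem_product, Finset.mem_sdiff] at hp h
    exact hp.2.2 h.1) (f₁ * rename (shf γ₁) f₂)
  have h1 := hP _ ux (ux_injH _)
  have hc : ((stab γ₁ γ₂).card : ℚ) ≠ 0 := by exact_mod_cast (stab_pos γ₁ γ₂).ne'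
  have h2 : algebraMap (PolyQ n) (FractionRing (PolyQ n)) P =
      algebraMap (PolyQ n) (FractionRing (PolyQ n)) (C ((stab γ₁ γ₂).card : ℚ)) * cohaMulRat Q γ₁ γ₂ f₁ f₂ := by
    rw [← aeval_ux, h1, Finset.sum_congr rfl (fun w hw => term_eq Q hf₁ hf₂ hw ux),
      ← Finset.sum_fiberwise_of_maps_to (t := shuffles γ₁ γ₂) (g := Sw γ₁ γ₂) (fun w hw => Sw_shuffle hw),
      cohaMulRat, Finset.mul_sum]
    refine Finset.sum_congr rfl fun S hS => ?_
    rw [Finset.sum_congr rfl (g := fun _ => algebraMap (PolyQ n) (FractionRing (PolyQ n))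
        (substAlong S f₁ * substAlong (shuffleCompl γ₁ γ₂ S) f₂ * interactionNum Q γ₁ γ₂ S) /
      algebraMap (PolyQ n) (FractionRing (PolyQ n)) (interactionDen γ₁ γ₂ S))]
    · rw [Finset.sum_const, fibre_card hS, nsmul_eq_mul]
      congr 1
      simp
    · intro w hw
      have := (Finset.mem_filter.mp hw).2
      rw [this, aeval_ux, aeval_ux, kernel_eq, map_mul, map_mul]
      ring
  have hex : ∃ P' : PolyQ n, algebraMap (PolyQ n) (FractionRing (PolyQ n)) P' = cohaMulRat Q γ₁ γ₂ f₁ f₂ := by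
    refine ⟨C ((stab γ₁ γ₂).card : ℚ)⁻¹ * P, ?_⟩
    rw [map_mul, h2, ← mul_assoc, ← map_mul, ← C_mul, inv_mul_cancel₀ hc, C_1, map_one, one_mul]
  have h3 : C ((stab γ₁ γ₂).card : ℚ) * cohaMul Q γ₁ γ₂ f₁ f₂ = P := by
    apply IsFractionRing.injective (PolyQ n) (FractionRing (PolyQ n))
    rw [map_mul, h2, cohaMul, dif_pos hex, hex.choose_spec]
  rw [h3]
  exact hP

lemma vars_prod_sub {γ₁ γ₂ : Fin n → ℕ} {f₁ f₂ : PolyQ n} (hf₁ : ∀ p ∈ f₁.vars, p ∈ Hset γ₁) (hf₂ : f₂ ∈ Hspace γ₂) :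
    ∀ p ∈ (f₁ * rename (shf γ₁) f₂).vars, p ∈ Hset (γ₁ + γ₂) := by
  intro p hp
  rcases Finset.mem_union.mp (vars_mul _ _ hp) with h | h
  · exact Hset_le (hf₁ p h)
  · have := vars_rename _ _ h
    rw [Finset.mem_image] at this
    obtain ⟨q, hq, rfl⟩ := this
    have := hf₂.1 q hq
    rw [mem_Hset]
    simp only [shf, Pi.add_apply]
    omega

lemma cohaMul_mem (Q : FinQuiver n) {γ₁ γ₂ : Fin n → ℕ} {f₁ f₂ : PolyQ n} (hf₁ : f₁ ∈ Hspace γ₁) (hf₂ : f₂ ∈ Hspace γ₂) :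
    cohaMul Q γ₁ γ₂ f₁ f₂ ∈ Hspace (γ₁ + γ₂) := by
  have h := SumRep_mem (by
    intro p hp
    rw [Finset.mem_product, Finset.mem_sdiff] at hp
    exact Finset.mem_product.mpr ⟨Hset_le hp.1, hp.2.1⟩)
    (vars_prod_sub (fun p hp => mem_Hset.mpr (hf₁.1 p hp)) hf₂) (link2 Q hf₁ hf₂)
  have hc : ((stab γ₁ γ₂).card : ℚ) ≠ 0 := by exact_mod_cast (stab_pos γ₁ γ₂).ne'
  have h2 := (Hspace (γ₁ + γ₂)).smul_mem ((stab γ₁ γ₂).card : ℚ)⁻¹ h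
  rw [← smul_eq_C_mul, smul_smul, inv_mul_cancel₀ hc, one_smul] at h2
  exact h2

end D1

section D2

def off (γ : ℕ → Fin n → ℕ) (k : ℕ) : Fin n → ℕ := fun i => ∑ u ∈ Finset.range k, γ u i

lemma off_zero (γ : ℕ → Fin n → ℕ) : off γ 0 = 0 := by funext i; simp [off]

lemma off_succ (γ : ℕ → Fin n → ℕ) (k : ℕ) : off γ (k + 1) = off γ k + γ k := by
  funext i; simp [off, Finset.sum_range_succ]

lemma off_mono (γ : ℕ → Fin n → ℕ) {a b : ℕ} (h : a ≤ b) (i : Fin n) : off γ a i ≤ off γ b i :=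
  Finset.sum_le_sum_of_subset (Finset.range_mono h)

noncomputable def lab (γ : ℕ → Fin n → ℕ) (e : Fin n × ℕ) : ℕ :=
  if h : ∃ u, e.2 < off γ (u + 1) e.1 then Nat.find h else 0

lemma lab_facts {γ : ℕ → Fin n → ℕ} {e : Fin n × ℕ} {k : ℕ} (he : e ∈ Hset (off γ (k + 1))) :
    lab γ e ≤ k ∧ off γ (lab γ e) e.1 ≤ e.2 ∧ e.2 < off γ (lab γ e + 1) e.1 := by
  rw [mem_Hset] at he
  have hex : ∃ u, e.2 < off γ (u + 1) e.1 := ⟨k, he⟩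
  rw [lab, dif_pos hex]
  refine ⟨Nat.find_min' hex he, ?_, Nat.find_spec hex⟩
  rcases Nat.eq_zero_or_pos (Nat.find hex) with h | h
  · rw [h, off_zero]; simp
  · by_contra h2
    have := Nat.find_min hex (m := Nat.find hex - 1) (by omega)
    rw [Nat.sub_add_cancel h] at this
    omega

lemma lab_eq {γ : ℕ → Fin n → ℕ} {e : Fin n × ℕ} {u : ℕ} (h1 : off γ u e.1 ≤ e.2) (h2 : e.2 < off γ (u + 1) e.1) :
    lab γ e = u := by
  obtain ⟨a, b, c⟩ := lab_facts (mem_Hset.mpr h2)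
  by_contra h
  have h3 := off_mono γ (show lab γ e + 1 ≤ u by omega) e.1
  omega

noncomputable def RR (Q : FinQuiver n) (γ : ℕ → Fin n → ℕ) (f : ℕ → PolyQ n) : ℕ → PolyQ n
  | 0 => f 0
  | k + 1 => cohaMul Q (off γ (k + 1)) (γ (k + 1)) (RR Q γ f k) (f (k + 1))

lemma cohaProd_append (Q : FinQuiver n) (l : List ((Fin n → ℕ) × PolyQ n)) (hl : l ≠ []) (y : (Fin n → ℕ) × PolyQ n) :
    cohaProd Q (l ++ [y]) = ((cohaProd Q l).1 + y.1, cohaMul Q (cohaProd Q l).1 y.1 (cohaProd Q l).2 y.2) := by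
  cases l with
  | nil => exact absurd rfl hl
  | cons a l => simp [cohaProd, List.foldl_append]

lemma cohaProd_range (Q : FinQuiver n) (γ : ℕ → Fin n → ℕ) (f : ℕ → PolyQ n) (k : ℕ) :
    cohaProd Q ((List.range (k + 1)).map fun u => (γ u, f u)) = (off γ (k + 1), RR Q γ f k) := by
  induction k with
  | zero =>
    rw [off_succ, off_zero, zero_add]
    simp [cohaProd, RR]
  | succ k ih =>
    rw [List.range_succ, List.map_append, List.map_singleton, cohaProd_append _ _ (by simp), ih, off_succ γ (k + 1)]
    rfl

lemma Kk_prod_perm (Q : FinQuiver n) (A B : Finset (Fin n × ℕ)) {v : Equiv.Perm (Fin n × ℕ)} (hv : v ∈ W Prod.fst A)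
    (hAB : Disjoint A B) {L : Type} [Field L] (z : Fin n × ℕ → L) :
    Kk Q Prod.fst (A ×ˢ B) (z ∘ v) = Kk Q Prod.fst (A ×ˢ B) z := by
  have hv' := mem_W.mp hv
  have hvi := mem_W.mp (W_inv hv)
  have hB : ∀ e ∈ B, e ∉ A := fun e he h => Finset.disjoint_left.mp hAB h he
  refine Finset.prod_nbij' (fun p => (v p.1, p.2)) (fun p => (v⁻¹ p.1, p.2)) ?_ ?_ ?_ ?_ ?_
  · intro p hp
    rw [Finset.mem_product] at hp ⊢
    exact ⟨(W_apply_mem hv).mpr hp.1, hp.2⟩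
  · intro p hp
    rw [Finset.mem_product] at hp ⊢
    exact ⟨(W_apply_mem (W_inv hv)).mpr hp.1, hp.2⟩
  · intro p _; simp
  · intro p _; simp
  · intro p hp
    rw [Finset.mem_product] at hp
    simp only [Function.comp, hv'.2, hv'.1 _ (hB _ hp.2)]

theorem iterate (Q : FinQuiver n) (γ : ℕ → Fin n → ℕ) (k : ℕ) :
    ∃ c : ℚ, c ≠ 0 ∧ ∀ f : ℕ → PolyQ n, (∀ u, f u ∈ Hspace (γ u)) →
      RR Q γ f k ∈ Hspace (off γ (k + 1)) ∧
      SumRep Q Prod.fst (Hset (off γ (k + 1))) (Pr (lab γ) (Hset (off γ (k + 1))))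
        (∏ u ∈ Finset.range (k + 1), rename (shf (off γ u)) (f u)) (C c * RR Q γ f k) := by
  induction k with
  | zero =>
    have h0 : off γ (0 + 1) = γ 0 := by rw [off_succ, off_zero, zero_add]
    refine ⟨(W Prod.fst (Hset (off γ (0 + 1)))).card, by exact_mod_cast (W_card_pos _ _).ne', ?_⟩
    intro f hf
    have hf0 : f 0 ∈ Hspace (off γ (0 + 1)) := by rw [h0]; exact hf 0
    refine ⟨hf0, ?_⟩
    intro L _ _ z hz
    have hPr : Pr (lab γ) (Hset (off γ (0 + 1))) = ∅ := by
      rw [Finset.eq_empty_iff_forall_notMem]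
      intro p hp
      rw [mem_Pr] at hp
      have h1 := (lab_facts hp.1.1).1
      have h2 := (lab_facts hp.1.2).1
      omega
    have hsh : shf (off γ 0) = id := by
      rw [off_zero]; funext e; simp [shf]
    rw [hPr, Finset.sum_congr rfl (g := fun _ => aeval z (f 0))]
    · rw [Finset.sum_const, nsmul_eq_mul, map_mul, RR]
      congr 1
      simp
    · intro w hw
      rw [zero_add, Finset.prod_range_one, hsh, rename_id_apply, ← aeval_rename, symm_W hf0 hw]
      simp [Kk]
  | succ k ih =>
    obtain ⟨c, hc, ih⟩ := ih
    set γ₁ := off γ (k + 1) with hγ₁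
    set γ₂ := γ (k + 1) with hγ₂
    have hoff : off γ (k + 1 + 1) = γ₁ + γ₂ := off_succ γ (k + 1)
    rw [hoff]
    set H₁ := Hset γ₁ with hH₁
    set H := Hset (γ₁ + γ₂) with hH
    have hW1 : ((W Prod.fst H₁).card : ℚ) ≠ 0 := by exact_mod_cast (W_card_pos _ _).ne'
    have hst : ((stab γ₁ γ₂).card : ℚ) ≠ 0 := by exact_mod_cast (stab_pos γ₁ γ₂).ne'
    refine ⟨c * (stab γ₁ γ₂).card / (W Prod.fst H₁).card, div_ne_zero (mul_ne_zero hc hst) hW1, ?_⟩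
    intro f hf
    obtain ⟨hR, hS⟩ := ih f hf
    have hlink := link2 Q hR (hf (k + 1))
    refine ⟨cohaMul_mem Q hR (hf (k + 1)), ?_⟩
    intro L _ _ z hz
    haveI : CharZero L := algebraRat.charZero L
    have hsub : H₁ ⊆ H := Hset_le
    have hlab1 : ∀ e ∈ H₁, lab γ e ≤ k := fun e he => (lab_facts he).1
    have hlab2 : ∀ e ∈ H \ H₁, lab γ e = k + 1 := by
      intro e he
      rw [Finset.mem_sdiff] at he
      apply lab_eq
      · have := he.2
        rw [hH₁, mem_Hset] at this
        exact not_lt.mp this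
      · have := he.1
        rw [hH, mem_Hset] at this
        rw [hoff]; exact this
    have hPr : Pr (lab γ) H = Pr (lab γ) H₁ ∪ H₁ ×ˢ (H \ H₁) := by
      ext p
      rw [Finset.mem_union, mem_Pr, mem_Pr, Finset.mem_product]
      constructor
      · rintro ⟨⟨h1, h2⟩, h3⟩
        by_cases a : p.1 ∈ H₁
        · by_cases b : p.2 ∈ H₁
          · exact Or.inl ⟨⟨a, b⟩, h3⟩
          · exact Or.inr ⟨a, Finset.mem_sdiff.mpr ⟨h2, b⟩⟩
        · have e1 := hlab2 p.1 (Finset.mem_sdiff.mpr ⟨h1, a⟩)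
          by_cases b : p.2 ∈ H₁
          · have := hlab1 _ b; omega
          · have := hlab2 p.2 (Finset.mem_sdiff.mpr ⟨h2, b⟩); omega
      · rintro (⟨⟨h1, h2⟩, h3⟩ | ⟨h1, h2⟩)
        · exact ⟨⟨hsub h1, hsub h2⟩, h3⟩
        · refine ⟨⟨hsub h1, (Finset.mem_sdiff.mp h2).1⟩, ?_⟩
          have := hlab1 _ h1
          have := hlab2 _ h2
          omega
    have hdis : Disjoint (Pr (lab γ) H₁) (H₁ ×ˢ (H \ H₁)) := by
      rw [Finset.disjoint_left]
      intro p hp hp'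
      rw [mem_Pr] at hp
      rw [Finset.mem_product, Finset.mem_sdiff] at hp'
      exact hp'.2.2 hp.1.2
    set N1 := ∏ u ∈ Finset.range (k + 1), rename (shf (off γ u)) (f u) with hN1
    set N2 := rename (shf γ₁) (f (k + 1)) with hN2
    let F : Equiv.Perm (Fin n × ℕ) → L := fun x => aeval (z ∘ x) (N1 * N2) * Kk Q Prod.fst (Pr (lab γ) H) (z ∘ x)
    have hKk : ∀ x : Equiv.Perm (Fin n × ℕ), Kk Q Prod.fst (Pr (lab γ) H) (z ∘ x) =
        Kk Q Prod.fst (Pr (lab γ) H₁) (z ∘ x) * Kk Q Prod.fst (H₁ ×ˢ (H \ H₁)) (z ∘ x) := by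
      intro x
      rw [hPr]
      exact Finset.prod_union hdis
    have hN2v : ∀ p ∈ N2.vars, p ∉ H₁ := by
      intro p hp
      have := vars_rename _ _ hp
      rw [Finset.mem_image] at this
      obtain ⟨q, _, rfl⟩ := this
      rw [hH₁, mem_Hset]
      simp only [shf]
      omega
    have key : algebraMap ℚ L c * (algebraMap ℚ L (stab γ₁ γ₂).card * aeval z (cohaMul Q γ₁ γ₂ (RR Q γ f k) (f (k + 1)))) =
        algebraMap ℚ L (W Prod.fst H₁).card * ∑ w ∈ W Prod.fst H, F w := by
      have h1 := hlink L z hz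
      rw [map_mul, aeval_C] at h1
      rw [h1, Finset.mul_sum]
      have h2 : ∀ w ∈ W Prod.fst H, algebraMap ℚ L c * (aeval (z ∘ w) (RR Q γ f k * N2) *
          Kk Q Prod.fst (H₁ ×ˢ (H \ H₁)) (z ∘ w)) = ∑ v ∈ W Prod.fst H₁, F (w * v) := by
        intro w hw
        have h3 := hS L (z ∘ w) (by
          intro e he e' he' h
          exact (hz.comp hw) e (hsub he) e' (hsub he') h)
        rw [map_mul, aeval_C] at h3
        calc _ = (algebraMap ℚ L c * aeval (z ∘ w) (RR Q γ f k)) * (aeval (z ∘ w) N2 *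
          Kk Q Prod.fst (H₁ ×ˢ (H \ H₁)) (z ∘ w)) := by rw [map_mul]; ring
          _ = _ := by
            rw [h3, Finset.sum_mul]
            refine Finset.sum_congr rfl fun v hv => ?_
            have e1 : aeval (z ∘ w) N2 = aeval (z ∘ (w * v : Equiv.Perm (Fin n × ℕ))) N2 := by
              apply aeval_congr_vars
              intro p hp
              simp only [Function.comp, Equiv.Perm.mul_apply, (mem_W.mp hv).1 p (hN2v p hp)]
            have e2 := Kk_prod_perm Q H₁ (H \ H₁) hv Finset.disjoint_sdiff (z ∘ w)
            simp only [F]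
            rw [hKk, map_mul, ← e1, ← e2]
            have e3 : (z ∘ w) ∘ v = z ∘ (w * v : Equiv.Perm (Fin n × ℕ)) := rfl
            rw [e3]
            ring
      rw [Finset.sum_congr rfl h2, Finset.sum_comm, Finset.sum_congr rfl (g := fun _ => ∑ w ∈ W Prod.fst H, F w)]
      · rw [Finset.sum_const, nsmul_eq_mul]
        simp
      · intro v hv
        exact W_sum_right (W_mono Prod.fst hsub hv) F
    have hW1' : algebraMap ℚ L (W Prod.fst H₁).card ≠ 0 := by
      rw [map_natCast]; exact_mod_cast (W_card_pos _ _).ne'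
    rw [map_mul, aeval_C, map_div₀, map_mul, RR, Finset.prod_range_succ]
    have : ∑ w ∈ W Prod.fst H, aeval (z ∘ w) (N1 * N2) * Kk Q Prod.fst (Pr (lab γ) H) (z ∘ w) = ∑ w ∈ W Prod.fst H, F w := rfl
    rw [this, div_mul_eq_mul_div, div_eq_iff hW1', mul_assoc, key, mul_comm]

end D2

section D3
variable {r : ℕ}

/-- extension by zero of the dimension vectors -/
def gam (m : Fin r → ℕ) (β : Fin r → Fin n → ℕ) : ℕ → Fin n → ℕ :=
  fun u v => if h : u < r then m ⟨u, h⟩ * β ⟨u, h⟩ v else 0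

lemma gam_fin (m : Fin r → ℕ) (β : Fin r → Fin n → ℕ) (u : Fin r) (v : Fin n) : gam m β u v = m u * β u v := by
  simp [gam]

lemma off_gam (m : Fin r → ℕ) (β : Fin r → Fin n → ℕ) :
    off (gam m β) r = fun v => ∑ u, m u * β u v := by
  funext v
  rw [off, Finset.sum_range]
  exact Finset.sum_congr rfl fun u _ => gam_fin m β u v

lemma ofFn_range {α : Type} (g : ℕ → α) (f : Fin r → α) (h : ∀ u : Fin r, f u = g u) :
    List.ofFn f = (List.range r).map g := by
  apply List.ext_getElem
  · simp
  · intro i h1 h2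
    simp [h]

theorem prodRep (Q : FinQuiver n) (β : Fin r → Fin n → ℕ) (m : Fin r → ℕ) :
    ∃ c : ℚ, c ≠ 0 ∧ ∀ f : Fin r → PolyQ n, (∀ u, f u ∈ Hspace (fun v => m u * β u v)) →
      cohaProdFin Q (fun u v => m u * β u v) f ∈ Hspace (off (gam m β) r) ∧
      SumRep Q Prod.fst (Hset (off (gam m β) r)) (Pr (lab (gam m β)) (Hset (off (gam m β) r)))
        (∏ u : Fin r, rename (shf (off (gam m β) u)) (f u)) (C c * cohaProdFin Q (fun u v => m u * β u v) f) := by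
  rcases r with _ | k
  · have h0 : Hset (off (gam m β) 0) = ∅ := by
      rw [Finset.eq_empty_iff_forall_notMem]
      intro e he
      rw [mem_Hset, off_zero] at he
      simp at he
    refine ⟨(W Prod.fst (Hset (off (gam m β) 0))).card, by exact_mod_cast (W_card_pos _ _).ne', ?_⟩
    intro f hf
    have h1 : cohaProdFin Q (fun u v => m u * β u v) f = 1 := by simp [cohaProdFin, cohaProd]
    rw [h1]
    constructor
    · refine ⟨fun p hp => ?_, fun i σ _ => map_one _⟩
      simp at hp
    · intro L _ _ z hz
      have h2 : Pr (lab (gam m β)) (Hset (off (gam m β) 0)) = ∅ := by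
        rw [h0]; rfl
      rw [h2]
      simp [Kk]
  · obtain ⟨c, hc, h⟩ := iterate Q (gam m β) k
    refine ⟨c, hc, fun f hf => ?_⟩
    let f' : ℕ → PolyQ n := fun u => if h : u < k + 1 then f ⟨u, h⟩ else 0
    have hff : ∀ u : Fin (k + 1), f' u = f u := by
      intro u; simp only [f', dif_pos u.2]
    have hg : ∀ u : Fin (k + 1), gam m β u = fun v => m u * β u v := by
      intro u; funext v; exact gam_fin m β u v
    obtain ⟨h1, h2⟩ := h f' (by
      intro u
      by_cases hu : u < k + 1
      · have a := hff ⟨u, hu⟩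
        have b := hg ⟨u, hu⟩
        simp only at a b
        rw [a, b]
        exact hf _
      · simp only [f', dif_neg hu]
        exact Submodule.zero_mem _)
    have h3 : cohaProdFin Q (fun u v => m u * β u v) f = RR Q (gam m β) f' k := by
      rw [cohaProdFin, ofFn_range (fun u => (gam m β u, f' u)), cohaProd_range]
      intro u
      rw [hff, hg]
    have h4 : ∏ u : Fin (k + 1), rename (shf (off (gam m β) u)) (f u) =
        ∏ u ∈ Finset.range (k + 1), rename (shf (off (gam m β) u)) (f' u) := by
      rw [Finset.prod_range]
      refine Finset.prod_congr rfl fun u _ => ?_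
      rw [hff]
    rw [h3, h4]
    exact ⟨h1, h2⟩

/-- matching two labelings with equal dimension vectors -/
lemma exists_match {E : Type} [DecidableEq E] (vert : E → Fin n) (H : Finset E) (a b : E → ℕ)
    (h : ∀ e ∈ H, dimv vert (H.filter fun e' => a e' = a e) = dimv vert (H.filter fun e' => b e' = a e)) :
    ∃ w ∈ W vert H, ∀ e ∈ H, a e = b (w e) := by
  let A : E → Finset E := fun e => H.filter fun e' => a e' = a e ∧ vert e' = vert e
  have hex : ∀ i : Fin n, ∀ u : ℕ, (H.filter fun e' => a e' = u ∧ vert e' = i).card =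
      (H.filter fun e' => b e' = u ∧ vert e' = i).card →
      ∃ g : E → E, (∀ e ∈ H, a e = u → vert e = i → g e ∈ H ∧ b (g e) = u ∧ vert (g e) = i) ∧
        ∀ e ∈ H, ∀ e' ∈ H, a e = u → vert e = i → a e' = u → vert e' = i → g e = g e' → e = e' := by
    intro i u hc
    let φ := Finset.equivOfCardEq hc
    have hm : ∀ e ∈ H, a e = u → vert e = i → e ∈ (H.filter fun e' => a e' = u ∧ vert e' = i) :=
      fun e h1 h2 h3 => Finset.mem_filter.mpr ⟨h1, h2, h3⟩
    refine ⟨fun e => if h : e ∈ (H.filter fun e' => a e' = u ∧ vert e' = i) then (φ ⟨e, h⟩).1 else e, ?_, ?_⟩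
    · intro e h1 h2 h3
      simp only [dif_pos (hm e h1 h2 h3)]
      exact Finset.mem_filter.mp (φ ⟨e, hm e h1 h2 h3⟩).2
    · intro e h1 e' h1' h2 h3 h2' h3' he
      simp only [dif_pos (hm e h1 h2 h3), dif_pos (hm e' h1' h2' h3')] at he
      exact congrArg Subtype.val (φ.injective (Subtype.ext he))
  have hcard : ∀ e ∈ H, (H.filter fun e' => a e' = a e ∧ vert e' = vert e).card =
      (H.filter fun e' => b e' = a e ∧ vert e' = vert e).card := by
    intro e he
    have := congrFun (h e he) (vert e)
    simp only [dimv, Finset.filter_filter] at this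
    exact this
  haveI : Nonempty (E → E) := ⟨id⟩
  choose! g hg1 hg2 using hex
  obtain ⟨w, hw, hwy⟩ := mkW vert H (fun e => g (vert e) (a e) e)
    (fun e he => (hg1 _ _ (hcard e he) e he rfl rfl).2.2)
    (fun e he => (hg1 _ _ (hcard e he) e he rfl rfl).1) (by
      intro e he e' he' heq
      have h1 := hg1 _ _ (hcard e he) e he rfl rfl
      have h2 := hg1 _ _ (hcard e' he') e' he' rfl rfl
      rw [heq] at h1
      have h3 : a e' = a e := h2.2.1.symm.trans h1.2.1
      have h4 : vert e' = vert e := h2.2.2.symm.trans h1.2.2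
      rw [h3, h4] at heq
      exact hg2 _ _ (hcard e he) e he e' he' rfl rfl h3 h4 heq)
  refine ⟨w, hw, fun e he => ?_⟩
  rw [hwy e he]
  exact (hg1 _ _ (hcard e he) e he rfl rfl).2.1.symm

lemma dimv_lab (γ : ℕ → Fin n → ℕ) (u : ℕ) {k : ℕ} (hu : u < k) :
    dimv Prod.fst ((Hset (off γ k)).filter fun e => lab γ e = u) = γ u := by
  funext i
  have h0 : γ u i = (Finset.Ico (off γ u i) (off γ (u + 1) i)).card := by
    rw [Nat.card_Ico, off_succ, Pi.add_apply]; omega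
  rw [h0, dimv]
  refine Finset.card_nbij' (fun e => e.2) (fun j => (i, j)) ?_ ?_ ?_ ?_
  · intro e he
    simp only [Finset.coe_filter, Finset.mem_filter, Set.mem_setOf_eq] at he
    obtain ⟨⟨h1, h2⟩, h3⟩ := he
    obtain ⟨k', rfl⟩ : ∃ k', k = k' + 1 := ⟨k - 1, by omega⟩
    have := (lab_facts h1).2
    rw [h2, h3] at this
    exact Finset.mem_coe.mpr (Finset.mem_Ico.mpr this)
  · intro j hj
    have hj := Finset.mem_Ico.mp (Finset.mem_coe.mp hj)
    simp only [Finset.coe_filter, Finset.mem_filter, Set.mem_setOf_eq, mem_Hset]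
    refine ⟨⟨?_, lab_eq hj.1 hj.2⟩, trivial⟩
    have := off_mono γ (show u + 1 ≤ k by omega) i
    omega
  · intro e he
    simp only [Finset.coe_filter, Finset.mem_filter, Set.mem_setOf_eq] at he
    exact Prod.ext he.2.symm rfl
  · intro j _; rfl

end D3

section D4
variable {r : ℕ}

lemma good_N {β : Fin r → Fin n → ℕ} {iv : Fin r → Fin n} (hiv : ∀ u, β u (iv u) = 1) (m : Fin r → ℕ)
    (grp : Fin n × ℕ → Fin r × ℕ)
    (hg : ∀ e ∈ Hset (off (gam m β) r), (grp e).2 < m (grp e).1)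
    (hgm : ∀ u k, k < m u → dimv Prod.fst ((Hset (off (gam m β) r)).filter fun e => grp e = (u, k)) = β u)
    {w : Equiv.Perm (Fin n × ℕ)} (hw : w ∈ W Prod.fst (Hset (off (gam m β) r)))
    (hgood : ∀ e ∈ Hset (off (gam m β) r), lab (gam m β) e = (grp (w e)).1)
    {L : Type} [Field L] [Algebra ℚ L] (x : Fin r × ℕ → L) (u : Fin r) (f : PolyQ n)
    (hf : f ∈ Aspace (β u) (iv u) (m u)) :
    aeval (x ∘ grp ∘ w) (rename (shf (off (gam m β) u)) f) = aeval (fun e => x (u, e.2)) f := by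
  set H := Hset (off (gam m β) r) with hH
  set γ := gam m β with hγ
  set ρ := shf (off γ u) with hρ
  set G := Hset (fun v => m u * β u v) with hG
  have hρH : ∀ e ∈ G, ρ e ∈ H ∧ lab γ (ρ e) = u := by
    intro e he
    rw [hG, mem_Hset] at he
    have h1 : off γ (u + 1) e.1 = off γ u e.1 + m u * β u e.1 := by
      rw [off_succ, Pi.add_apply, hγ, gam_fin]
    have h2 := off_mono γ (show (u : ℕ) + 1 ≤ r from u.2) e.1
    constructor
    · rw [hH, mem_Hset]
      simp only [hρ, shf]
      omega
    · apply lab_eq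
      · simp [hρ, shf]
      · simp only [hρ, shf]
        omega
  have hgr : ∀ e ∈ G, (grp (w (ρ e))).1 = u ∧ (grp (w (ρ e))).2 < m u := by
    intro e he
    obtain ⟨h1, h2⟩ := hρH e he
    have h3 : (grp (w (ρ e))).1 = u := by
      apply Fin.ext
      rw [← hgood _ h1, h2]
    refine ⟨h3, ?_⟩
    have := hg _ ((W_apply_mem hw).mpr h1)
    rwa [h3] at this
  let y : Fin n × ℕ → Fin n × ℕ := fun e => if e.1 = iv u then (e.1, (grp (w (ρ e))).2) else e
  obtain ⟨v, hv, hvy⟩ := mkW Prod.fst G y (by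
    intro e _; simp only [y]; split_ifs <;> rfl) (by
    intro e he
    by_cases h : e.1 = iv u
    · simp only [y, if_pos h]
      rw [hG, mem_Hset]
      simp only
      rw [h, hiv, mul_one]
      exact (hgr e he).2
    · simp only [y, if_neg h]; exact he) (by
    intro e he e' he' h
    have hfst : e.1 = e'.1 := by
      have a : ∀ e, (y e).1 = e.1 := by intro e; simp only [y]; split_ifs <;> rfl
      rw [← a e, h, a]
    by_cases hc : e.1 = iv u
    · have hc' : e'.1 = iv u := hfst ▸ hc
      simp only [y, if_pos hc, if_pos hc', Prod.mk.injEq] at h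
      have h1 := hgr e he
      have h2 := hgr e' he'
      have hcard := congrFun (hgm u _ h1.2) (iv u)
      rw [hiv, dimv, Finset.card_eq_one] at hcard
      obtain ⟨a, ha⟩ := hcard
      have k1 : w (ρ e) = a := by
        rw [← Finset.mem_singleton, ← ha]
        simp only [Finset.mem_filter]
        refine ⟨⟨(W_apply_mem hw).mpr (hρH e he).1, Prod.ext h1.1 rfl⟩, ?_⟩
        rw [(mem_W.mp hw).2]; exact hc
      have k2 : w (ρ e') = a := by
        rw [← Finset.mem_singleton, ← ha]
        simp only [Finset.mem_filter]
        refine ⟨⟨(W_apply_mem hw).mpr (hρH e' he').1, Prod.ext h2.1 h.2.symm⟩, ?_⟩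
        rw [(mem_W.mp hw).2]; exact hc'
      have k3 := w.injective (k1.trans k2.symm)
      simp only [hρ, shf, Prod.mk.injEq] at k3
      refine Prod.ext hfst ?_
      have := k3.2
      rw [hfst] at this
      omega
    · have hc' : ¬ e'.1 = iv u := hfst ▸ hc
      simpa only [y, if_neg hc, if_neg hc'] using h)
  have hsym := symm_W hf.1 hv
  conv_rhs => rw [← hsym]
  rw [aeval_rename, aeval_rename]
  apply aeval_congr_vars
  intro e he
  have heG : e ∈ G := mem_Hset.mpr (hf.1.1 e he)
  have hei : e.1 = iv u := hf.2 e he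
  simp only [Function.comp, hvy e heG, y, if_pos hei]
  congr 1
  exact Prod.ext (hgr e heG).1 rfl

theorem eval_main {Q : FinQuiver n} {β : Fin r → Fin n → ℕ} (RD : RData Q β) {iv : Fin r → Fin n}
    (hiv : ∀ u, β u (iv u) = 1) (m₀ : Fin r → ℕ) :
    ∃ z : Fin n × ℕ → FractionRing (MvPolynomial (Fin r × ℕ) ℚ),
      (∀ m : Fin r → ℕ, m ≠ m₀ → (∀ v, (∀ w, w < v → m w = m₀ w) → m₀ v ≤ m v) →
        off (gam m β) r = off (gam m₀ β) r →
        ∀ f : Fin r → PolyQ n, (∀ u, f u ∈ Hspace (fun v => m u * β u v)) →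
          aeval z (cohaProdFin Q (fun u v => m u * β u v) f) = 0) ∧
      ∃ d : FractionRing (MvPolynomial (Fin r × ℕ) ℚ), d ≠ 0 ∧
        ∀ f : Fin r → PolyQ n, (∀ u, f u ∈ Aspace (β u) (iv u) (m₀ u)) →
          aeval z (cohaProdFin Q (fun u v => m₀ u * β u v) f) = d * ∏ u, aeval (fun e => ux (u, e.2)) (f u) := by
  rcases Nat.eq_zero_or_pos r with hr | hr
  · subst hr
    refine ⟨fun _ => 0, fun m hm => absurd (Subsingleton.elim _ _) hm, 1, one_ne_zero, fun f _ => ?_⟩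
    simp [cohaProdFin, cohaProd]
  set H := Hset (off (gam m₀ β) r) with hH
  have hdimH : ∀ i, dimv Prod.fst H i = ∑ u, m₀ u * β u i := by
    intro i
    have h1 : ∑ u, m₀ u * β u i = off (gam m₀ β) r i := (congrFun (off_gam m₀ β) i).symm
    rw [h1, dimv, ← Finset.card_range (off (gam m₀ β) r i)]
    refine Finset.card_nbij' (fun e => e.2) (fun j => (i, j)) ?_ ?_ ?_ ?_
    · intro e he
      have he := Finset.mem_filter.mp (Finset.mem_coe.mp he)
      refine Finset.mem_coe.mpr (Finset.mem_range.mpr ?_)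
      rw [← he.2]; exact mem_Hset.mp he.1
    · intro j hj
      have hj := Finset.mem_range.mp (Finset.mem_coe.mp hj)
      exact Finset.mem_coe.mpr (Finset.mem_filter.mpr ⟨mem_Hset.mpr hj, rfl⟩)
    · intro e he
      have he := Finset.mem_filter.mp (Finset.mem_coe.mp he)
      exact Prod.ext he.2.symm rfl
    · intro j _; rfl
  obtain ⟨grp, hg, hgm⟩ := exists_grp (β := β) Prod.fst ⟨0, hr⟩ H m₀ hdimH
  have hdg := dimv_grp Prod.fst H m₀ grp hg hgm
  have hlabr : ∀ m : Fin r → ℕ, off (gam m β) r = off (gam m₀ β) r → ∀ e ∈ H, lab (gam m β) e < r := by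
    intro m hm e he
    rw [hH, ← hm] at he
    obtain ⟨k, rfl⟩ : ∃ k, r = k + 1 := ⟨r - 1, by omega⟩
    have := (lab_facts he).1
    omega
  have hlabd : ∀ m : Fin r → ℕ, off (gam m β) r = off (gam m₀ β) r → ∀ u : Fin r, ∀ i,
      dimv Prod.fst (H.filter fun e => lab (gam m β) e = u) i = m u * β u i := by
    intro m hm u i
    rw [hH, ← hm, dimv_lab _ _ u.2, gam_fin]
  have hz : ∀ m : Fin r → ℕ, (∀ v, (∀ w, w < v → m w = m₀ w) → m₀ v ≤ m v) →
      ∀ hm : off (gam m β) r = off (gam m₀ β) r, ∀ N P, SumRep Q Prod.fst H (Pr (lab (gam m β)) H) N P →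
      aeval (ux ∘ grp) P = ∑ w ∈ (W Prod.fst H).filter (fun w => ∀ e ∈ H, lab (gam m β) e = (grp (w e)).1),
      aeval (ux ∘ grp ∘ w) N * Kk Q Prod.fst (Pr (lab (gam m β)) H) (ux ∘ grp ∘ w : Fin n × ℕ → FractionRing (MvPolynomial (Fin r × ℕ) ℚ)) := by
    intro m hlex hm N P hP
    exact evalL Prod.fst RD H.card (VH_all Prod.fst RD H.card) H le_rfl (lab (gam m β)) grp m m₀
      (hlabr m hm) (hlabd m hm) hg hgm hlex N P hP _ ux ux_inj
  refine ⟨ux ∘ grp, ?_, ?_⟩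
  · intro m hne hlex hm f hf
    obtain ⟨c, hc, h⟩ := prodRep Q β m
    obtain ⟨_, hS⟩ := h f hf
    rw [hm] at hS
    have h1 := hz m hlex hm _ _ hS
    rw [Finset.sum_eq_zero] at h1
    · rw [map_mul, aeval_C, mul_eq_zero] at h1
      refine h1.resolve_left ?_
      rw [map_eq_zero]; exact hc
    · intro w hw
      exfalso
      obtain ⟨hw1, hw2⟩ := Finset.mem_filter.mp hw
      apply hne
      funext u
      have a := hlabd m hm u (iv u)
      have b := hdg u (iv u)
      rw [← dimv_perm Prod.fst _ H hw1 u, Finset.filter_congr (q := fun e => ((grp e).1 : ℕ) = u), b, hiv, mul_one, mul_one] at a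
      · exact a.symm
      · intro e he
        rw [hw2 _ ((W_apply_mem (W_inv hw1)).mpr he), perm_ai]
  · obtain ⟨c, hc, h⟩ := prodRep Q β m₀
    set Good := (W Prod.fst H).filter (fun w => ∀ e ∈ H, lab (gam m₀ β) e = (grp (w e)).1) with hGood
    set K : FractionRing (MvPolynomial (Fin r × ℕ) ℚ) := Kk Q Prod.fst (Pr (fun e => ((grp e).1 : ℕ)) H) (ux ∘ grp) with hK
    have hK0 : K ≠ 0 := by
      apply Kk_ne_zero
      intro p hp h
      rw [mem_Pr] at hp
      have := ux_inj h
      rw [this] at hp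
      exact lt_irrefl _ hp.2
    have hGc : ((Good.card : ℕ) : FractionRing (MvPolynomial (Fin r × ℕ) ℚ)) ≠ 0 := by
      haveI : CharZero (FractionRing (MvPolynomial (Fin r × ℕ) ℚ)) := algebraRat.charZero _
      rw [Nat.cast_ne_zero]
      obtain ⟨w, hw, hw2⟩ := exists_match Prod.fst H (lab (gam m₀ β)) (fun e => ((grp e).1 : ℕ)) (by
        intro e he
        have hlt := hlabr m₀ rfl e he
        funext i
        exact (hlabd m₀ rfl ⟨_, hlt⟩ i).trans (hdg ⟨_, hlt⟩ i).symm)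
      exact Finset.card_ne_zero_of_mem (Finset.mem_filter.mpr ⟨hw, hw2⟩)
    have hc' : algebraMap ℚ (FractionRing (MvPolynomial (Fin r × ℕ) ℚ)) c ≠ 0 := by
      rw [map_ne_zero]; exact hc
    refine ⟨Good.card * K / algebraMap ℚ _ c, div_ne_zero (mul_ne_zero hGc hK0) hc', ?_⟩
    intro f hf
    obtain ⟨_, hS⟩ := h f (fun u => (hf u).1)
    have h1 := hz m₀ (fun _ _ => le_rfl) rfl _ _ hS
    rw [Finset.sum_congr rfl (g := fun _ => (∏ u, aeval (fun e => ux (u, e.2)) (f u)) * K), Finset.sum_const,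
      nsmul_eq_mul, map_mul, aeval_C] at h1
    · rw [div_mul_eq_mul_div, eq_div_iff hc', mul_comm, h1]
      ring
    · intro w hw
      obtain ⟨hw1, hw2⟩ := Finset.mem_filter.mp hw
      rw [good_Kk Prod.fst H _ grp hw1 hw2 ux, map_prod]
      congr 1
      refine Finset.prod_congr rfl fun u _ => ?_
      exact good_N hiv m₀ grp hg hgm hw1 hw2 ux u (f u) (hf u)

end D4

section D5
variable {r : ℕ}

/-- multiplication of polynomials in separate groups of variables -/
noncomputable def MB (r : ℕ) : (⨂[ℚ] _ : Fin r, MvPolynomial ℕ ℚ) →ₗ[ℚ] MvPolynomial (Fin r × ℕ) ℚ :=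
  PiTensorProduct.lift ((MultilinearMap.mkPiAlgebra ℚ (Fin r) (MvPolynomial (Fin r × ℕ) ℚ)).compLinearMap
    fun u => (rename (fun k : ℕ => (u, k)) : MvPolynomial ℕ ℚ →ₐ[ℚ] MvPolynomial (Fin r × ℕ) ℚ).toLinearMap)

lemma MB_tprod (f : Fin r → MvPolynomial ℕ ℚ) :
    MB r (PiTensorProduct.tprod ℚ f) = ∏ u, rename (fun k : ℕ => (u, k)) (f u) := by
  simp [MB]

lemma pair_inj (u : Fin r) : Function.Injective (fun k : ℕ => (u, k)) := fun _ _ h => congrArg Prod.snd h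

lemma MB_inj : Function.Injective (MB r) := by
  let Lf : MvPolynomial (Fin r × ℕ) ℚ →ₗ[ℚ] ⨂[ℚ] _ : Fin r, MvPolynomial ℕ ℚ :=
    (basisMonomials (Fin r × ℕ) ℚ).constr ℚ fun s =>
      PiTensorProduct.tprod ℚ fun u => monomial (s.comapDomain (fun k : ℕ => (u, k)) ((pair_inj u).injOn)) (1 : ℚ)
  have h : Lf ∘ₗ MB r = LinearMap.id := by
    apply PiTensorProduct.ext
    refine Module.Basis.ext_multilinear (fun _ => basisMonomials ℕ ℚ) ?_
    intro s
    simp only [LinearMap.compMultilinearMap_apply, LinearMap.comp_apply, MB_tprod, LinearMap.id_apply, coe_basisMonomials,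
      rename_monomial]
    have h1 : ∏ u : Fin r, monomial (Finsupp.mapDomain (fun k : ℕ => (u, k)) (s u)) (1 : ℚ) =
        monomial (∑ u : Fin r, Finsupp.mapDomain (fun k : ℕ => (u, k)) (s u)) (1 : ℚ) := by
      exact (monomial_sum_one _ _).symm
    rw [h1]
    have h2 := (basisMonomials (Fin r × ℕ) ℚ).constr_basis ℚ (fun s =>
      PiTensorProduct.tprod ℚ fun u => monomial (s.comapDomain (fun k : ℕ => (u, k)) ((pair_inj u).injOn)) (1 : ℚ))
      (∑ u : Fin r, Finsupp.mapDomain (fun k : ℕ => (u, k)) (s u))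
    rw [coe_basisMonomials] at h2
    rw [h2]
    congr 1
    funext u
    refine congrArg (fun t => monomial t (1 : ℚ)) ?_
    ext k
    rw [Finsupp.comapDomain_apply, Finsupp.finset_sum_apply, Finset.sum_eq_single u]
    · exact Finsupp.mapDomain_apply (pair_inj u) _ _
    · intro v _ hv
      apply Finsupp.mapDomain_notin_range
      rintro ⟨k', hk'⟩
      exact hv (congrArg Prod.fst hk')
    · simp
  intro a b hab
  have := congrArg Lf hab
  have e : ∀ t, Lf (MB r t) = t := fun t => congrArg (fun g => g t) h
  rwa [e, e] at this

lemma map_inj {M N : Fin r → Type} [∀ u, AddCommGroup (M u)] [∀ u, Module ℚ (M u)] [∀ u, AddCommGroup (N u)]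
    [∀ u, Module ℚ (N u)] (g : ∀ u, M u →ₗ[ℚ] N u) (hg : ∀ u, Function.Injective (g u)) :
    Function.Injective (PiTensorProduct.map g) := by
  have h : ∀ u, ∃ p : N u →ₗ[ℚ] M u, p ∘ₗ g u = LinearMap.id := fun u =>
    LinearMap.exists_leftInverse_of_injective (g u) (LinearMap.ker_eq_bot.mpr (hg u))
  choose p hp using h
  have h2 : PiTensorProduct.map p ∘ₗ PiTensorProduct.map g = LinearMap.id := by
    rw [← PiTensorProduct.map_comp]
    simp only [hp]
    exact PiTensorProduct.map_id
  intro a b hab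
  have := congrArg (PiTensorProduct.map p) hab
  have e : ∀ t, PiTensorProduct.map p (PiTensorProduct.map g t) = t := fun t => congrArg (fun g => g t) h2
  rwa [e, e] at this

noncomputable def snd_map (A : Submodule ℚ (PolyQ n)) : ↥A →ₗ[ℚ] MvPolynomial ℕ ℚ :=
  (rename Prod.snd : PolyQ n →ₐ[ℚ] MvPolynomial ℕ ℚ).toLinearMap ∘ₗ A.subtype

lemma snd_map_inj (b : Fin n → ℕ) (i : Fin n) (m : ℕ) : Function.Injective (snd_map (Aspace b i m)) := by
  have h : ∀ f : ↥(Aspace b i m), rename (fun k : ℕ => (i, k)) (snd_map (Aspace b i m) f) = (f : PolyQ n) := by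
    intro f
    have : snd_map (Aspace b i m) f = rename Prod.snd (f : PolyQ n) := rfl
    rw [this, rename_rename]
    conv_rhs => rw [← rename_id_apply (f : PolyQ n)]
    apply rename_congr_vars
    intro p hp
    exact Prod.ext (f.2.2 p hp).symm rfl
  intro f g hfg
  apply Subtype.ext
  rw [← h f, ← h g, hfg]

noncomputable def NN (β : Fin r → Fin n → ℕ) (iv : Fin r → Fin n) (m : Fin r → ℕ) :
    MultilinearMap ℚ (fun u : Fin r => ↥(Aspace (β u) (iv u) (m u))) (PolyQ n) :=
  (MultilinearMap.mkPiAlgebra ℚ (Fin r) (PolyQ n)).compLinearMap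
    fun u => (rename (shf (off (gam m β) u)) : PolyQ n →ₐ[ℚ] PolyQ n).toLinearMap ∘ₗ (Aspace (β u) (iv u) (m u)).subtype

/-- the product as a multilinear map -/
theorem exists_mult (Q : FinQuiver n) (β : Fin r → Fin n → ℕ) (iv : Fin r → Fin n) (m : Fin r → ℕ) :
    ∃ φ : MultilinearMap ℚ (fun u : Fin r => ↥(Aspace (β u) (iv u) (m u))) ↥(Hspace (fun v => ∑ u, m u * β u v)),
      ∀ f, (φ f : PolyQ n) = cohaProdFin Q (fun u v => m u * β u v) (fun u => (f u : PolyQ n)) := by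
  obtain ⟨c, hc, h⟩ := prodRep Q β m
  set H := Hset (off (gam m β) r) with hH
  set S := Pr (lab (gam m β)) H with hS
  let A : (∀ u : Fin r, ↥(Aspace (β u) (iv u) (m u))) → PolyQ n :=
    fun f => cohaProdFin Q (fun u v => m u * β u v) (fun u => (f u : PolyQ n))
  have hA : ∀ f, A f ∈ Hspace (fun v => ∑ u, m u * β u v) := by
    intro f
    rw [← off_gam]
    exact (h _ fun u => (f u).2.1).1
  let Lf : PolyQ n → FractionRing (PolyQ n) := fun N => ∑ w ∈ W Prod.fst H, aeval (ux ∘ w) N * Kk Q Prod.fst S (ux ∘ w)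
  have hL : ∀ f, algebraMap (PolyQ n) (FractionRing (PolyQ n)) (C c * A f) = Lf (NN β iv m f) := by
    intro f
    rw [← aeval_ux, (h _ fun u => (f u).2.1).2 _ ux (ux_injH _)]
    simp only [Lf, NN]
    rfl
  have hadd : ∀ N N', Lf (N + N') = Lf N + Lf N' := by
    intro N N'
    simp only [Lf, map_add, add_mul, Finset.sum_add_distrib]
  have hsmul : ∀ (q : ℚ) N, Lf (q • N) = algebraMap (PolyQ n) (FractionRing (PolyQ n)) (C q) * Lf N := by
    intro q N
    have hq : algebraMap (PolyQ n) (FractionRing (PolyQ n)) (C q) = algebraMap ℚ _ q := by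
      rw [← aeval_ux, aeval_C]
    simp only [Lf, hq, smul_eq_C_mul, map_mul, aeval_C, Finset.mul_sum, mul_assoc]
  have hinj := IsFractionRing.injective (PolyQ n) (FractionRing (PolyQ n))
  have hC : (C c : PolyQ n) ≠ 0 := by rw [Ne, C_eq_zero]; exact hc
  refine ⟨MultilinearMap.mk' (fun f => ⟨A f, hA f⟩) ?_ ?_, fun f => rfl⟩
  · intro f u a b
    apply Subtype.ext
    show A _ = A _ + A _
    apply mul_left_cancel₀ hC
    apply hinj
    rw [mul_add, map_add, hL, hL, hL, MultilinearMap.map_update_add, hadd]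
  · intro f u q a
    apply Subtype.ext
    show A _ = q • A _
    apply mul_left_cancel₀ hC
    apply hinj
    rw [hL, MultilinearMap.map_update_smul, hsmul, smul_eq_C_mul, mul_left_comm, map_mul, hL]

end D5

lemma eval_main' {r : ℕ} {Q : FinQuiver n} {β : Fin r → Fin n → ℕ} (RD : RData Q β) {iv : Fin r → Fin n}
    (hiv : ∀ u, β u (iv u) = 1) (m₀ : Fin r → ℕ) :
    ∃ (K : Type) (_ : Field K) (_ : Algebra ℚ K) (j : MvPolynomial (Fin r × ℕ) ℚ →ₐ[ℚ] K)
      (z : Fin n × ℕ → K), Function.Injective j ∧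
      (∀ m : Fin r → ℕ, m ≠ m₀ → (∀ v, (∀ w, w < v → m w = m₀ w) → m₀ v ≤ m v) →
        off (gam m β) r = off (gam m₀ β) r →
        ∀ f : Fin r → PolyQ n, (∀ u, f u ∈ Hspace (fun v => m u * β u v)) →
          aeval z (cohaProdFin Q (fun u v => m u * β u v) f) = 0) ∧
      ∃ d : K, d ≠ 0 ∧
        ∀ f : Fin r → PolyQ n, (∀ u, f u ∈ Aspace (β u) (iv u) (m₀ u)) →
          aeval z (cohaProdFin Q (fun u v => m₀ u * β u v) f) =
            d * ∏ u, j (rename (fun k : ℕ => (u, k)) (rename Prod.snd (f u))) := by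
  obtain ⟨z, hz1, d, hd, hz2⟩ := eval_main RD hiv m₀
  refine ⟨FractionRing (MvPolynomial (Fin r × ℕ) ℚ), inferInstance, inferInstance, aeval ux, z, ?_, hz1, d, hd, ?_⟩
  · intro a b hab
    exact eq_of_ux hab
  · intro f hf
    rw [hz2 f hf]
    congr 1
    refine Finset.prod_congr rfl fun u _ => ?_
    rw [rename_rename, aeval_rename]
    rfl

/-- Let `𝒬•` be an admissible, ordered, Dynkin subquiver partition
of the acyclic quiver `Q` and `β₁,…,β_r` a Reineke order on `Φ₊(𝒬•)` with chosen
vertices `iv u` satisfying `β_u (iv u) = 1`.  Then the `ℚ`-linear map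
`⊕_m (𝒜_{β₁,m₁} ⊗ ⋯ ⊗ 𝒜_{β_r,m_r}) → ℋ(Q)` induced on each summand by the
left-to-right CoHA product is injective. -/
theorem coha_product_map_injective {n ℓ r : ℕ} (Q : FinQuiver n) (hQ : Q.Acyclic)
    (P : SubqPartition Q ℓ) (hord : P.Ordered) (hDyn : P.Dynkin)
    (β : Fin r → Fin n → ℕ) (blk : Fin r → Fin ℓ) (hR : IsReinekeOrder P β blk)
    (iv : Fin r → Fin n) (hiv : ∀ u, β u (iv u) = 1) :
    ∃ Φ : (⨁ m : Fin r → ℕ, ⨂[ℚ] u : Fin r, ↥(Aspace (β u) (iv u) (m u)))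
        →ₗ[ℚ] ⨁ γ : Fin n → ℕ, ↥(Hspace γ),
      (∀ (m : Fin r → ℕ) (f : (u : Fin r) → ↥(Aspace (β u) (iv u) (m u))),
        ∃ hmem : cohaProdFin Q (fun u v => m u * β u v) (fun u => (f u : PolyQ n)) ∈
            Hspace (fun v => ∑ u, m u * β u v),
          Φ (DirectSum.of (fun m' : Fin r → ℕ =>
                ⨂[ℚ] u : Fin r, ↥(Aspace (β u) (iv u) (m' u))) m
              (PiTensorProduct.tprod ℚ f)) =
            DirectSum.of (fun γ : Fin n → ℕ => ↥(Hspace γ))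
              (fun v => ∑ u, m u * β u v)
              ⟨cohaProdFin Q (fun u v => m u * β u v) (fun u => (f u : PolyQ n)), hmem⟩) ∧
      Function.Injective Φ := by

  have RD : RData Q β := rdata Q hQ P hDyn β blk hR
  choose φ hφ using exists_mult Q β iv
  let Φ : (⨁ m : Fin r → ℕ, ⨂[ℚ] u : Fin r, ↥(Aspace (β u) (iv u) (m u)))
        →ₗ[ℚ] ⨁ γ : Fin n → ℕ, ↥(Hspace γ) :=
    DirectSum.toModule ℚ _ _ fun m =>
      DirectSum.lof ℚ _ (fun γ : Fin n → ℕ => ↥(Hspace γ)) (fun v => ∑ u, m u * β u v) ∘ₗ PiTensorProduct.lift (φ m)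
  have hΦ : ∀ m t, Φ (DirectSum.of (fun m' : Fin r → ℕ =>
      ⨂[ℚ] u : Fin r, ↥(Aspace (β u) (iv u) (m' u))) m t) =
      DirectSum.lof ℚ _ (fun γ : Fin n → ℕ => ↥(Hspace γ)) (fun v => ∑ u, m u * β u v)
        (PiTensorProduct.lift (φ m) t) := by
    intro m t
    rw [← DirectSum.lof_eq_of ℚ]
    simp only [Φ, DirectSum.toModule_lof, LinearMap.comp_apply]
  refine ⟨Φ, ?_, ?_⟩
  · intro m f
    refine ⟨by rw [← hφ]; exact (φ m f).2, ?_⟩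
    rw [hΦ, PiTensorProduct.lift.tprod, DirectSum.lof_eq_of]
    congr 1
    exact Subtype.ext (hφ m f)
  · letI : AddCommGroup (⨁ m : Fin r → ℕ, ⨂[ℚ] u : Fin r, ↥(Aspace (β u) (iv u) (m u))) :=
      Module.addCommMonoidToAddCommGroup ℚ
    rw [injective_iff_map_eq_zero]
    intro x hx
    by_contra hx0
    have hne : (DFinsupp.support x).Nonempty := by
      rw [Finset.nonempty_iff_ne_empty, Ne, DFinsupp.support_eq_empty]
      exact hx0
    obtain ⟨m₀, hm₀, hmin⟩ := Finset.exists_min_image (DFinsupp.support x) (fun m => toLex m) hne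
    obtain ⟨K, fK, aK, j, z, hj, hz1, d, hd, hz2⟩ := eval_main' RD hiv m₀
    let ev : PolyQ n →ₗ[ℚ] K :=
      (aeval z : PolyQ n →ₐ[ℚ] K).toLinearMap
    let Ψ : (⨁ γ : Fin n → ℕ, ↥(Hspace γ)) →ₗ[ℚ] K :=
      DirectSum.toModule ℚ _ _ fun γ =>
        if γ = (fun v => ∑ u, m₀ u * β u v) then ev ∘ₗ (Hspace γ).subtype else 0
    have hΨ0 : ∀ γ h, γ ≠ (fun v => ∑ u, m₀ u * β u v) →
        Ψ (DirectSum.lof ℚ _ (fun γ : Fin n → ℕ => ↥(Hspace γ)) γ h) = 0 := by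
      intro γ h hγ
      simp only [Ψ, DirectSum.toModule_lof, if_neg hγ, LinearMap.zero_apply]
    have hΨ1 : ∀ γ h, γ = (fun v => ∑ u, m₀ u * β u v) →
        Ψ (DirectSum.lof ℚ _ (fun γ : Fin n → ℕ => ↥(Hspace γ)) γ h) = aeval z (h : PolyQ n) := by
      intro γ h hγ
      simp only [Ψ, DirectSum.toModule_lof, if_pos hγ]
      rfl
    have hA : ∀ m ∈ DFinsupp.support x, m ≠ m₀ → ∀ t, Ψ (Φ (DirectSum.of (fun m' : Fin r → ℕ =>
      ⨂[ℚ] u : Fin r, ↥(Aspace (β u) (iv u) (m' u))) m t)) = 0 := by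
      intro m hm hmm t
      rw [hΦ]
      by_cases hγ : (fun v => ∑ u, m u * β u v) = (fun v => ∑ u, m₀ u * β u v)
      · rw [hΨ1 _ _ hγ]
        have key : ev ∘ₗ (Hspace (fun v => ∑ u, m u * β u v)).subtype ∘ₗ PiTensorProduct.lift (φ m) = 0 := by
          apply PiTensorProduct.ext
          ext f
          simp only [LinearMap.compMultilinearMap_apply, LinearMap.comp_apply, PiTensorProduct.lift.tprod,
            LinearMap.zero_apply, Submodule.subtype_apply, hφ]
          refine hz1 m hmm ?_ ?_ _ (fun u => (f u).2.1)
          · intro v hv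
            by_contra hlt
            have h1 : toLex m < toLex m₀ := ⟨v, hv, not_le.mp hlt⟩
            exact absurd (hmin m hm) (not_le.mpr h1)
          · rw [off_gam, off_gam, hγ]
        exact congrArg (fun g => g t) key
      · exact hΨ0 _ _ hγ
    let G : (⨂[ℚ] u : Fin r, ↥(Aspace (β u) (iv u) (m₀ u))) →ₗ[ℚ] MvPolynomial (Fin r × ℕ) ℚ :=
      MB r ∘ₗ PiTensorProduct.map (fun u => snd_map (Aspace (β u) (iv u) (m₀ u)))
    have hG : Function.Injective G := by
      have h1 := map_inj (fun u => snd_map (Aspace (β u) (iv u) (m₀ u))) (fun u => snd_map_inj _ _ _)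
      exact MB_inj.comp h1
    have hB : ∀ t, Ψ (Φ (DirectSum.of (fun m' : Fin r → ℕ =>
      ⨂[ℚ] u : Fin r, ↥(Aspace (β u) (iv u) (m' u))) m₀ t)) = d * j (G t) := by
      intro t
      rw [hΦ, hΨ1 _ _ rfl]
      have key : ev ∘ₗ (Hspace (fun v => ∑ u, m₀ u * β u v)).subtype ∘ₗ PiTensorProduct.lift (φ m₀) =
          LinearMap.mulLeft ℚ d ∘ₗ j.toLinearMap ∘ₗ G := by
        apply PiTensorProduct.ext
        ext f
        simp only [LinearMap.compMultilinearMap_apply, LinearMap.comp_apply, PiTensorProduct.lift.tprod,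
          Submodule.subtype_apply, hφ, LinearMap.mulLeft_apply, AlgHom.toLinearMap_apply, G, PiTensorProduct.map_tprod,
          MB_tprod, map_prod]
        refine (hz2 _ (fun u => (f u).2)).trans ?_
        congr 1
      exact congrArg (fun g => g t) key
    have hsum := DirectSum.sum_support_of x
    have h0 : Ψ (Φ x) = 0 := by rw [hx, map_zero]
    rw [← hsum, map_sum, map_sum, Finset.sum_eq_single m₀ (fun m hm hmm => hA m hm hmm _)
      (fun h => absurd hm₀ h), hB] at h0
    have h1 := (mul_eq_zero.mp h0).resolve_left hd
    have h2 : G (x m₀) = 0 := hj (h1.trans (map_zero j).symm)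
    have h3 : x m₀ = 0 := hG (h2.trans (map_zero G).symm)
    exact (DFinsupp.mem_support_iff.mp hm₀) h3
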